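/- Let S¹ = N(σ_0¹, …, σ_{m₁}¹) and S² = N(σ_0², …, σ_{m₂}²) be two Nikishin systems with σ_0¹ = σ_0², let n = (n_1; n_2) with |n_1| = |n_2| + 1, let A_n be a mixed type vector polynomial relative to (S¹, S², n), and let 𝒜_n = a_{n,0} + Σ_{k=1}^{m₁} a_{n,k}·ŝ¹_{1,k} be its linear form. Then there exist a permutation λ₂ of {0, …, m₂} with n_{2,λ₂(0)} ≥ ⋯ ≥ n_{2,λ₂(m₂)} and measures ρ_1², …, ρ_{m₂}² with ρ_k² ∈ M(Δ_k') for some interval Δ_k' ⊆ Δ_k², forming a Nikishin system N(ρ_1², …, ρ_{m₂}²) with the property that every form p_0 + Σ_{k=1}^{m₂} p_k·ŝ²_{1,k} with deg p_k ≤ n_{2,k} − 1 can be written on ℂ ∖ Δ_1² as (q_0 + Σ_{k=1}^{m₂} q_k·r̂²_{1,k})·ŝ²_{1,λ₂(0)} with real polynomials deg q_k ≤ n_{2,λ₂(k)} − 1 (here r²_{1,k} = ⟨ρ_1², …, ρ_k²⟩ and ŝ²_{1,0} ≡ 1), such that, defining ρ_0² by dρ_0²(x) = ŝ²_{1,λ₂(0)}(x)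 dσ_0²(x) and r²_{0,k} := ⟨ρ_0², ρ_1², …, ρ_k²⟩, one has ∫ x^ν · 𝒜_n(x) dr²_{0,k}(x) = 0 for all ν = 0, …, n_{2,λ₂(k)} − 1 and all k = 0, …, m₂. -/

import Mathlib

open MeasureTheory Set Polynomial Filter

noncomputable section

/-- A signed Borel measure on `ℝ`, represented by a pair of (nonnegative) measures
(a "positive part" and a "negative part"). -/
structure SignedM where
  pos : MeasureTheory.Measure ℝ
  neg : MeasureTheory.Measure ℝ

namespace SignedM

/-- Integral of a complex-valued function against a signed measure. -/
def cintegral (s : SignedM) (f : ℝ → ℂ) : ℂ :=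
  (∫ x, f x ∂s.pos) - ∫ x, f x ∂s.neg

/-- Integral of a real-valued function against a signed measure. -/
def rintegral (s : SignedM) (f : ℝ → ℝ) : ℝ :=
  (∫ x, f x ∂s.pos) - ∫ x, f x ∂s.neg

/-- The Cauchy transform `ŝ(z) = ∫ ds(x)/(z - x)` at a complex point. -/
def cauchy (s : SignedM) (z : ℂ) : ℂ :=
  s.cintegral fun x => (z - (x : ℂ))⁻¹

/-- The Cauchy transform at a real point (real-valued). -/
def cauchyR (s : SignedM) (x : ℝ) : ℝ :=
  s.rintegral fun t => (x - t)⁻¹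

/-- The total variation `|s|` (for the constant-sign representation used here). -/
def mass (s : SignedM) : ℝ :=
  (s.pos Set.univ).toReal + (s.neg Set.univ).toReal

/-- The (topological) support of a nonnegative measure. -/
def msupport (μ : MeasureTheory.Measure ℝ) : Set ℝ :=
  {x | ∀ U : Set ℝ, IsOpen U → x ∈ U → μ U ≠ 0}

/-- The support of a signed measure. -/
def supp (s : SignedM) : Set ℝ := msupport s.pos ∪ msupport s.neg

/-- The signed measure `g·s` with (real, possibly sign-changing) density `g` w.r.t. `s`. -/
def withDensityR (s : SignedM) (g : ℝ → ℝ) : SignedM where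
  pos := s.pos.withDensity (fun x => ENNReal.ofReal (g x)) +
    s.neg.withDensity (fun x => ENNReal.ofReal (-g x))
  neg := s.pos.withDensity (fun x => ENNReal.ofReal (-g x)) +
    s.neg.withDensity (fun x => ENNReal.ofReal (g x))

/-- The product `⟨a, b⟩`: the measure with density `b̂` with respect to `a`. -/
def nik (a b : SignedM) : SignedM := a.withDensityR b.cauchyR

end SignedM

/-- `s ∈ M(Δ)`: a finite Borel measure with constant sign, whose support is compact and
consists of infinitely many points, `Δ` being the smallest closed interval containing it. -/
structure IsM (s : SignedM) (Δ : Set ℝ) : Prop where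
  posFinite : MeasureTheory.IsFiniteMeasure s.pos
  negFinite : MeasureTheory.IsFiniteMeasure s.neg
  constSign : s.pos = 0 ∨ s.neg = 0
  compactSupp : IsCompact s.supp
  infiniteSupp : s.supp.Infinite
  hullEq : Δ = Set.Icc (sInf s.supp) (sSup s.supp)

/-- A set of reals, viewed inside `ℂ`. -/
def cSet (Δ : Set ℝ) : Set ℂ := (fun x : ℝ => (x : ℂ)) '' Δ

/-- `τ` is the inverse measure of `s`: `1/ŝ(z) = z/|s| + b + τ̂(z)` on `ℂ ∖ Δ`. -/
def IsInverse (s τ : SignedM) (Δ : Set ℝ) : Prop :=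
  ∃ b : ℝ, ∀ z : ℂ, z ∉ cSet Δ →
    (s.cauchy z)⁻¹ = z / (s.mass : ℂ) + (b : ℂ) + τ.cauchy z

/-- The iterated products `s_{j,k} = ⟨σ_j, σ_{j+1}, …, σ_k⟩` of a Nikishin system
(`s_{j,k} = σ_j` when `j ≥ k`). -/
def nikSys (σ : ℕ → SignedM) : ℕ → ℕ → SignedM
  | j, k => if h : j < k then (σ j).nik (nikSys σ (j + 1) k) else σ j
  termination_by j k => k - j
  decreasing_by omega

/-- `ŝ_{1,k}` as a real function, with the convention `ŝ_{1,0} ≡ 1`. -/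
def sh1R (σ : ℕ → SignedM) (k : ℕ) (x : ℝ) : ℝ :=
  if k = 0 then 1 else (nikSys σ 1 k).cauchyR x

/-- `ŝ_{1,k}` as a complex function, with the convention `ŝ_{1,0} ≡ 1`. -/
def sh1C (σ : ℕ → SignedM) (k : ℕ) (z : ℂ) : ℂ :=
  if k = 0 then 1 else (nikSys σ 1 k).cauchy z

/-- `A = (a_0, …, a_{m₁})` is a mixed type vector polynomial relative to the pair of
Nikishin systems generated by `σ1 = (σ₀¹, …, σ_{m₁}¹)` and `σ2 = (σ₀², …, σ_{m₂}²)`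
(with `σ₀¹ = σ₀²`) and the multi-index `n = (n1; n2)`: the `a_k` are real polynomials,
not all zero, `deg a_k ≤ n_{1,k} − 1`, and for each `i ≤ m₂` there is a polynomial `d_i`
with `Σ_k a_k(z) ∫ ŝ²_{1,i}(x) ŝ¹_{1,k}(x) dσ₀²(x)/(z−x) − d_i(z) = O(1/z^{n_{2,i}+1})`. -/
def IsMixedVP (σ1 σ2 : ℕ → SignedM) (m1 m2 : ℕ) (n1 n2 : ℕ → ℕ)
    (a : ℕ → Polynomial ℝ) : Prop :=
  (¬ ∀ k ≤ m1, a k = 0) ∧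
  (∀ k ≤ m1, (a k).degree < (n1 k : WithBot ℕ)) ∧
  (∀ i ≤ m2, ∃ d : Polynomial ℝ, ∃ C R : ℝ, ∀ z : ℂ, R ≤ ‖z‖ →
    ‖(∑ k ∈ Finset.range (m1 + 1), aeval z (a k) *
        (σ2 0).cintegral (fun x =>
          ((sh1R σ2 i x * sh1R σ1 k x : ℝ) : ℂ) * (z - (x : ℂ))⁻¹)) -
      aeval z d‖ ≤ C / ‖z‖ ^ (n2 i + 1))

open scoped Topology

/-- `μ` is a finite measure living on the compact set `I`. -/
structure Concentrated (I : Set ℝ) (μ : Measure ℝ) : Prop where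
  isCompact : IsCompact I
  isFinite : IsFiniteMeasure μ
  null : μ Iᶜ = 0

/-- Cauchy transform of the measure `w μ`. -/
def ct (μ : Measure ℝ) (w : ℝ → ℝ) (z : ℂ) : ℂ := ∫ x, (w x : ℂ) * (z - (x : ℂ))⁻¹ ∂μ

/-- Cauchy transform of the measure `w μ` at real points. -/
def ctR (μ : Measure ℝ) (w : ℝ → ℝ) (t : ℝ) : ℝ := ∫ x, w x * (t - x)⁻¹ ∂μ

lemma ct_ofReal (μ : Measure ℝ) (w : ℝ → ℝ) (t : ℝ) : ct μ w t = (ctR μ w t : ℂ) := by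
  rw [ct, ctR, ← integral_complex_ofReal]
  congr 1; ext x; push_cast; rfl

/-- The non-real complex numbers. -/
def nonreal : Set ℂ := {z | z.im ≠ 0}

lemma ofReal_mem_cSet {I : Set ℝ} {x : ℝ} : (x : ℂ) ∈ cSet I ↔ x ∈ I := by
  simp [cSet]

lemma notMem_cSet_of_nonreal {I : Set ℝ} {z : ℂ} (hz : z ∈ nonreal) : z ∉ cSet I := by
  rintro ⟨x, _, rfl⟩
  exact hz (by simp)

lemma sub_ofReal_ne {I : Set ℝ} {z : ℂ} (hz : z ∉ cSet I) {x : ℝ} (hx : x ∈ I) :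
    z - (x : ℂ) ≠ 0 := by
  intro h
  exact hz ⟨x, hx, (sub_eq_zero.1 h).symm⟩

lemma isOpen_compl_cSet {I : Set ℝ} (hI : IsCompact I) : IsOpen (cSet I)ᶜ :=
  (hI.image Complex.continuous_ofReal).isClosed.isOpen_compl

namespace Concentrated

variable {I K : Set ℝ} {μ ν : Measure ℝ}

lemma ae_mem (h : Concentrated I μ) : ∀ᵐ x ∂μ, x ∈ I := by
  rw [ae_iff]; exact h.null

lemma restrict_eq (h : Concentrated I μ) : μ.restrict I = μ :=
  Measure.restrict_eq_self_of_ae_mem h.ae_mem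

lemma integrable {E : Type*} [NormedAddCommGroup E] [NormedSpace ℝ E]
    (h : Concentrated I μ) {f : ℝ → E} (hf : ContinuousOn f I) : Integrable f μ := by
  have := h.isFinite
  rw [← h.restrict_eq]
  exact hf.integrableOn_compact h.isCompact

lemma integral_congr {E : Type*} [NormedAddCommGroup E] [NormedSpace ℝ E]
    (h : Concentrated I μ) {f g : ℝ → E} (hfg : ∀ x ∈ I, f x = g x) :
    ∫ x, f x ∂μ = ∫ x, g x ∂μ :=
  integral_congr_ae (h.ae_mem.mono hfg)

lemma continuousOn_kernel {z : ℂ} (hz : z ∉ cSet I) :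
    ContinuousOn (fun x : ℝ => (z - (x : ℂ))⁻¹) I :=
  (continuous_const.sub Complex.continuous_ofReal).continuousOn.inv₀
    fun _ hx => sub_ofReal_ne hz hx

lemma continuousOn_kernelR {t : ℝ} (ht : t ∉ I) :
    ContinuousOn (fun x : ℝ => (t - x)⁻¹) I :=
  (continuous_const.sub continuous_id).continuousOn.inv₀
    fun x hx h => ht (by rw [show t = x from sub_eq_zero.1 h]; exact hx)

lemma continuousOn_ofReal {w : ℝ → ℝ} (hw : ContinuousOn w I) :
    ContinuousOn (fun x => (w x : ℂ)) I := Complex.continuous_ofReal.comp_continuousOn hw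

lemma integrable_ct (h : Concentrated I μ) {w : ℝ → ℝ} (hw : ContinuousOn w I) {z : ℂ}
    (hz : z ∉ cSet I) : Integrable (fun x => (w x : ℂ) * (z - (x : ℂ))⁻¹) μ :=
  h.integrable ((continuousOn_ofReal hw).mul (continuousOn_kernel hz))

lemma ct_congr (h : Concentrated I μ) {w v : ℝ → ℝ} (hwv : ∀ x ∈ I, w x = v x) (z : ℂ) :
    ct μ w z = ct μ v z :=
  h.integral_congr fun x hx => by rw [hwv x hx]

lemma ct_add (h : Concentrated I μ) {w v : ℝ → ℝ} (hw : ContinuousOn w I)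
    (hv : ContinuousOn v I) {z : ℂ} (hz : z ∉ cSet I) :
    ct μ (fun x => w x + v x) z = ct μ w z + ct μ v z := by
  rw [ct, ct, ct, ← integral_add (h.integrable_ct hw hz) (h.integrable_ct hv hz)]
  congr 1; ext x; push_cast; ring

end Concentrated

lemma ct_const_mul (μ : Measure ℝ) (c : ℝ) (w : ℝ → ℝ) (z : ℂ) :
    ct μ (fun x => c * w x) z = c * ct μ w z := by
  rw [ct, ct, ← integral_const_mul]
  congr 1; ext x; push_cast; ring

lemma ct_neg (μ : Measure ℝ) (w : ℝ → ℝ) (z : ℂ) :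
    ct μ (fun x => - w x) z = - ct μ w z := by
  rw [ct, ct, ← integral_neg]
  congr 1; ext x; push_cast; ring

namespace Concentrated

variable {I K : Set ℝ} {μ ν : Measure ℝ}

lemma ct_sum {ι : Type*} (h : Concentrated I μ) (s : Finset ι) {w : ι → ℝ → ℝ}
    (hw : ∀ i ∈ s, ContinuousOn (w i) I) {z : ℂ} (hz : z ∉ cSet I) :
    ct μ (fun x => ∑ i ∈ s, w i x) z = ∑ i ∈ s, ct μ (w i) z := by
  simp only [ct]
  rw [← integral_finsetSum s fun i hi => h.integrable_ct (hw i hi) hz]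
  congr 1; ext x; push_cast; rw [Finset.sum_mul]

lemma continuousAt_ct (h : Concentrated I μ) {w : ℝ → ℝ} (hw : ContinuousOn w I) {z : ℂ}
    (hz : z ∉ cSet I) : ContinuousAt (ct μ w) z := by
  obtain ⟨δ, hδ, hball⟩ := Metric.isOpen_iff.1 (isOpen_compl_cSet h.isCompact) z hz
  have key : ∀ z' ∈ Metric.ball z (δ / 2), ∀ x ∈ I, δ / 2 ≤ ‖z' - (x : ℂ)‖ := by
    intro z' hz' x hx
    by_contra hlt
    push Not at hlt
    apply hball (show (x : ℂ) ∈ Metric.ball z δ from ?_) ⟨x, hx, rfl⟩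
    rw [Metric.mem_ball] at *
    have := dist_triangle (x : ℂ) z' z
    rw [dist_comm (x : ℂ) z', dist_eq_norm z' (x : ℂ)] at this
    linarith
  refine continuousAt_of_dominated (bound := fun x => ‖w x‖ * (δ / 2)⁻¹) ?_ ?_ ?_ ?_
  · filter_upwards [(isOpen_compl_cSet h.isCompact).mem_nhds hz] with z' hz'
    exact (h.integrable_ct hw hz').aestronglyMeasurable
  · filter_upwards [Metric.ball_mem_nhds z (half_pos hδ)] with z' hz'
    filter_upwards [h.ae_mem] with x hx
    rw [norm_mul, norm_inv, Complex.norm_real]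
    gcongr
    exact key z' hz' x hx
  · exact h.integrable (hw.norm.mul continuousOn_const)
  · filter_upwards [h.ae_mem] with x hx
    exact continuousAt_const.mul
      ((continuousAt_id.sub continuousAt_const).inv₀ (sub_ofReal_ne hz hx))

lemma continuousAt_ctR (h : Concentrated I μ) {w : ℝ → ℝ} (hw : ContinuousOn w I) {t : ℝ}
    (ht : t ∉ I) : ContinuousAt (ctR μ w) t := by
  have h1 : ContinuousAt (fun t : ℝ => (ct μ w t).re) t :=
    Complex.continuous_re.continuousAt.comp
      (ContinuousAt.comp (f := fun t : ℝ => (t : ℂ)) (h.continuousAt_ct hw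
        (mt ofReal_mem_cSet.1 ht)) Complex.continuous_ofReal.continuousAt)
  simpa [ct_ofReal] using h1

lemma continuousOn_ctR (h : Concentrated I μ) {w : ℝ → ℝ} (hw : ContinuousOn w I)
    (hIK : Disjoint I K) : ContinuousOn (ctR μ w) K := fun _ ht =>
  (h.continuousAt_ctR hw (fun hI => hIK.le_bot ⟨hI, ht⟩)).continuousWithinAt

lemma integrable_prod {E : Type*} [NormedAddCommGroup E] [NormedSpace ℝ E]
    (h : Concentrated I μ) (h' : Concentrated K ν) {f : ℝ × ℝ → E}
    (hf : ContinuousOn f (I ×ˢ K)) : Integrable f (μ.prod ν) := by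
  have := h.isFinite
  have := h'.isFinite
  rw [← h.restrict_eq, ← h'.restrict_eq, Measure.prod_restrict]
  exact hf.integrableOn_compact (h.isCompact.prod h'.isCompact)

lemma ct_mul (h : Concentrated I μ) (h' : Concentrated K ν) (hIK : Disjoint I K)
    {w v : ℝ → ℝ} (hw : ContinuousOn w I) (hv : ContinuousOn v K) {z : ℂ}
    (hz : z ∉ cSet I) (hz' : z ∉ cSet K) :
    ct μ w z * ct ν v z =
      ct μ (fun x => w x * ctR ν v x) z + ct ν (fun y => v y * ctR μ w y) z := by
  have := h.isFinite
  have := h'.isFinite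
  have hne : ∀ x ∈ I, ∀ y ∈ K, (y : ℂ) - x ≠ 0 := fun x hx y hy =>
    sub_ofReal_ne (I := I) (z := (y : ℂ))
      (fun hh => hIK.le_bot ⟨ofReal_mem_cSet.1 hh, hy⟩) hx
  have hne' : ∀ x ∈ I, ∀ y ∈ K, (x : ℂ) - y ≠ 0 := fun x hx y hy =>
    fun hh => hne x hx y hy (by rw [← neg_sub, hh, neg_zero])
  set F : ℝ → ℝ → ℂ := fun x y =>
    (w x : ℂ) * (v y : ℂ) * (((y : ℂ) - x)⁻¹ * (z - y)⁻¹) with hF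
  have hFc : ContinuousOn (Function.uncurry F) (I ×ˢ K) := by
    have hw' : ContinuousOn (fun p : ℝ × ℝ => (w p.1 : ℂ)) (I ×ˢ K) :=
      (continuousOn_ofReal hw).comp continuousOn_fst fun p hp => hp.1
    have hv' : ContinuousOn (fun p : ℝ × ℝ => (v p.2 : ℂ)) (I ×ˢ K) :=
      (continuousOn_ofReal hv).comp continuousOn_snd fun p hp => hp.2
    refine (hw'.mul hv').mul (ContinuousOn.mul ?_ ?_)
    · refine ContinuousOn.inv₀ (by fun_prop) fun p hp => hne p.1 hp.1 p.2 hp.2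
    · refine ContinuousOn.inv₀ (by fun_prop) fun p hp => sub_ofReal_ne hz' hp.2
  have hFint : Integrable (Function.uncurry F) (μ.prod ν) := h.integrable_prod h' hFc
  have hRw := h'.continuousOn_ctR hv hIK.symm
  have e1 : ∀ x ∈ I, (w x : ℂ) * (z - (x : ℂ))⁻¹ * ct ν v z =
      ((w x * ctR ν v x : ℝ) : ℂ) * (z - (x : ℂ))⁻¹ + ∫ y, F x y ∂ν := by
    intro x hx
    have hxK : x ∉ K := fun hh => hIK.le_bot ⟨hx, hh⟩
    have hxK' : (x : ℂ) ∉ cSet K := fun hh => hxK (ofReal_mem_cSet.1 hh)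
    have r1 : (w x : ℂ) * (z - (x : ℂ))⁻¹ * ct ν v z =
        ∫ y, (w x : ℂ) * (z - (x : ℂ))⁻¹ * ((v y : ℂ) * (z - (y : ℂ))⁻¹) ∂ν := by
      rw [ct, integral_const_mul]
    have r2 : ((w x * ctR ν v x : ℝ) : ℂ) * (z - (x : ℂ))⁻¹ =
        ∫ y, (w x : ℂ) * (z - (x : ℂ))⁻¹ * ((v y : ℂ) * ((x : ℂ) - (y : ℂ))⁻¹) ∂ν := by
      rw [integral_const_mul, Complex.ofReal_mul, ← ct_ofReal, ct]
      ring
    rw [r1, r2, ← integral_add]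
    · refine h'.integral_congr fun y hy => ?_
      have h1 := hne x hx y hy
      have h2 := hne' x hx y hy
      have h3 := sub_ofReal_ne hz hx
      have h4 := sub_ofReal_ne hz' hy
      simp only [hF]
      have : (z - x)⁻¹ * (z - y)⁻¹ =
          ((x : ℂ) - y)⁻¹ * (z - x)⁻¹ + ((y : ℂ) - x)⁻¹ * (z - y)⁻¹ := by
        have : (y : ℂ) - x = -((x : ℂ) - y) := by ring
        rw [this]
        field_simp
        ring
      linear_combination (w x : ℂ) * (v y : ℂ) * this
    · exact (h'.integrable_ct hv hxK').const_mul _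
    · refine h'.integrable (hFc.comp (by fun_prop : ContinuousOn (fun y : ℝ => (x, y)) K)
        fun y hy => ⟨hx, hy⟩)
  have e2 : ∀ y ∈ K, ∫ x, F x y ∂μ = ((v y * ctR μ w y : ℝ) : ℂ) * (z - (y : ℂ))⁻¹ := by
    intro y hy
    push_cast
    rw [← ct_ofReal, ct, ← integral_const_mul, ← integral_mul_const]
    congr 1; ext x; simp only [hF]; ring
  calc ct μ w z * ct ν v z
      = ∫ x, (w x : ℂ) * (z - (x : ℂ))⁻¹ * ct ν v z ∂μ := by
        rw [integral_mul_const]; rfl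
    _ = ∫ x, (((w x * ctR ν v x : ℝ) : ℂ) * (z - (x : ℂ))⁻¹ + ∫ y, F x y ∂ν) ∂μ :=
        h.integral_congr e1
    _ = ct μ (fun x => w x * ctR ν v x) z + ∫ x, ∫ y, F x y ∂ν ∂μ :=
        integral_add (h.integrable_ct (hw.mul hRw) hz) hFint.integral_prod_left
    _ = _ := by
        rw [integral_integral_swap hFint, h'.integral_congr e2, ct]; rfl

lemma mul_ct (h : Concentrated I μ) {w : ℝ → ℝ} (hw : ContinuousOn w I) {z : ℂ}
    (hz : z ∉ cSet I) :
    z * ct μ w z = ct μ (fun x => x * w x) z + ((∫ x, w x ∂μ : ℝ) : ℂ) := by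
  rw [ct, ct, ← integral_const_mul, ← integral_complex_ofReal, ← integral_add]
  · refine h.integral_congr fun x hx => ?_
    have := sub_ofReal_ne hz hx
    push_cast
    field_simp
    ring
  · exact h.integrable_ct (w := fun x => x * w x) (continuousOn_id.mul hw) hz
  · exact h.integrable (continuousOn_ofReal hw)

lemma poly_mul_ct (h : Concentrated I μ) (n : ℕ) (p : ℝ[X]) (hp : p.degree < n) {w : ℝ → ℝ}
    (hw : ContinuousOn w I) : ∃ E : ℝ[X], E.degree < n ∧ ∀ z ∉ cSet I,
      aeval z p * ct μ w z = aeval z E + ct μ (fun x => p.eval x * w x) z := by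
  obtain ⟨N, hN⟩ : ∃ N, p.natDegree ≤ N := ⟨_, le_rfl⟩
  induction N generalizing p w with
  | zero =>
    obtain ⟨c, rfl⟩ : ∃ c, p = C c := ⟨_, eq_C_of_natDegree_le_zero hN⟩
    refine ⟨0, by simp, fun z hz => ?_⟩
    simp [ct_const_mul]
  | succ N ih =>
    have hd : p.divX.degree < n := lt_of_le_of_lt (by
      by_cases h0 : p = 0
      · simp [h0]
      · exact (degree_divX_lt h0).le) hp
    have hxw : ContinuousOn (fun x => x * w x) I := continuousOn_id.mul hw
    obtain ⟨E, hE, hE'⟩ := ih p.divX hd hxw (by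
      rw [natDegree_divX_eq_natDegree_tsub_one]; omega)
    refine ⟨E + C (∫ x, w x ∂μ) * p.divX, ?_, fun z hz => ?_⟩
    · refine lt_of_le_of_lt (degree_add_le _ _) (max_lt hE ?_)
      refine lt_of_le_of_lt (degree_mul_le _ _) ?_
      refine lt_of_le_of_lt (add_le_add_left degree_C_le _) ?_
      simpa using hd
    · have h1 : aeval z p = aeval z p.divX * z + (p.coeff 0 : ℂ) := by
        conv_lhs => rw [← divX_mul_X_add p]
        simp
      have h2 : ct μ (fun x => p.eval x * w x) z =
          ct μ (fun x => p.divX.eval x * (x * w x)) z + p.coeff 0 * ct μ w z := by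
        rw [← ct_const_mul, ← h.ct_add (w := fun x => p.divX.eval x * (x * w x))
          (p.divX.continuous.continuousOn.mul hxw)
          (v := fun x => p.coeff 0 * w x) (continuousOn_const.mul hw) hz]
        congr 1; ext x
        conv_lhs => rw [← divX_mul_X_add p]
        simp; ring
      have h3 := hE' z hz
      have h4 := h.mul_ct hw hz
      rw [h1, h2]
      simp only [map_add, map_mul, aeval_C, Complex.coe_algebraMap]
      linear_combination h3 + aeval z p.divX * h4

end Concentrated

lemma msupport_eq (μ : Measure ℝ) : SignedM.msupport μ = μ.support := by
  rw [Measure.support_eq_forall_isOpen]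
  ext x
  simp only [SignedM.msupport, mem_ofPred_eq, pos_iff_ne_zero]
  exact ⟨fun h U hx hU => h U hU hx, fun h U hU hx => h U hx hU⟩

/-- `w μ` is a measure of constant sign with infinite support living on the interval `I`, with a
continuous nonvanishing density `w`. -/
structure Weighted (I : Set ℝ) (μ : Measure ℝ) (w : ℝ → ℝ) : Prop extends Concentrated I μ where
  ordConnected : I.OrdConnected
  infinite : μ.support.Infinite
  continuousOn : ContinuousOn w I
  ne_zero : ∀ x ∈ I, w x ≠ 0

namespace Concentrated

variable {I : Set ℝ} {μ : Measure ℝ}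

lemma support_subset (h : Concentrated I μ) : μ.support ⊆ I :=
  Measure.support_subset_of_isClosed h.isCompact.isClosed h.ae_mem

lemma integral_pos (h : Concentrated I μ) (hμ : μ ≠ 0) {f : ℝ → ℝ} (hf : ContinuousOn f I)
    (hpos : ∀ x ∈ I, 0 < f x) : 0 < ∫ x, f x ∂μ := by
  rw [integral_pos_iff_support_of_nonneg_ae (h.ae_mem.mono fun x hx => (hpos x hx).le)
    (h.integrable hf)]
  refine lt_of_lt_of_le (b := μ I) ?_ (measure_mono fun x hx => (hpos x hx).ne')
  rw [pos_iff_ne_zero]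
  intro h0
  apply hμ
  rw [← Measure.measure_univ_eq_zero, ← union_compl_self I]
  exact measure_union_null h0 h.null

end Concentrated

lemma exists_sign {I : Set ℝ} (hI : I.OrdConnected) {w : ℝ → ℝ} (hw : ContinuousOn w I)
    (h0 : ∀ x ∈ I, w x ≠ 0) :
    ∃ ε : ℝ, (ε = 1 ∨ ε = -1) ∧ ∀ x ∈ I, 0 < ε * w x := by
  by_cases hneg : ∃ x ∈ I, w x < 0
  · obtain ⟨x, hx, hwx⟩ := hneg
    refine ⟨-1, Or.inr rfl, fun y hy => ?_⟩
    by_contra hy'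
    have hy0 : 0 ≤ w y := by linarith
    obtain ⟨t, ht, ht0⟩ := hI.isPreconnected.intermediate_value hx hy hw ⟨hwx.le, hy0⟩
    exact h0 t ht ht0
  · push Not at hneg
    refine ⟨1, Or.inl rfl, fun y hy => ?_⟩
    rw [one_mul]
    exact lt_of_le_of_ne (hneg y hy) (h0 y hy).symm

namespace Weighted

variable {I K : Set ℝ} {μ : Measure ℝ} {w : ℝ → ℝ}

lemma ne_zero_measure (h : Weighted I μ w) : μ ≠ 0 :=
  Measure.nonempty_support_iff.1 h.infinite.nonempty

lemma with_weight (h : Weighted I μ w) {v : ℝ → ℝ} (hv : ContinuousOn v I)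
    (h0 : ∀ x ∈ I, v x ≠ 0) : Weighted I μ v :=
  { h with continuousOn := hv, ne_zero := h0 }

lemma integral_ne_zero (h : Weighted I μ w) : ∫ x, w x ∂μ ≠ 0 := by
  obtain ⟨ε, hε, hpos⟩ := exists_sign h.ordConnected h.continuousOn h.ne_zero
  have := h.toConcentrated.integral_pos h.ne_zero_measure
    (f := fun x => ε * w x) (continuousOn_const.mul h.continuousOn) hpos
  rw [integral_const_mul] at this
  intro h0
  rw [h0, mul_zero] at this
  exact lt_irrefl _ this

lemma ctR_ne_zero (h : Weighted I μ w) {t : ℝ} (ht : t ∉ I) : ctR μ w t ≠ 0 :=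
  (h.with_weight (h.continuousOn.mul (Concentrated.continuousOn_kernelR ht))
    fun x hx => mul_ne_zero (h.ne_zero x hx)
      (inv_ne_zero fun h0 => ht (by rwa [sub_eq_zero.1 h0]))).integral_ne_zero

lemma const_add_ct_ne_zero (h : Weighted I μ w) (C : ℝ) {z : ℂ} (hz : z ∈ nonreal) :
    (C : ℂ) + ct μ w z ≠ 0 := by
  have hz' : z ∉ cSet I := notMem_cSet_of_nonreal hz
  have hker : ContinuousOn (fun x : ℝ => (Complex.normSq (z - x))⁻¹) I :=
    (Complex.continuous_normSq.comp
      (continuous_const.sub Complex.continuous_ofReal)).continuousOn.inv₀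
      fun x hx => by simpa using sub_ofReal_ne hz' hx
  have h1 := (h.with_weight (h.continuousOn.mul hker) fun x hx =>
    mul_ne_zero (h.ne_zero x hx) (inv_ne_zero (by
      simpa using sub_ofReal_ne hz' hx))).integral_ne_zero
  have him : (ct μ w z).im = -z.im * ∫ x, w x * (Complex.normSq (z - x))⁻¹ ∂μ := by
    rw [ct, ← RCLike.im_eq_complex_im,
      ← integral_im (h.integrable_ct h.continuousOn hz'), ← integral_const_mul]
    congr 1; ext x
    simp [div_eq_mul_inv]
    ring
  intro h0
  have := congrArg Complex.im h0
  simp only [Complex.add_im, Complex.ofReal_im, zero_add, Complex.zero_im, him] at this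
  exact mul_ne_zero (neg_ne_zero.2 hz) h1 this

lemma ct_ne_zero (h : Weighted I μ w) {z : ℂ} (hz : z ∈ nonreal) : ct μ w z ≠ 0 := by
  simpa using h.const_add_ct_ne_zero 0 hz

end Weighted

/-- The filter of points `i y`, `y → +∞`. -/
def imInfty : Filter ℂ := map (fun y : ℝ => (y : ℂ) * Complex.I) atTop

instance : imInfty.NeBot := by unfold imInfty; infer_instance

lemma eventually_nonreal : ∀ᶠ z in imInfty, z ∈ nonreal := by
  rw [imInfty, eventually_map]
  filter_upwards [eventually_gt_atTop 0] with y hy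
  simpa [nonreal] using hy.ne'

lemma tendsto_inv_imInfty : Tendsto (fun z : ℂ => z⁻¹) imInfty (𝓝 0) := by
  rw [imInfty, tendsto_map'_iff, tendsto_zero_iff_norm_tendsto_zero]
  refine tendsto_inv_atTop_zero.congr' ?_
  filter_upwards [eventually_gt_atTop (0 : ℝ)] with y hy
  simp [abs_of_pos hy]

lemma norm_ct_le (μ : Measure ℝ) (w : ℝ → ℝ) (hw : Integrable w μ) {z : ℂ}
    (hz : z ∈ nonreal) : ‖ct μ w z‖ ≤ (∫ x, |w x| ∂μ) * |z.im|⁻¹ := by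
  rw [← integral_mul_const]
  refine norm_integral_le_of_norm_le (hw.abs.mul_const _) (ae_of_all _ fun x => ?_)
  rw [norm_mul, norm_inv, Complex.norm_real, Real.norm_eq_abs]
  gcongr
  · exact abs_pos.2 hz
  · simpa using Complex.abs_im_le_norm (z - x)

lemma Concentrated.tendsto_ct {I : Set ℝ} {μ : Measure ℝ} (h : Concentrated I μ) {w : ℝ → ℝ}
    (hw : ContinuousOn w I) : Tendsto (ct μ w) imInfty (𝓝 0) := by
  rw [tendsto_zero_iff_norm_tendsto_zero]
  have h1 : Tendsto (fun z : ℂ => (∫ x, |w x| ∂μ) * |z.im|⁻¹) imInfty (𝓝 0) := by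
    rw [imInfty, tendsto_map'_iff]
    have : Tendsto (fun y : ℝ => (∫ x, |w x| ∂μ) * |y|⁻¹) atTop (𝓝 ((∫ x, |w x| ∂μ) * 0)) :=
      (tendsto_inv_atTop_zero.comp tendsto_abs_atTop_atTop).const_mul _
    simpa [Function.comp_def] using this
  refine squeeze_zero' (Eventually.of_forall fun _ => norm_nonneg _) ?_ h1
  filter_upwards [eventually_nonreal] with z hz
  exact norm_ct_le μ w (h.integrable hw) hz

lemma Concentrated.tendsto_mul_ct {I : Set ℝ} {μ : Measure ℝ} (h : Concentrated I μ)
    {w : ℝ → ℝ} (hw : ContinuousOn w I) :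
    Tendsto (fun z => z * ct μ w z) imInfty (𝓝 ((∫ x, w x ∂μ : ℝ) : ℂ)) := by
  have h1 := (h.tendsto_ct (w := fun x => x * w x) (continuousOn_id.mul hw)).add
    (tendsto_const_nhds (x := ((∫ x, w x ∂μ : ℝ) : ℂ)))
  rw [zero_add] at h1
  refine h1.congr' ?_
  filter_upwards [eventually_nonreal] with z hz
  exact (h.mul_ct hw (notMem_cSet_of_nonreal hz)).symm

lemma Concentrated.coeff_of_tendsto {I : Set ℝ} {μ : Measure ℝ} (h : Concentrated I μ)
    {w : ℝ → ℝ} (hw : ContinuousOn w I) {α β : ℝ} {f : ℂ → ℂ} {L : ℂ}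
    (hf : ∀ z ∈ nonreal, f z = α * z + β + ct μ w z) (hL : Tendsto f imInfty (𝓝 L)) :
    α = 0 ∧ (β : ℂ) = L := by
  have h1 : Tendsto (fun z => f z * z⁻¹) imInfty (𝓝 (L * 0)) := hL.mul tendsto_inv_imInfty
  have h2 : Tendsto (fun z : ℂ => (α : ℂ) + (β + ct μ w z) * z⁻¹) imInfty
      (𝓝 ((α : ℂ) + (β + 0) * 0)) :=
    tendsto_const_nhds.add ((tendsto_const_nhds.add (h.tendsto_ct hw)).mul tendsto_inv_imInfty)
  have h3 : (α : ℂ) + (β + 0) * 0 = L * 0 := tendsto_nhds_unique_of_eventuallyEq h2 h1 (by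
    filter_upwards [eventually_nonreal] with z hz
    have hz0 : z ≠ 0 := fun h => hz (by simp [h])
    rw [hf z hz]
    field_simp
    ring)
  have hα : α = 0 := by simpa using h3
  refine ⟨hα, ?_⟩
  have h4 : Tendsto (fun z : ℂ => (β : ℂ) + ct μ w z) imInfty (𝓝 ((β : ℂ) + 0)) :=
    tendsto_const_nhds.add (h.tendsto_ct hw)
  rw [add_zero] at h4
  refine tendsto_nhds_unique_of_eventuallyEq h4 hL ?_
  filter_upwards [eventually_nonreal] with z hz
  rw [hf z hz, hα]; simp

/-- The real boundary value of `f` at a real point. -/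
def bval (f : ℂ → ℂ) (x : ℝ) : ℝ := (limUnder (𝓝[nonreal] (x : ℂ)) f).re

instance (x : ℝ) : (𝓝[nonreal] (x : ℂ)).NeBot := by
  rw [← mem_closure_iff_nhdsWithin_neBot, Metric.mem_closure_iff]
  intro ε hε
  refine ⟨x + (ε / 2 : ℝ) * Complex.I, ?_, ?_⟩
  · simpa [nonreal] using hε.ne'
  · simp [dist_eq_norm]
    rw [abs_of_pos hε]; linarith

lemma bval_eq {f : ℂ → ℂ} {x c : ℝ} (h : Tendsto f (𝓝[nonreal] (x : ℂ)) (𝓝 (c : ℂ))) :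
    bval f x = c := by
  rw [bval, h.limUnder_eq, Complex.ofReal_re]

/-- `f` has continuous real boundary values on `K`. -/
structure HasBval (f : ℂ → ℂ) (K : Set ℝ) : Prop where
  cont : ContinuousOn (bval f) K
  tendsto : ∀ x ∈ K, Tendsto f (𝓝[nonreal] (x : ℂ)) (𝓝 (bval f x : ℂ))

lemma hasBval_of_tendsto {f : ℂ → ℂ} {K : Set ℝ} {g : ℝ → ℝ} (hg : ContinuousOn g K)
    (h : ∀ x ∈ K, Tendsto f (𝓝[nonreal] (x : ℂ)) (𝓝 (g x : ℂ))) :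
    HasBval f K ∧ ∀ x ∈ K, bval f x = g x := by
  have h1 : ∀ x ∈ K, bval f x = g x := fun x hx => bval_eq (h x hx)
  exact ⟨⟨hg.congr h1, fun x hx => by rw [h1 x hx]; exact h x hx⟩, h1⟩

lemma HasBval.mul {f g h : ℂ → ℂ} {K : Set ℝ} (hf : HasBval f K) (hg : HasBval g K)
    (hh : ∀ z ∈ nonreal, h z = f z * g z) :
    HasBval h K ∧ ∀ x ∈ K, bval h x = bval f x * bval g x := by
  refine hasBval_of_tendsto (hf.cont.mul hg.cont) fun x hx => ?_
  push_cast
  refine ((hf.tendsto x hx).mul (hg.tendsto x hx)).congr' ?_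
  filter_upwards [self_mem_nhdsWithin] with z hz
  exact (hh z hz).symm

lemma hasBval_congr {f g : ℂ → ℂ} (h : ∀ z ∈ nonreal, f z = g z) : bval f = bval g := by
  ext x
  have : map f (𝓝[nonreal] (x : ℂ)) = map g (𝓝[nonreal] (x : ℂ)) := by
    refine Filter.map_congr ?_
    filter_upwards [self_mem_nhdsWithin] with z hz using h z hz
  rw [bval, bval, limUnder, limUnder, this]

lemma HasBval.mono {f : ℂ → ℂ} {K K' : Set ℝ} (h : HasBval f K) (hK : K' ⊆ K) :
    HasBval f K' := ⟨h.cont.mono hK, fun x hx => h.tendsto x (hK hx)⟩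

lemma hasBval_const (c : ℝ) (K : Set ℝ) {f : ℂ → ℂ} (hf : ∀ z ∈ nonreal, f z = c) :
    HasBval f K ∧ ∀ x ∈ K, bval f x = c := by
  refine hasBval_of_tendsto continuousOn_const fun x _ => ?_
  refine tendsto_const_nhds.congr' ?_
  filter_upwards [self_mem_nhdsWithin] with z hz
  exact (hf z hz).symm

lemma Concentrated.hasBval {I K : Set ℝ} {μ : Measure ℝ} (h : Concentrated I μ) {w : ℝ → ℝ}
    (hw : ContinuousOn w I) (hIK : Disjoint I K) {α β : ℝ} {f : ℂ → ℂ}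
    (hf : ∀ z ∈ nonreal, f z = α * z + β + ct μ w z) :
    HasBval f K ∧ ∀ x ∈ K, bval f x = α * x + β + ctR μ w x := by
  refine hasBval_of_tendsto (ContinuousOn.add (by fun_prop) (h.continuousOn_ctR hw hIK))
    fun x hx => ?_
  push_cast
  rw [← ct_ofReal]
  have hx' : (x : ℂ) ∉ cSet I := fun hh => hIK.le_bot ⟨ofReal_mem_cSet.1 hh, hx⟩
  have : ContinuousAt (fun z : ℂ => (α : ℂ) * z + β + ct μ w z) x :=
    ContinuousAt.add (by fun_prop) (h.continuousAt_ct hw hx')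
  refine (this.tendsto.mono_left nhdsWithin_le_nhds).congr' ?_
  filter_upwards [self_mem_nhdsWithin] with z hz
  exact (hf z hz).symm

lemma HasBval.ne_zero {f g : ℂ → ℂ} {K : Set ℝ} (hf : HasBval f K) (hg : HasBval g K)
    (h : ∀ z ∈ nonreal, f z * g z = 1) : ∀ x ∈ K, bval f x ≠ 0 := by
  intro x hx h0
  have h1 := (hf.mul hg fun z hz => (h z hz).symm : HasBval (fun _ => 1) K ∧ _).2 x hx
  rw [h0, zero_mul] at h1
  have h2 := (hasBval_const (f := fun _ => 1) 1 K fun z _ => by simp).2 x hx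
  exact one_ne_zero (h2.symm.trans h1)

section Operators

open scoped InnerProductSpace ComplexOrder CompactlySupported

variable {H : Type*} [NormedAddCommGroup H] [InnerProductSpace ℂ H] [CompleteSpace H]

/-- Spectral measure of a bounded self-adjoint operator. -/
lemma exists_spectral_measure {I : Set ℝ} (hI : IsCompact I) {Y : H →L[ℂ] H}
    (hY : IsSelfAdjoint Y) (hspec : spectrum ℝ Y ⊆ I) (v : H) :
    ∃ ν : Measure ℝ, Concentrated I ν ∧ ∀ z ∈ nonreal, ∀ u : H, z • u - Y u = v →
      ⟪v, u⟫_ℂ = ct ν (fun _ => 1) z := by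
  classical
  have : CompactSpace I := isCompact_iff_compactSpace.1 hI
  set φ := cfcHomSuperset hY hspec with hφ
  have hφid : φ ((ContinuousMap.id ℝ).restrict I) = Y := cfcHomSuperset_id hY hspec
  have hsa : ∀ g : C(I, ℝ), IsSelfAdjoint (φ g) := fun g =>
    (IsSelfAdjoint.all g).map φ
  have hreal : ∀ g : C(I, ℝ), ⟪v, φ g v⟫_ℂ = ((⟪v, φ g v⟫_ℂ).re : ℂ) := by
    intro g
    have h1 : ⟪φ g v, v⟫_ℂ = ⟪v, φ g v⟫_ℂ :=
      ((ContinuousLinearMap.isSelfAdjoint_iff_isSymmetric.1 (hsa g)) v v)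
    rw [eq_comm, ← Complex.conj_eq_iff_re, inner_conj_symm, h1]
  let L : C_c(I, ℝ) →ₗ[ℝ] ℝ :=
    { toFun := fun g => (⟪v, φ g.toContinuousMap v⟫_ℂ).re
      map_add' := fun f g => by
        have : (f + g).toContinuousMap = f.toContinuousMap + g.toContinuousMap := rfl
        rw [this, map_add, add_apply, inner_add_right, Complex.add_re]
      map_smul' := fun c g => by
        have : (c • g).toContinuousMap = c • g.toContinuousMap := rfl
        rw [this, map_smul, smul_apply]
        simp [inner_smul_right_eq_smul] }
  have hL : ∀ g, 0 ≤ g → 0 ≤ L g := by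
    intro g hg
    change 0 ≤ (⟪v, φ g.toContinuousMap v⟫_ℂ).re
    let s : C(I, ℝ) := ⟨fun x => Real.sqrt (g x), by fun_prop⟩
    have hs : g.toContinuousMap = s * s := by
      ext x
      exact (Real.mul_self_sqrt (hg x)).symm
    have h1 := (ContinuousLinearMap.isSelfAdjoint_iff_isSymmetric.1 (hsa s)) v (φ s v)
    rw [hs, map_mul]
    change 0 ≤ (⟪v, φ s (φ s v)⟫_ℂ).re
    have h2 : ⟪φ s v, φ s v⟫_ℂ = ⟪v, φ s (φ s v)⟫_ℂ := h1
    rw [← h2]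
    exact inner_self_nonneg (𝕜 := ℂ)
  let Λ : C_c(I, ℝ) →ₚ[ℝ] ℝ := PositiveLinearMap.mk₀ L hL
  set ν' : Measure I := RealRMK.rieszMeasure Λ with hν'
  have hΛ : ∀ g : C(I, ℝ), ∫ x, g x ∂ν' = (⟪v, φ g v⟫_ℂ).re := fun g =>
    RealRMK.integral_rieszMeasure Λ (CompactlySupportedContinuousMap.continuousMapEquiv g)
  have hfin : IsFiniteMeasure ν' := inferInstance
  have hemb : MeasurableEmbedding (Subtype.val : I → ℝ) :=
    MeasurableEmbedding.subtype_coe hI.measurableSet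
  refine ⟨ν'.map Subtype.val, ⟨hI, inferInstance, ?_⟩, fun z hz u hu => ?_⟩
  · rw [hemb.map_apply]
    simp
  have hz' : z ∉ cSet I := notMem_cSet_of_nonreal hz
  have hns : ∀ x : I, Complex.normSq (z - (x : ℝ)) ≠ 0 := fun x => by
    simpa using sub_ofReal_ne hz' x.2
  let h : C(I, ℝ) := ⟨fun x => (Complex.normSq (z - (x : ℝ)))⁻¹,
    (Complex.continuous_normSq.comp (by fun_prop)).inv₀ hns⟩
  let X : C(I, ℝ) := (ContinuousMap.id ℝ).restrict I
  have hu2 : u = φ h ((starRingEnd ℂ z) • v - Y v) := by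
    have e1 : (starRingEnd ℂ z) • v - Y v =
        Complex.normSq z • u - (2 * z.re) • Y u + Y (Y u) := by
      have h2 : (Complex.normSq z : ℂ) = starRingEnd ℂ z * z := by
        rw [mul_comm, Complex.mul_conj]
      have h3 : ((2 * z.re : ℝ) : ℂ) = z + starRingEnd ℂ z := by
        rw [Complex.add_conj]
      rw [← Complex.coe_smul (Complex.normSq z), ← Complex.coe_smul (2 * z.re), h2, h3, ← hu,
        map_sub, map_smul]
      module
    have e2 : h * (Complex.normSq z • 1 - (2 * z.re) • X + X * X) = 1 := by
      ext x
      have : Complex.normSq (z - (x : ℝ)) =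
          Complex.normSq z - 2 * z.re * x + x * x := by
        simp [Complex.normSq_apply]; ring
      have h1 := hns x
      rw [this] at h1
      simp [h, X, this]
      rw [inv_mul_cancel₀ h1]
    have e3 := congrArg (fun g => φ g u) e2
    simp only [map_mul, map_add, map_sub, map_smul, map_one, X, hφid,
      mul_apply_eq_comp, add_apply,
      sub_apply, smul_apply,
      one_apply_eq_self] at e3
    rw [e1, map_add, map_sub]
    exact e3.symm
  have e4 : φ h ((starRingEnd ℂ z) • v - Y v) = starRingEnd ℂ z • φ h v - φ (h * X) v := by
    rw [map_sub, map_smul, map_mul, hφid]; rfl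
  rw [hu2, e4, inner_sub_right, inner_smul_right, hreal h, hreal (h * X),
    ← hΛ, ← hΛ, ct, hemb.integral_map,
    ← integral_complex_ofReal, ← integral_complex_ofReal, ← integral_const_mul,
    ← integral_sub]
  · congr 1; ext x
    have h1 := sub_ofReal_ne hz' x.2
    have h2 : starRingEnd ℂ z - (x : ℝ) ≠ 0 := by
      intro h0
      apply h1
      have := congrArg (starRingEnd ℂ) h0
      simpa using this
    have h3 : (Complex.normSq (z - (x : ℝ)) : ℂ) = (z - (x : ℝ)) * (starRingEnd ℂ z - (x : ℝ)) := by
      rw [← Complex.mul_conj]; simp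
    simp only [h, X, ContinuousMap.mul_apply, ContinuousMap.coe_mk, Complex.ofReal_mul,
      Complex.ofReal_inv, h3, ContinuousMap.restrict_apply, ContinuousMap.id_apply,
      Complex.ofReal_one]
    field_simp
  · refine (Continuous.integrable_of_hasCompactSupport ?_ (HasCompactSupport.of_compactSpace _))
    fun_prop
  · refine (Continuous.integrable_of_hasCompactSupport ?_ (HasCompactSupport.of_compactSpace _))
    fun_prop

end Operators

section Operators

open scoped InnerProductSpace ComplexOrder

variable {H : Type*} [NormedAddCommGroup H] [InnerProductSpace ℂ H] [CompleteSpace H]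

lemma IsSelfAdjoint.inner_apply {T : H →L[ℂ] H} (hT : IsSelfAdjoint T) (x y : H) :
    ⟪T x, y⟫_ℂ = ⟪x, T y⟫_ℂ :=
  ContinuousLinearMap.isSelfAdjoint_iff_isSymmetric.1 hT x y

/-- The operator `x ↦ ⟪e, x⟫ e`. -/
def rankOneOp (e : H) : H →L[ℂ] H := (innerSL ℂ e).smulRight e

lemma rankOneOp_apply (e x : H) : rankOneOp e x = ⟪e, x⟫_ℂ • e := rfl

lemma isSelfAdjoint_rankOneOp (e : H) : IsSelfAdjoint (rankOneOp e) := by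
  rw [ContinuousLinearMap.isSelfAdjoint_iff_isSymmetric]
  intro x y
  change ⟪rankOneOp e x, y⟫_ℂ = ⟪x, rankOneOp e y⟫_ℂ
  rw [rankOneOp_apply, rankOneOp_apply, inner_smul_left, inner_smul_right, inner_conj_symm,
    mul_comm]

lemma exists_measure_rank_one_perturbation {I : Set ℝ} (hI : IsCompact I) {T : H →L[ℂ] H}
    (hT : IsSelfAdjoint T) (e : H) (κ : ℝ)
    (hres : ∀ t : ℝ, t ∉ I → ∃ S : H →L[ℂ] H, IsSelfAdjoint S ∧
      (∀ u, (t : ℂ) • S u - T (S u) = u) ∧ 1 + κ * ⟪e, S e⟫_ℂ ≠ 0) :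
    ∃ ν : Measure ℝ, Concentrated I ν ∧ ∀ z ∈ nonreal, ∀ r : H, z • r - T r = e →
      1 + κ * ⟪e, r⟫_ℂ ≠ 0 → ⟪e, r⟫_ℂ * (1 + κ * ⟪e, r⟫_ℂ)⁻¹ = ct ν (fun _ => 1) z := by
  set Y : H →L[ℂ] H := T - κ • rankOneOp e with hYdef
  have hYapp : ∀ u, Y u = T u - ((κ : ℂ) * ⟪e, u⟫_ℂ) • e := fun u => by
    rw [hYdef, sub_apply, smul_apply, rankOneOp_apply, ← Complex.coe_smul, smul_smul]
  have hY : IsSelfAdjoint Y := hT.sub ((IsSelfAdjoint.all κ).smul (isSelfAdjoint_rankOneOp e))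
  have hspec : spectrum ℝ Y ⊆ I := by
    intro t ht
    by_contra htI
    obtain ⟨S, hS, hTS, hne⟩ := hres t htI
    apply ht
    set G := ⟪e, S e⟫_ℂ with hG
    have hright : ∀ u, ∃ y, (t : ℂ) • y - Y y = u ∧
        y = S u - ((1 + κ * G)⁻¹ * κ * ⟪e, S u⟫_ℂ) • S e := by
      intro u
      refine ⟨_, ?_, rfl⟩
      rw [hYapp, map_sub, map_smul, inner_sub_right, inner_smul_right, ← hG]
      have h1 := hTS u
      have h2 := hTS e
      have h4 : (t : ℂ) • S e = e + T (S e) := by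
        rw [sub_eq_iff_eq_add] at h2; exact h2
      have h3' : (t : ℂ) • S u = u + T (S u) := by
        rw [sub_eq_iff_eq_add] at h1; exact h1
      rw [smul_sub, smul_comm, h3', h4]
      have h5 : (κ : ℂ) * (⟪e, S u⟫_ℂ - (1 + κ * G)⁻¹ * κ * ⟪e, S u⟫_ℂ * G) =
          (1 + κ * G)⁻¹ * κ * ⟪e, S u⟫_ℂ := by
        field_simp
        ring
      rw [h5]
      module
    have hR : (algebraMap ℝ (H →L[ℂ] H) t - Y) *
        (S - ((1 + κ * G)⁻¹ * κ) • ((innerSL ℂ e).comp S).smulRight (S e)) = 1 := by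
      ext u
      obtain ⟨y, hy, hy'⟩ := hright u
      have : (S - ((1 + κ * G)⁻¹ * κ) • ((innerSL ℂ e).comp S).smulRight (S e)) u = y := by
        rw [hy', sub_apply, smul_apply, mul_smul _ ⟪e, S u⟫_ℂ]
        rfl
      rw [mul_apply_eq_comp]
      change (algebraMap ℝ (H →L[ℂ] H) t - Y)
        ((S - ((1 + κ * G)⁻¹ * κ) • ((innerSL ℂ e).comp S).smulRight (S e)) u) = u
      rw [this, sub_apply, ← hy, Algebra.algebraMap_eq_smul_one, smul_apply, one_apply_eq_self,
        Complex.coe_smul]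
    have hsa : IsSelfAdjoint (algebraMap ℝ (H →L[ℂ] H) t - Y) :=
      (IsSelfAdjoint.algebraMap _ (IsSelfAdjoint.all t)).sub hY
    have hL := congrArg star hR
    rw [star_mul, hsa.star_eq, star_one] at hL
    exact ⟨⟨_, _, hR, left_inv_eq_right_inv hL hR ▸ hL⟩, rfl⟩
  obtain ⟨ν, hν, hνz⟩ := exists_spectral_measure hI hY hspec e
  refine ⟨ν, hν, fun z hz r hr hne => ?_⟩
  rw [← hνz z hz ((1 + κ * ⟪e, r⟫_ℂ)⁻¹ • r), inner_smul_right, mul_comm]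
  rw [hYapp, map_smul, inner_smul_right, smul_comm]
  have h1 : z • r = e + T r := by rw [sub_eq_iff_eq_add] at hr; exact hr
  rw [h1]
  have h2 : (1 + κ * ⟪e, r⟫_ℂ)⁻¹ + κ * ((1 + κ * ⟪e, r⟫_ℂ)⁻¹ * ⟪e, r⟫_ℂ) = 1 := by
    field_simp
  calc _ = ((1 + κ * ⟪e, r⟫_ℂ)⁻¹ + κ * ((1 + κ * ⟪e, r⟫_ℂ)⁻¹ * ⟪e, r⟫_ℂ)) • e := by module
    _ = e := by rw [h2, one_smul]

lemma exists_measure_compression {I : Set ℝ} (hI : IsCompact I) (hIo : I.OrdConnected)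
    {T : H →L[ℂ] H} {A B : ℝ} (hA : A ∈ I) (hB : B ∈ I) (hAB : A ≤ B)
    (hAT : algebraMap ℝ (H →L[ℂ] H) A ≤ T) (hTB : T ≤ algebraMap ℝ (H →L[ℂ] H) B)
    (hT : IsSelfAdjoint T) {e : H} (he : e ≠ 0) :
    ∃ (ν : Measure ℝ) (m : ℝ), Concentrated I ν ∧ ∀ z ∈ nonreal, ∀ r : H, z • r - T r = e →
      ⟪e, r⟫_ℂ ≠ 0 →
      ct ν (fun _ => 1) z = (‖e‖ : ℂ) ^ 2 * z - (‖e‖ : ℂ) ^ 4 * (⟪e, r⟫_ℂ)⁻¹ - m := by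
  set M : ℝ := ‖e‖ ^ 2 with hM
  have hM0 : (M : ℂ) ≠ 0 := by simpa [hM] using he
  have hMi : ⟪e, e⟫_ℂ = M := by rw [inner_self_eq_norm_sq_to_K, hM]; push_cast; rfl
  set P : H →L[ℂ] H := 1 - M⁻¹ • rankOneOp e with hP
  have hPapp : ∀ u, P u = u - ((M : ℂ)⁻¹ * ⟪e, u⟫_ℂ) • e := fun u => by
    rw [hP, sub_apply, smul_apply, rankOneOp_apply, one_apply_eq_self, ← Complex.coe_smul,
      smul_smul, Complex.ofReal_inv]
  have hPsa : IsSelfAdjoint P :=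
    (IsSelfAdjoint.one _).sub ((IsSelfAdjoint.all _).smul (isSelfAdjoint_rankOneOp e))
  have hPe : P e = 0 := by
    rw [hPapp, hMi, inv_mul_cancel₀ hM0, one_smul, sub_self]
  have hPP : P * P = P := by
    ext u
    rw [mul_apply_eq_comp]
    conv_lhs => rw [hPapp u, map_sub, map_smul, hPe, smul_zero, sub_zero]
  clear_value P
  set Y : H →L[ℂ] H := P * T * P + A • (1 - P) with hYdef
  have hY : IsSelfAdjoint Y := by
    refine IsSelfAdjoint.add ?_ ((IsSelfAdjoint.all A).smul ((IsSelfAdjoint.one _).sub hPsa))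
    rw [IsSelfAdjoint, star_mul, star_mul, hPsa.star_eq, hT.star_eq, mul_assoc]
  have hQ : 0 ≤ 1 - P := by
    have : 1 - P = star (1 - P) * (1 - P) := by
      rw [star_sub, star_one, hPsa.star_eq, mul_sub, sub_mul, sub_mul, hPP]
      simp
    rw [this]
    exact star_mul_self_nonneg _
  have hAY : algebraMap ℝ (H →L[ℂ] H) A ≤ Y := by
    have h1 := star_left_conjugate_nonneg (sub_nonneg.2 hAT) P
    rw [hPsa.star_eq] at h1
    rw [← sub_nonneg]
    convert h1 using 1
    rw [hYdef, Algebra.algebraMap_eq_smul_one, mul_sub, sub_mul, mul_smul_comm, smul_mul_assoc,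
      mul_one, hPP, smul_sub]
    abel
  have hYB : Y ≤ algebraMap ℝ (H →L[ℂ] H) B := by
    have h1 := star_left_conjugate_nonneg (sub_nonneg.2 hTB) P
    rw [hPsa.star_eq] at h1
    have hAB : 0 ≤ (B - A) • (1 - P) := smul_nonneg (sub_nonneg.2 hAB) hQ
    rw [← sub_nonneg]
    convert add_nonneg h1 hAB using 1
    rw [hYdef, Algebra.algebraMap_eq_smul_one, mul_sub, sub_mul, mul_smul_comm, smul_mul_assoc,
      mul_one, hPP, sub_smul, smul_sub, smul_sub]
    abel
  have hspec : spectrum ℝ Y ⊆ I := fun t ht => hIo.out hA hB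
    ⟨(algebraMap_le_iff_le_spectrum (a := Y) (r := A)).1 hAY t ht, 
      (le_algebraMap_iff_spectrum_le (a := Y) (r := B)).1 hYB t ht⟩
  obtain ⟨ν, hν, hνz⟩ := exists_spectral_measure hI hY hspec (P (T e))
  obtain ⟨m, hm⟩ : ∃ m : ℝ, ⟪e, T e⟫_ℂ = m := ⟨(⟪e, T e⟫_ℂ).re, by
    rw [eq_comm, ← Complex.conj_eq_iff_re, inner_conj_symm, hT.inner_apply]⟩
  refine ⟨ν, m, hν, fun z hz r hr hG => ?_⟩
  have h1 : T r = z • r - e := by rw [← hr]; abel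
  rw [← hνz z hz ((M * (⟪e, r⟫_ℂ)⁻¹) • P r)]
  · rw [inner_smul_right, hPsa.inner_apply, ← mul_apply_eq_comp, hPP, hPapp, inner_sub_right,
      inner_smul_right, hT.inner_apply, hT.inner_apply, h1, inner_sub_right, inner_smul_right, hMi,
      hm]
    have hM4 : (‖e‖ : ℂ) ^ 4 = (M : ℂ) ^ 2 := by rw [hM]; push_cast; ring
    have hM2 : (‖e‖ : ℂ) ^ 2 = (M : ℂ) := by rw [hM]; push_cast; ring
    rw [hM4, hM2]
    field_simp
  · have e1 : Y (P r) = P (T (P r)) := by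
      have : Y * P = P * T * P := by
        rw [hYdef, add_mul, mul_assoc (P * T), hPP, smul_mul_assoc, sub_mul, one_mul, hPP, sub_self,
          smul_zero, add_zero]
      exact congrArg (fun f => f r) this
    have e2 : T (P r) = z • r - e - ((M : ℂ)⁻¹ * ⟪e, r⟫_ℂ) • T e := by
      rw [hPapp, map_sub, map_smul, h1]
    rw [map_smul, smul_comm, ← smul_sub, e1, e2, map_sub, map_sub, map_smul, map_smul, hPe]
    rw [sub_zero, sub_sub_cancel, smul_smul]
    have : (M : ℂ) * (⟪e, r⟫_ℂ)⁻¹ * ((M : ℂ)⁻¹ * ⟪e, r⟫_ℂ) = 1 := by field_simp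
    rw [this, one_smul]

end Operators

section Model

open scoped InnerProductSpace ComplexOrder

lemma exists_cyclic_representation {X : Type} [TopologicalSpace X] [CompactSpace X]
    (f : C(X, ℂ) →ₚ[ℂ] ℂ) :
    ∃ (H : Type) (_ : NormedAddCommGroup H) (_ : InnerProductSpace ℂ H) (_ : CompleteSpace H)
      (π : C(X, ℂ) →⋆ₐ[ℂ] (H →L[ℂ] H)) (e : H), ∀ g, ⟪e, π g e⟫_ℂ = f g := by
  refine ⟨f.GNS, inferInstance, inferInstance, inferInstance, f.gnsStarAlgHom,
    ((f.toPreGNS 1 : f.PreGNS) : f.GNS), fun g => ?_⟩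
  have hg : f.gnsStarAlgHom g (f.toPreGNS 1 : f.PreGNS) = f.leftMulMapPreGNS g (f.toPreGNS 1) :=
    PositiveLinearMap.gnsNonUnitalStarAlgHom_apply_coe f
  rw [hg,
    UniformSpace.Completion.inner_coe, PositiveLinearMap.preGNS_inner_def]
  simp

/-- Integration against `w μ` as a positive functional on `C(I, ℂ)`. -/
def Concentrated.functional {I : Set ℝ} {μ : Measure ℝ} (h : Concentrated I μ) {w : ℝ → ℝ}
    (hw : ContinuousOn w I) (hpos : ∀ x ∈ I, 0 < w x) : C(I, ℂ) →ₚ[ℂ] ℂ :=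
  have hgw : ∀ g : C(I, ℂ), Integrable (fun x : I => g x * (w x : ℂ)) (μ.comap Subtype.val) := by
    intro g
    have := h.isFinite
    have : IsFiniteMeasure (μ.comap (Subtype.val : I → ℝ)) := by
      infer_instance
    have : CompactSpace I := isCompact_iff_compactSpace.1 h.isCompact
    refine Continuous.integrable_of_hasCompactSupport ?_ (HasCompactSupport.of_compactSpace _)
    exact g.continuous.mul (Complex.continuous_ofReal.comp hw.domRestrict)
  PositiveLinearMap.mk₀
    { toFun := fun g => ∫ x : I, g x * (w x : ℂ) ∂(μ.comap Subtype.val)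
      map_add' := fun g g' => by
        rw [← integral_add (hgw g) (hgw g')]
        congr 1; ext x; simp [add_mul]
      map_smul' := fun c g => by
        rw [RingHom.id_apply, smul_eq_mul, ← integral_const_mul]
        congr 1; ext x; simp [mul_assoc] }
    fun g hg => by
      refine integral_nonneg fun x => ?_
      exact mul_nonneg (hg x) (Complex.zero_le_real.2 (hpos x x.2).le)

lemma Concentrated.exists_model {I : Set ℝ} {μ : Measure ℝ} (h : Concentrated I μ) {w : ℝ → ℝ}
    (hw : ContinuousOn w I) (hpos : ∀ x ∈ I, 0 < w x) :
    ∃ (H : Type) (_ : NormedAddCommGroup H) (_ : InnerProductSpace ℂ H) (_ : CompleteSpace H)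
      (π : C(I, ℂ) →⋆ₐ[ℂ] (H →L[ℂ] H)) (e : H), ∀ (g : C(I, ℂ)) (G : ℝ → ℂ), (∀ x, g x = G x) →
        ⟪e, π g e⟫_ℂ = ∫ x, (w x : ℂ) * G x ∂μ := by
  have : CompactSpace I := isCompact_iff_compactSpace.1 h.isCompact
  obtain ⟨H, i1, i2, i3, π, e, he⟩ := exists_cyclic_representation (h.functional hw hpos)
  refine ⟨H, i1, i2, i3, π, e, fun g G hgG => ?_⟩
  rw [he]
  change ∫ x : I, g x * (w x : ℂ) ∂(μ.comap Subtype.val) = _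
  simp_rw [hgG]
  rw [integral_subtype_comap h.isCompact.measurableSet (fun x => G x * (w x : ℂ)), h.restrict_eq]
  congr 1; ext x; ring

/-- The Cauchy transform of a positive measure as the compressed resolvent of a self-adjoint
operator. -/
lemma Concentrated.exists_operator_model {I : Set ℝ} {μ : Measure ℝ} (h : Concentrated I μ)
    {w : ℝ → ℝ} (hw : ContinuousOn w I) (hpos : ∀ x ∈ I, 0 < w x) :
    ∃ (H : Type) (_ : NormedAddCommGroup H) (_ : InnerProductSpace ℂ H) (_ : CompleteSpace H)
      (T : H →L[ℂ] H) (e : H), IsSelfAdjoint T ∧ ⟪e, e⟫_ℂ = ((∫ x, w x ∂μ : ℝ) : ℂ) ∧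
      (∀ A : ℝ, (∀ x ∈ I, A ≤ x) → algebraMap ℝ (H →L[ℂ] H) A ≤ T) ∧
      (∀ B : ℝ, (∀ x ∈ I, x ≤ B) → T ≤ algebraMap ℝ (H →L[ℂ] H) B) ∧
      ∀ z ∉ cSet I, ∃ S : H →L[ℂ] H, (∀ u, z • S u - T (S u) = u) ∧ ⟪e, S e⟫_ℂ = ct μ w z ∧
        (z.im = 0 → IsSelfAdjoint S) := by
  have : CompactSpace I := isCompact_iff_compactSpace.1 h.isCompact
  obtain ⟨H, i1, i2, i3, π, e, he⟩ := h.exists_model hw hpos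
  let X : C(I, ℂ) := ⟨fun x => ((x : ℝ) : ℂ), by fun_prop⟩
  have hX : IsSelfAdjoint X := by
    ext x
    exact Complex.conj_ofReal x
  have hmono : ∀ f g : C(I, ℂ), f ≤ g → π f ≤ π g := fun f g hfg => OrderHomClass.mono π hfg
  refine ⟨H, i1, i2, i3, π X, e, hX.map π, ?_, fun A hA => ?_, fun B hB => ?_, fun z hz => ?_⟩
  · have := he 1 (fun _ => 1) fun x => rfl
    rw [map_one, one_apply_eq_self] at this
    rw [this, ← integral_complex_ofReal]
    simp
  · have h1 : π (algebraMap ℝ C(I, ℂ) A) = algebraMap ℝ (H →L[ℂ] H) A := by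
      have := AlgHomClass.commutes (π.restrictScalars ℝ) A
      exact this
    rw [← h1]
    refine hmono _ _ fun x => ?_
    exact Complex.real_le_real.2 (hA x x.2)
  · have h1 : π (algebraMap ℝ C(I, ℂ) B) = algebraMap ℝ (H →L[ℂ] H) B := by
      have := AlgHomClass.commutes (π.restrictScalars ℝ) B
      exact this
    rw [← h1]
    refine hmono _ _ fun x => ?_
    exact Complex.real_le_real.2 (hB x x.2)
  · let g : C(I, ℂ) := ⟨fun x => (z - ((x : ℝ) : ℂ))⁻¹,
      (Concentrated.continuousOn_kernel hz).domRestrict⟩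
    have h1 : z • g - X * g = 1 := by
      ext x
      change z * (z - ((x : ℝ) : ℂ))⁻¹ - ((x : ℝ) : ℂ) * (z - ((x : ℝ) : ℂ))⁻¹ = 1
      have := sub_ofReal_ne hz x.2
      rw [← sub_mul, mul_inv_cancel₀ this]
    refine ⟨π g, fun u => ?_, ?_, fun hz' => ?_⟩
    · have h2 := congrArg π h1
      rw [map_sub, map_smul, map_mul, map_one] at h2
      exact congrArg (fun f => f u) h2
    · rw [he g (fun x => (z - (x : ℂ))⁻¹) fun x => rfl]
      rfl
    · refine IsSelfAdjoint.map ?_ π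
      ext x
      change (starRingEnd ℂ) (z - ((x : ℝ) : ℂ))⁻¹ = (z - ((x : ℝ) : ℂ))⁻¹
      rw [map_inv₀, map_sub, Complex.conj_ofReal, Complex.conj_eq_iff_im.2 hz']

end Model

lemma Concentrated.exists_inverse_measure {I : Set ℝ} {μ : Measure ℝ} {w : ℝ → ℝ}
    (h : Weighted I μ w) (C : ℝ) (hC : ∀ t ∉ I, C + ctR μ w t ≠ 0) :
    ∃ (c d k : ℝ) (ν : Measure ℝ), Concentrated I ν ∧ k ≠ 0 ∧ (C ≠ 0 → c = 0) ∧
      ∀ z ∈ nonreal, (C + ct μ w z)⁻¹ = c * z + d + k * ct ν (fun _ => 1) z := by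
  obtain ⟨ε, hε, hpos⟩ := exists_sign h.ordConnected h.continuousOn h.ne_zero
  have hε2 : (ε : ℂ) * ε = 1 := by rcases hε with rfl | rfl <;> simp
  have hε0 : ε ≠ 0 := by rcases hε with rfl | rfl <;> simp
  have hε0' : (ε : ℂ) ≠ 0 := by exact_mod_cast hε0
  have hinv : ∀ x : ℂ, x⁻¹ = ε * (ε * x)⁻¹ := fun x => by
    rw [mul_inv, ← mul_assoc, mul_inv_cancel₀ hε0', one_mul]
  have hεw : ContinuousOn (fun x => ε * w x) I := continuousOn_const.mul h.continuousOn
  obtain ⟨H, i1, i2, i3, T, e, hT, hee, hA, hB, hS⟩ :=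
    h.toConcentrated.exists_operator_model (w := fun x => ε * w x) hεw hpos
  have hM := h.toConcentrated.integral_pos h.ne_zero_measure hεw hpos
  set M := ∫ x, ε * w x ∂μ with hMdef
  have hct : ∀ z, ct μ (fun x => ε * w x) z = ε * ct μ w z := fun z => ct_const_mul _ _ _ _
  by_cases hC0 : C = 0
  · subst hC0
    have hne : I.Nonempty := h.infinite.nonempty.mono h.toConcentrated.support_subset
    have he : e ≠ 0 := by
      rintro rfl
      rw [inner_zero_left] at hee
      exact hM.ne' (by exact_mod_cast hee.symm)
    have heM : (‖e‖ : ℂ) ^ 2 = M := by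
      rw [← hee, inner_self_eq_norm_sq_to_K]; rfl
    obtain ⟨ν, m, hν, hνz⟩ := exists_measure_compression h.isCompact h.ordConnected
      (h.isCompact.sInf_mem hne) (h.isCompact.sSup_mem hne)
      (csInf_le_csSup hne h.isCompact.bddBelow h.isCompact.bddAbove)
      (hA _ fun x hx => csInf_le h.isCompact.bddBelow hx)
      (hB _ fun x hx => le_csSup h.isCompact.bddAbove hx) hT he
    refine ⟨ε / M, -(ε * m / M ^ 2), -(ε / M ^ 2), ν, hν, by
      have := hM.ne'
      exact neg_ne_zero.2 (div_ne_zero hε0 (pow_ne_zero _ this)), fun hh => (hh rfl).elim,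
      fun z hz => ?_⟩
    obtain ⟨S, hS1, hS2, -⟩ := hS z (notMem_cSet_of_nonreal hz)
    have h0 : ct μ (fun x => ε * w x) z ≠ 0 := by
      rw [hct]
      exact mul_ne_zero hε0' (h.ct_ne_zero hz)
    have h1 := hνz z hz (S e) (hS1 e) (by rw [hS2]; exact h0)
    have h4 : (‖e‖ : ℂ) ^ 4 = M ^ 2 := by rw [← heM]; ring
    rw [hS2, heM, h4] at h1
    have hM0 : (M : ℂ) ≠ 0 := by exact_mod_cast hM.ne'
    rw [h1, Complex.ofReal_zero, zero_add, hinv, ← hct]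
    push_cast
    field_simp
    ring
  · have hκ : ∀ x : ℂ, (C : ℂ) + x ≠ 0 → 1 + ((ε * C)⁻¹ : ℝ) * (ε * x) ≠ 0 := fun x hx => by
      have hC0' : (C : ℂ) ≠ 0 := by exact_mod_cast hC0
      push_cast
      have : (1 : ℂ) + (ε * C : ℂ)⁻¹ * (ε * x) = (C : ℂ)⁻¹ * (C + x) := by
        field_simp
      rw [this]
      exact mul_ne_zero (inv_ne_zero hC0') hx
    obtain ⟨ν, hν, hνz⟩ := exists_measure_rank_one_perturbation h.isCompact hT e (ε * C)⁻¹ (by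
      intro t ht
      obtain ⟨S, hS1, hS2, hS3⟩ := hS t (mt ofReal_mem_cSet.1 ht)
      refine ⟨S, hS3 (Complex.ofReal_im t), hS1, ?_⟩
      rw [hS2, hct]
      refine hκ _ ?_
      rw [ct_ofReal]
      exact_mod_cast hC t ht)
    refine ⟨0, C⁻¹, -(ε * C⁻¹ ^ 2), ν, hν, neg_ne_zero.2 (mul_ne_zero hε0
      (pow_ne_zero _ (inv_ne_zero hC0))), fun _ => rfl, fun z hz => ?_⟩
    obtain ⟨S, hS1, hS2, -⟩ := hS z (notMem_cSet_of_nonreal hz)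
    have h0 := h.const_add_ct_ne_zero C hz
    have h1 := hκ _ h0
    have h2 := hνz z hz (S e) (hS1 e) (by rw [hS2, hct]; exact h1)
    rw [← h2, hS2, hct]
    have hC0' : (C : ℂ) ≠ 0 := by exact_mod_cast hC0
    have h3 : (1 : ℂ) + ((ε * C)⁻¹ : ℝ) * (ε * ct μ w z) = (C : ℂ)⁻¹ * (C + ct μ w z) := by
      push_cast
      field_simp
    rw [h3]
    push_cast
    field_simp
    linear_combination ct μ w z * hε2

lemma Polynomial.eq_zero_of_tendsto_imInfty {D : ℝ[X]}
    (h : Tendsto (fun z : ℂ => aeval z D) imInfty (𝓝 0)) : D = 0 := by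
  have hinf : Tendsto (fun z : ℂ => ‖z‖) imInfty atTop := by
    rw [imInfty, tendsto_map'_iff]
    refine tendsto_abs_atTop_atTop.congr fun y => ?_
    simp
  by_cases hd : 0 < D.degree
  · have h1 := Polynomial.tendsto_norm_atTop (D.map (algebraMap ℝ ℂ)) (by
      rwa [degree_map]) hinf
    refine (not_tendsto_nhds_of_tendsto_atTop h1 ‖(0 : ℂ)‖ ?_).elim
    simpa only [eval_map_algebraMap] using h.norm
  · rw [eq_C_of_degree_le_zero (not_lt.1 hd)] at h ⊢
    simp only [aeval_C] at h
    have := tendsto_nhds_unique tendsto_const_nhds h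
    simpa using this

lemma Weighted.eq_zero_of_ct_eq {I : Set ℝ} {μ : Measure ℝ} {w : ℝ → ℝ} (h : Weighted I μ w)
    {P D : ℝ[X]} (hPD : ∀ z ∈ nonreal, ct μ (fun x => P.eval x * w x) z = aeval z D) : P = 0 := by
  have hPw : ContinuousOn (fun x => P.eval x * w x) I := P.continuousOn.mul h.continuousOn
  have key : ∀ {v : ℝ → ℝ} {D : ℝ[X]}, ContinuousOn v I →
      (∀ z ∈ nonreal, ct μ v z = aeval z D) → D = 0 := fun {v} {D} hv hvD =>
    Polynomial.eq_zero_of_tendsto_imInfty ((h.toConcentrated.tendsto_ct hv).congr' (by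
      filter_upwards [eventually_nonreal] with z hz using hvD z hz))
  have hD := key hPw hPD
  obtain ⟨E, -, hE⟩ := h.toConcentrated.poly_mul_ct (P.natDegree + 1) P
    (by simpa using degree_le_natDegree.trans_lt (by exact_mod_cast P.natDegree.lt_succ_self)) hPw
  have hPPw : ContinuousOn (fun x => P.eval x * (P.eval x * w x)) I := P.continuousOn.mul hPw
  have h2 : ∀ z ∈ nonreal, ct μ (fun x => P.eval x * (P.eval x * w x)) z = aeval z (-E) := by
    intro z hz
    have := hE z (notMem_cSet_of_nonreal hz)
    rw [hPD z hz, hD, map_zero, mul_zero] at this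
    rw [map_neg]
    linear_combination -this
  have hE0 := key hPPw h2
  have h3 : ((∫ x, P.eval x * (P.eval x * w x) ∂μ : ℝ) : ℂ) = 0 := by
    refine tendsto_nhds_unique (h.toConcentrated.tendsto_mul_ct hPPw) ?_
    refine tendsto_const_nhds.congr' ?_
    filter_upwards [eventually_nonreal] with z hz
    rw [h2 z hz, hE0, map_zero, mul_zero]
  obtain ⟨ε, hε, hpos⟩ := exists_sign h.ordConnected h.continuousOn h.ne_zero
  have h4 : ∫ x, ε * (P.eval x * (P.eval x * w x)) ∂μ = 0 := by
    rw [integral_const_mul]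
    have : (∫ x, P.eval x * (P.eval x * w x) ∂μ) = 0 := by exact_mod_cast h3
    rw [this, mul_zero]
  rw [integral_eq_zero_iff_of_nonneg_ae] at h4
  · have h5 : ∀ᵐ x ∂μ, P.eval x = 0 := by
      filter_upwards [h4, h.toConcentrated.ae_mem] with x hx hxI
      have h6 : P.eval x * P.eval x * (ε * w x) = 0 := by
        have : ε * (P.eval x * (P.eval x * w x)) = 0 := hx
        linear_combination this
      simpa [(hpos x hxI).ne'] using h6
    have h6 : μ.support ⊆ {x | P.eval x = 0} :=
      Measure.support_subset_of_isClosed (isClosed_eq P.continuous continuous_const) h5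
    exact P.eq_zero_of_infinite_isRoot (h.infinite.mono h6)
  · filter_upwards [h.toConcentrated.ae_mem] with x hxI
    have : 0 ≤ P.eval x * P.eval x * (ε * w x) := mul_nonneg (mul_self_nonneg _) (hpos x hxI).le
    change 0 ≤ ε * (P.eval x * (P.eval x * w x))
    linarith
  · exact h.toConcentrated.integrable (continuousOn_const.mul hPPw)

lemma Weighted.infinite_support_inverse {I : Set ℝ} {μ ν : Measure ℝ} {w : ℝ → ℝ}
    (h : Weighted I μ w) (hν : Concentrated I ν) {C c d k : ℝ}
    (hinv : ∀ z ∈ nonreal, (C + ct μ w z)⁻¹ = c * z + d + k * ct ν (fun _ => 1) z) :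
    ν.support.Infinite := by
  intro hfin
  set Q : ℝ[X] := ∏ t ∈ hfin.toFinset, (X - Polynomial.C t) with hQ
  have hdeg : ∀ P : ℝ[X], P.degree < ((P.natDegree + 1 : ℕ) : WithBot ℕ) := fun P =>
    degree_le_natDegree.trans_lt (by exact_mod_cast P.natDegree.lt_succ_self)
  obtain ⟨E, -, hE⟩ := hν.poly_mul_ct (Q.natDegree + 1) Q (hdeg Q) (w := fun _ => 1)
    continuousOn_const
  have hQ0 : ∀ z, ct ν (fun x => Q.eval x * 1) z = 0 := by
    intro z
    rw [ct, ← integral_zero ℝ ℂ (μ := ν)]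
    refine integral_congr_ae ?_
    filter_upwards [Measure.support_mem_ae (μ := ν)] with x hx
    have : Q.eval x = 0 := by
      rw [hQ, eval_prod]
      exact Finset.prod_eq_zero (hfin.mem_toFinset.2 hx) (by simp)
    simp [this]
  set P : ℝ[X] := Q * (Polynomial.C c * X + Polynomial.C d) + Polynomial.C k * E with hP
  have hQP : ∀ z ∈ nonreal, aeval z Q = aeval z P * (C + ct μ w z) := by
    intro z hz
    have h0 := h.const_add_ct_ne_zero C hz
    have h1 := hinv z hz
    have h2 := hE z (notMem_cSet_of_nonreal hz)
    rw [hQ0, add_zero] at h2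
    have h3 : aeval z P = aeval z Q * (C + ct μ w z)⁻¹ := by
      rw [h1, hP]
      simp only [map_add, map_mul, aeval_C, aeval_X, Complex.coe_algebraMap]
      linear_combination (-(k : ℂ)) * h2
    rw [h3, mul_assoc, inv_mul_cancel₀ h0, mul_one]
  obtain ⟨E', -, hE'⟩ := h.toConcentrated.poly_mul_ct (P.natDegree + 1) P (hdeg P) h.continuousOn
  have hP0 : P = 0 := by
    refine h.eq_zero_of_ct_eq (D := Q - Polynomial.C C * P - E') fun z hz => ?_
    have h1 := hE' z (notMem_cSet_of_nonreal hz)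
    have h2 := hQP z hz
    simp only [map_sub, map_mul, aeval_C, Complex.coe_algebraMap]
    linear_combination -h2 - h1
  have h1 := hQP Complex.I (by simp [nonreal])
  rw [hP0, map_zero, zero_mul, hQ, map_prod, Finset.prod_eq_zero_iff] at h1
  obtain ⟨t, -, ht⟩ := h1
  have := congrArg Complex.im ht
  simp at this

/-- The inverse of a (constant plus a) Cauchy transform is again of the same kind. -/
lemma Weighted.exists_inverse {I : Set ℝ} {μ : Measure ℝ} {w : ℝ → ℝ}
    (h : Weighted I μ w) (C : ℝ) (hC : ∀ t ∉ I, C + ctR μ w t ≠ 0) :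
    ∃ (c d : ℝ) (ν : Measure ℝ) (v : ℝ → ℝ), Weighted I ν v ∧ (C ≠ 0 → c = 0) ∧
      ∀ z ∈ nonreal, (C + ct μ w z)⁻¹ = c * z + d + ct ν v z := by
  obtain ⟨c, d, k, ν, hν, hk, hc, hz⟩ := Concentrated.exists_inverse_measure h C hC
  refine ⟨c, d, ν, fun _ => k * 1, ⟨hν, h.ordConnected, h.infinite_support_inverse hν hz,
    continuousOn_const, fun _ _ => by simpa using hk⟩, hc, fun z hz' => ?_⟩
  rw [hz z hz', ct_const_mul]

lemma HasBval.inv {f : ℂ → ℂ} {K : Set ℝ} (hf : HasBval f K) (h0 : ∀ x ∈ K, bval f x ≠ 0) :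
    HasBval (fun z => (f z)⁻¹) K ∧ ∀ x ∈ K, bval (fun z => (f z)⁻¹) x = (bval f x)⁻¹ := by
  refine hasBval_of_tendsto (hf.cont.inv₀ h0) fun x hx => ?_
  push_cast
  exact (hf.tendsto x hx).inv₀ (by exact_mod_cast h0 x hx)

lemma HasBval.congr {f g : ℂ → ℂ} {K : Set ℝ} (hf : HasBval f K)
    (h : ∀ z ∈ nonreal, f z = g z) : HasBval g K := by
  have hb := hasBval_congr h
  refine ⟨hb ▸ hf.cont, fun x hx => ?_⟩
  rw [← hb]
  refine (hf.tendsto x hx).congr' ?_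
  filter_upwards [self_mem_nhdsWithin] with z hz using h z hz

/-- `a` is an index in `{i, …, m}` outside `J`. -/
def Adm (m i : ℕ) (J : Finset ℕ) (a : ℕ) : Prop := i ≤ a ∧ a ≤ m ∧ a ∉ J

/-- A family of ratios `Q J a b` attached to a Nikishin system: after the columns in `J` have been
eliminated, `Q J a b` is the quotient of the remaining functions with labels `a` and `b`. -/
structure RatioFamily (m i : ℕ) (I : ℕ → Set ℝ) (φ : ℕ → ℂ → ℂ)
    (Q : Finset ℕ → ℕ → ℕ → ℂ → ℂ) : Prop where
  one : ∀ J ⊆ Finset.Icc i m, ∀ a, Adm m i J a → ∀ z ∈ nonreal, Q J a a z = 1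
  mul : ∀ J ⊆ Finset.Icc i m, ∀ a b c, Adm m i J a → Adm m i J b → Adm m i J c →
    ∀ z ∈ nonreal, Q J a b z * Q J b c z = Q J a c z
  three_term : ∀ J ⊆ Finset.Icc i m, ∀ a' a b, Adm m i J a' → Adm m i J a → Adm m i J b →
    a' ≠ a → a' ≠ b → a ≠ b → ∀ z ∈ nonreal,
      Q J a' b z = Q (insert b J) a' a z * Q J a b z + Q (insert a J) a' b z
  zero : ∀ a, Adm m i ∅ a → ∀ z ∈ nonreal, Q ∅ a i z = φ a z
  rep : ∀ J ⊆ Finset.Icc i m, ∀ a b, Adm m i J a → Adm m i J b → a ≠ b →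
    ∃ (μ : Measure ℝ) (w : ℝ → ℝ), Weighted (I (i + J.card + 1)) μ w ∧
      ∀ a', Adm m i J a' → a' ≠ b → ∃ α β : ℝ,
        (α ≠ 0 → a' < i + J.card + 1 ∧ i + J.card + 1 ≤ b) ∧
        (i + J.card + 1 ≤ a' → b < i + J.card + 1 → β = 0) ∧
        ∀ z ∈ nonreal,
          Q J a' b z = α * z + β + ct μ (fun x => bval (Q (insert b J) a' a) x * w x) z

lemma Adm.card_lt {m i : ℕ} {J : Finset ℕ} (hJ : J ⊆ Finset.Icc i m) {a b : ℕ}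
    (ha : Adm m i J a) (hb : Adm m i J b) (hab : a ≠ b) : i + J.card + 1 ≤ m := by
  have h1 : insert a (insert b J) ⊆ Finset.Icc i m := by
    intro x hx
    simp only [Finset.mem_insert] at hx
    rcases hx with rfl | rfl | hx
    · exact Finset.mem_Icc.2 ⟨ha.1, ha.2.1⟩
    · exact Finset.mem_Icc.2 ⟨hb.1, hb.2.1⟩
    · exact hJ hx
  have h2 := Finset.card_le_card h1
  rw [Finset.card_insert_of_notMem (by simp [hab, ha.2.2]), Finset.card_insert_of_notMem hb.2.2,
    Nat.card_Icc] at h2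
  have := ha.1
  have := ha.2.1
  omega

lemma Adm.card_lt' {m i : ℕ} {J : Finset ℕ} (hJ : J ⊆ Finset.Icc (i + 1) m) {a : ℕ}
    (ha : Adm m (i + 1) J a) : i + J.card + 1 ≤ m := by
  have h2 := Finset.card_le_card (Finset.insert_subset (Finset.mem_Icc.2 ⟨ha.1, ha.2.1⟩) hJ)
  rw [Finset.card_insert_of_notMem ha.2.2, Nat.card_Icc] at h2
  have := ha.1
  have := ha.2.1
  omega

lemma Adm.insert_subset {m i : ℕ} {J : Finset ℕ} (hJ : J ⊆ Finset.Icc i m) {a : ℕ}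
    (ha : Adm m i J a) : insert a J ⊆ Finset.Icc i m :=
  Finset.insert_subset (Finset.mem_Icc.2 ⟨ha.1, ha.2.1⟩) hJ

lemma Adm.adm_insert {m i : ℕ} {J : Finset ℕ} {a b : ℕ}
    (ha : Adm m i J a) (hab : a ≠ b) : Adm m i (insert b J) a :=
  ⟨ha.1, ha.2.1, by simp [hab, ha.2.2]⟩

namespace RatioFamily

variable {m i : ℕ} {I : ℕ → Set ℝ} {φ : ℕ → ℂ → ℂ} {Q : Finset ℕ → ℕ → ℕ → ℂ → ℂ}

lemma bval_one (F : RatioFamily m i I φ Q) {J : Finset ℕ} (hJ : J ⊆ Finset.Icc i m) {a : ℕ}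
    (ha : Adm m i J a) (K : Set ℝ) : HasBval (Q J a a) K ∧ ∀ x, bval (Q J a a) x = 1 := by
  have h : ∀ z ∈ nonreal, Q J a a z = (1 : ℝ) := by simpa using F.one J hJ a ha
  exact ⟨(hasBval_const 1 K h).1, fun x => (hasBval_const 1 {x} h).2 x rfl⟩

lemma rep_self (F : RatioFamily m i I φ Q) {J : Finset ℕ} (hJ : J ⊆ Finset.Icc i m) {a b : ℕ}
    (ha : Adm m i J a) (hb : Adm m i J b) (hab : a ≠ b) :
    ∃ (μ : Measure ℝ) (w : ℝ → ℝ), Weighted (I (i + J.card + 1)) μ w ∧ ∃ α β : ℝ,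
        (α ≠ 0 → a < i + J.card + 1 ∧ i + J.card + 1 ≤ b) ∧
        (i + J.card + 1 ≤ a → b < i + J.card + 1 → β = 0) ∧
        ∀ z ∈ nonreal, Q J a b z = α * z + β + ct μ w z := by
  obtain ⟨μ, w, hw, h⟩ := F.rep J hJ a b ha hb hab
  obtain ⟨α, β, h1, h2, h3⟩ := h a ha hab
  refine ⟨μ, w, hw, α, β, h1, h2, fun z hz => ?_⟩
  rw [h3 z hz]
  congr 1
  refine hw.toConcentrated.ct_congr (fun x _ => ?_) z
  rw [(F.bval_one (hb.insert_subset hJ) (ha.adm_insert hab) univ).2, one_mul]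

lemma hasBval (F : RatioFamily m i I φ Q) {J : Finset ℕ} (hJ : J ⊆ Finset.Icc i m) {a b : ℕ}
    (ha : Adm m i J a) (hb : Adm m i J b) {K : Set ℝ}
    (hK : i + J.card + 1 ≤ m → Disjoint (I (i + J.card + 1)) K) :
    HasBval (Q J a b) K := by
  rcases eq_or_ne a b with rfl | hab
  · exact (F.bval_one hJ ha K).1
  · obtain ⟨μ, w, hw, α, β, -, -, h⟩ := F.rep_self hJ ha hb hab
    exact (hw.toConcentrated.hasBval hw.continuousOn (hK (ha.card_lt hJ hb hab)) h).1

lemma mul_inv_cancel (F : RatioFamily m i I φ Q) {J : Finset ℕ} (hJ : J ⊆ Finset.Icc i m)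
    {a b : ℕ} (ha : Adm m i J a) (hb : Adm m i J b) {z : ℂ} (hz : z ∈ nonreal) :
    Q J a b z * Q J b a z = 1 := by
  rw [F.mul J hJ a b a ha hb ha z hz, F.one J hJ a ha z hz]

lemma bval_ne_zero (F : RatioFamily m i I φ Q) {J : Finset ℕ} (hJ : J ⊆ Finset.Icc i m) {a b : ℕ}
    (ha : Adm m i J a) (hb : Adm m i J b) {K : Set ℝ}
    (hK : i + J.card + 1 ≤ m → Disjoint (I (i + J.card + 1)) K) :
    ∀ x ∈ K, bval (Q J a b) x ≠ 0 :=
  (F.hasBval hJ ha hb hK).ne_zero (F.hasBval hJ hb ha hK) fun _ hz => F.mul_inv_cancel hJ ha hb hz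

lemma bval_mul (F : RatioFamily m i I φ Q) {J : Finset ℕ} (hJ : J ⊆ Finset.Icc i m) {a b c : ℕ}
    (ha : Adm m i J a) (hb : Adm m i J b) (hc : Adm m i J c) {K : Set ℝ}
    (hK : i + J.card + 1 ≤ m → Disjoint (I (i + J.card + 1)) K) :
    ∀ x ∈ K, bval (Q J a c) x = bval (Q J a b) x * bval (Q J b c) x :=
  ((F.hasBval hJ ha hb hK).mul (F.hasBval hJ hb hc hK)
    fun z hz => (F.mul J hJ a b c ha hb hc z hz).symm).2

end RatioFamily

/-- Successive elimination of the columns in a list, starting from the functions `φ`. -/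
def elimList (φ : ℕ → ℂ → ℂ) (Q : Finset ℕ → ℕ → ℕ → ℂ → ℂ) : List ℕ → ℕ → ℂ → ℂ
  | [], a, z => φ a z
  | j :: l, a, z => elimList φ Q l a z - Q l.toFinset a j z * elimList φ Q l j z

/-- Elimination of the columns in a finite set. -/
def elim (φ : ℕ → ℂ → ℂ) (Q : Finset ℕ → ℕ → ℕ → ℂ → ℂ) (J : Finset ℕ) (a : ℕ) (z : ℂ) : ℂ :=
  elimList φ Q J.toList a z

section Elim

variable {m i : ℕ} {I : ℕ → Set ℝ} {φ φ' : ℕ → ℂ → ℂ} {Q : Finset ℕ → ℕ → ℕ → ℂ → ℂ}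

lemma elim_empty (a : ℕ) (z : ℂ) : elim φ Q ∅ a z = φ a z := by
  simp [elim, elimList]

lemma RatioFamily.elimList_perm (F : RatioFamily m i I φ' Q) {l l' : List ℕ} (hp : l.Perm l')
    (hl : l.Nodup) (hm : l.toFinset ⊆ Finset.Icc i m) {z : ℂ} (hz : z ∈ nonreal) :
    ∀ a, Adm m i l.toFinset a → elimList φ Q l a z = elimList φ Q l' a z := by
  induction hp with
  | nil => intro a _; rfl
  | @cons x l₁ l₂ h ih =>
    intro a ha
    rw [List.toFinset_cons] at hm ha
    have hm' := (Finset.subset_insert _ _).trans hm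
    have hx := hm (Finset.mem_insert_self _ _)
    rw [Finset.mem_Icc] at hx
    obtain ⟨hxl, hl⟩ := List.nodup_cons.1 hl
    have ih' := ih hl hm'
    have hax : Adm m i l₁.toFinset a := ⟨ha.1, ha.2.1, fun h => ha.2.2 (Finset.mem_insert_of_mem h)⟩
    rw [elimList, elimList, ih' a hax, ih' x ⟨hx.1, hx.2, by simpa using hxl⟩,
      List.toFinset_eq_of_perm _ _ h]
  | swap x y l =>
    intro a ha
    simp only [List.toFinset_cons] at hm ha
    simp only [List.nodup_cons, List.mem_cons, not_or] at hl
    obtain ⟨⟨hyx, hyl⟩, hxl, hl⟩ := hl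
    have hy := Finset.mem_Icc.1 (hm (Finset.mem_insert_self _ _))
    have hx := Finset.mem_Icc.1 (hm (Finset.mem_insert_of_mem (Finset.mem_insert_self _ _)))
    have hm' := ((Finset.subset_insert _ _).trans (Finset.subset_insert _ _)).trans hm
    obtain ⟨h1, h2, h3⟩ := ha
    simp only [Finset.mem_insert, not_or] at h3
    have hA : Adm m i l.toFinset a := ⟨h1, h2, h3.2.2⟩
    have hX : Adm m i l.toFinset x := ⟨hx.1, hx.2, by simpa using hxl⟩
    have hY : Adm m i l.toFinset y := ⟨hy.1, hy.2, by simpa using hyl⟩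
    have e1 := F.three_term _ hm' a y x hA hY hX h3.1 h3.2.1 hyx z hz
    have e2 := F.three_term _ hm' a x y hA hX hY h3.2.1 h3.1 (Ne.symm hyx) z hz
    simp only [elimList, List.toFinset_cons]
    linear_combination (-elimList φ Q l x z) * e1 + elimList φ Q l y z * e2
  | @trans l₁ l₂ l₃ h h' ih ih' =>
    intro a ha
    have e := List.toFinset_eq_of_perm _ _ h
    rw [ih hl hm a ha, ih' (h.nodup_iff.1 hl) (e ▸ hm) a (e ▸ ha)]

lemma RatioFamily.elim_insert (F : RatioFamily m i I φ' Q) {J : Finset ℕ}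
    (hJ : J ⊆ Finset.Icc i m) {j a : ℕ} (hj : Adm m i J j) (ha : Adm m i J a) (haj : a ≠ j)
    {z : ℂ} (hz : z ∈ nonreal) :
    elim φ Q (insert j J) a z = elim φ Q J a z - Q J a j z * elim φ Q J j z := by
  have h := F.elimList_perm (φ := φ) (Finset.toList_insert hj.2.2) (Finset.nodup_toList _)
    (by rw [Finset.toList_toFinset]; exact hj.insert_subset hJ) hz a
    (by rw [Finset.toList_toFinset]; exact ha.adm_insert haj)
  rw [elim, h, elimList, Finset.toList_toFinset]
  rfl

end Elim

/-- The data for extending a ratio family from the columns `i + 1, …, m` to `i, …, m`. -/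
structure ElimStep (m i : ℕ) (I : ℕ → Set ℝ) (φ φ' : ℕ → ℂ → ℂ)
    (Q : Finset ℕ → ℕ → ℕ → ℂ → ℂ) (μ₀ : Measure ℝ) (w₀ : ℝ → ℝ) : Prop where
  disj : ∀ k, 1 ≤ k → k + 1 ≤ m → Disjoint (I k) (I (k + 1))
  le : i + 1 ≤ m
  fam : RatioFamily m (i + 1) I φ' Q
  weighted : Weighted (I (i + 1)) μ₀ w₀
  one : ∀ z, φ i z = 1
  rep : ∀ a, i + 1 ≤ a → a ≤ m → ∀ z ∈ nonreal,
    φ a z = ct μ₀ (fun x => bval (φ' a) x * w₀ x) z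

/-- Simultaneous representation of all eliminated functions as Cauchy transforms with respect to
one measure, normalised at the label `j`. -/
def ElimRep (m i : ℕ) (I : ℕ → Set ℝ) (φ : ℕ → ℂ → ℂ)
    (Q : Finset ℕ → ℕ → ℕ → ℂ → ℂ) (J : Finset ℕ) (j : ℕ) : Prop :=
  ∃ (μ : Measure ℝ) (w : ℝ → ℝ), Weighted (I (i + J.card + 1)) μ w ∧
    ∀ a, Adm m (i + 1) J a → ∃ C : ℝ, (i + J.card + 1 ≤ a → C = 0) ∧
      ∀ z ∈ nonreal, elim φ Q J a z = C + ct μ (fun x => bval (Q J a j) x * w x) z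

namespace ElimStep

variable {m i : ℕ} {I : ℕ → Set ℝ} {φ φ' : ℕ → ℂ → ℂ} {Q : Finset ℕ → ℕ → ℕ → ℂ → ℂ}
  {μ₀ : Measure ℝ} {w₀ : ℝ → ℝ}

lemma disjoint_tail (S : ElimStep m i I φ φ' Q μ₀ w₀) (J : Finset ℕ) :
    i + 1 + J.card + 1 ≤ m → Disjoint (I (i + 1 + J.card + 1)) (I (i + J.card + 1)) := by
  intro h
  have h1 := (S.disj (i + J.card + 1) (by omega) (by omega)).symm
  have h2 : i + J.card + 1 + 1 = i + 1 + J.card + 1 := by omega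
  rwa [h2] at h1

lemma disjoint_tail' (S : ElimStep m i I φ φ' Q μ₀ w₀) (J : Finset ℕ) :
    i + 1 + J.card + 1 ≤ m → Disjoint (I (i + J.card + 1)) (I (i + 1 + J.card + 1)) :=
  fun h => (S.disjoint_tail J h).symm

lemma rep_empty (S : ElimStep m i I φ φ' Q μ₀ w₀) {j : ℕ} (hj : Adm m (i + 1) ∅ j) :
    ElimRep m i I φ Q ∅ j := by
  have F := S.fam
  have hi : Adm m (i + 1) ∅ (i + 1) := ⟨le_rfl, S.le, by simp⟩
  have hJ : (∅ : Finset ℕ) ⊆ Finset.Icc (i + 1) m := Finset.empty_subset _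
  have hd := S.disjoint_tail ∅
  rw [Finset.card_empty] at hd
  refine ⟨μ₀, fun x => bval (Q ∅ j (i + 1)) x * w₀ x, ?_, fun a ha => ⟨0, fun _ => rfl,
    fun z hz => ?_⟩⟩
  · exact S.weighted.with_weight ((F.hasBval hJ hj hi hd).cont.mul S.weighted.continuousOn)
      fun x hx => mul_ne_zero (F.bval_ne_zero hJ hj hi hd x hx) (S.weighted.ne_zero x hx)
  · rw [elim_empty, S.rep a ha.1 ha.2.1 z hz, Complex.ofReal_zero, zero_add]
    refine S.weighted.toConcentrated.ct_congr (fun x hx => ?_) z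
    rw [← hasBval_congr (F.zero a ha), F.bval_mul hJ ha hj hi hd x hx, mul_assoc]

/-- One elimination step at the level of Cauchy transforms. -/
lemma rep_insert (S : ElimStep m i I φ φ' Q μ₀ w₀) {J : Finset ℕ}
    (hJ : J ⊆ Finset.Icc (i + 1) m) {k j : ℕ} (hk : Adm m (i + 1) J k)
    (hj : Adm m (i + 1) J j) (hjk : j ≠ k)
    {μ : Measure ℝ} {w : ℝ → ℝ} (hw : Weighted (I (i + J.card + 1)) μ w)
    (hrep : ∀ a, Adm m (i + 1) J a → ∃ C : ℝ, (i + J.card + 1 ≤ a → C = 0) ∧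
      ∀ z ∈ nonreal, elim φ Q J a z = C + ct μ (fun x => bval (Q J a k) x * w x) z)
    {g : Measure ℝ} {v : ℝ → ℝ} (hv : Weighted (I (i + 1 + J.card + 1)) g v)
    (hQ : ∀ a, Adm m (i + 1) J a → a ≠ k → ∃ α β : ℝ,
        (α ≠ 0 → a < i + 1 + J.card + 1 ∧ i + 1 + J.card + 1 ≤ k) ∧
        (i + 1 + J.card + 1 ≤ a → k < i + 1 + J.card + 1 → β = 0) ∧
        ∀ z ∈ nonreal,
          Q J a k z = α * z + β + ct g (fun x => bval (Q (insert k J) a j) x * v x) z) :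
    ∀ a, Adm m (i + 1) (insert k J) a → ∃ C : ℝ, (i + J.card + 1 + 1 ≤ a → C = 0) ∧
      ∀ z ∈ nonreal, elim φ Q (insert k J) a z =
        C + ct g (fun x => bval (Q (insert k J) a j) x * (-(v x * bval (elim φ Q J k) x))) z := by
  intro a ha
  have F := S.fam
  have hm : i + 1 + J.card + 1 ≤ m := hj.card_lt hJ hk hjk
  have hak : a ≠ k := fun h => ha.2.2 (by simp [h])
  have haJ : Adm m (i + 1) J a := ⟨ha.1, ha.2.1, fun h => ha.2.2 (Finset.mem_insert_of_mem h)⟩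
  obtain ⟨α, hα, hα'⟩ := hrep a haJ
  obtain ⟨β, hβ, hβ'⟩ := hrep k hk
  obtain ⟨c, d, hc, hd, hQa⟩ := hQ a haJ hak
  have hβ'' : ∀ z ∈ nonreal, elim φ Q J k z = (0 : ℝ) * z + β + ct μ w z := by
    intro z hz
    rw [hβ' z hz, Complex.ofReal_zero, zero_mul, zero_add]
    congr 1
    refine hw.toConcentrated.ct_congr (fun x _ => ?_) z
    rw [(F.bval_one hJ hk univ).2, one_mul]
  have hins := hk.insert_subset hJ
  have hkc : (insert k J).card = J.card + 1 := Finset.card_insert_of_notMem hk.2.2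
  set V : ℝ → ℝ := fun x => bval (Q (insert k J) a j) x * v x with hV
  have hVc : ContinuousOn V (I (i + 1 + J.card + 1)) := by
    refine ContinuousOn.mul (F.hasBval hins ha (hj.adm_insert hjk) ?_).cont hv.continuousOn
    intro h
    rw [hkc] at h ⊢
    exact (S.disj (i + 1 + J.card + 1) (by omega) h).symm
  have hdis := S.disjoint_tail' J hm
  have hy := (hw.toConcentrated.hasBval hw.continuousOn hdis hβ'').2
  have hq := (hv.toConcentrated.hasBval hVc hdis.symm hQa).2
  have hcβ : c * β = 0 := by
    by_cases hc0 : c = 0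
    · rw [hc0, zero_mul]
    · rw [hβ (by have := (hc hc0).2; omega), mul_zero]
  refine ⟨α - d * β - c * ∫ x, w x ∂μ, fun hle => ?_, fun z hz => ?_⟩
  · have hc0 : c = 0 := by
      by_contra hc0
      have := (hc hc0).1
      omega
    have hdβ : d * β = 0 := by
      by_cases hkl : k < i + 1 + J.card + 1
      · rw [hd (by omega) hkl, zero_mul]
      · rw [hβ (by omega), mul_zero]
    rw [hα (by omega), hc0, hdβ]
    simp
  · have hz1 : z ∉ cSet (I (i + J.card + 1)) := notMem_cSet_of_nonreal hz
    have hz2 : z ∉ cSet (I (i + 1 + J.card + 1)) := notMem_cSet_of_nonreal hz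
    rw [F.elim_insert hJ hk haJ hak hz, hα' z hz, hβ'' z hz, hQa z hz]
    have e1 : ct μ (fun x => bval (Q J a k) x * w x) z =
        c * ct μ (fun x => x * w x) z + d * ct μ w z + ct μ (fun x => w x * ctR g V x) z := by
      rw [← ct_const_mul, ← ct_const_mul,
        ← hw.toConcentrated.ct_add (w := fun x => c * (x * w x)) (v := fun x => d * w x)
          (continuousOn_const.mul (continuousOn_id.mul hw.continuousOn))
          (continuousOn_const.mul hw.continuousOn) hz1,
        ← hw.toConcentrated.ct_add (w := fun x => c * (x * w x) + d * w x)
          ((continuousOn_const.mul (continuousOn_id.mul hw.continuousOn)).add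
          (continuousOn_const.mul hw.continuousOn))
          (v := fun x => w x * ctR g V x)
          (hw.continuousOn.mul (hv.toConcentrated.continuousOn_ctR hVc hdis.symm)) hz1]
      refine hw.toConcentrated.ct_congr (fun x hx => ?_) z
      rw [hq x hx]
      ring
    have e2 : ct g (fun x => bval (Q (insert k J) a j) x * (-(v x * bval (elim φ Q J k) x))) z =
        -(β * ct g V z + ct g (fun x => V x * ctR μ w x) z) := by
      rw [← ct_const_mul,
        ← hv.toConcentrated.ct_add (w := fun x => β * V x) (v := fun x => V x * ctR μ w x) (continuousOn_const.mul hVc)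
          (hVc.mul (hw.toConcentrated.continuousOn_ctR hw.continuousOn hdis)) hz2, ← ct_neg]
      refine hv.toConcentrated.ct_congr (fun x hx => ?_) z
      rw [hy x hx, hV]
      ring
    rw [e1, e2]
    have e3 := hw.toConcentrated.ct_mul hv.toConcentrated hdis hw.continuousOn hVc hz1 hz2
    have e4 := hw.toConcentrated.mul_ct hw.continuousOn hz1
    have e5 : (c : ℂ) * β = 0 := by exact_mod_cast hcβ
    push_cast
    linear_combination (-1 : ℂ) * e3 - (c : ℂ) * e4 - z * e5

/-- Nonvanishing of the eliminated functions. -/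
lemma nonvanishing (S : ElimStep m i I φ φ' Q μ₀ w₀) {J : Finset ℕ}
    (hJ : J ⊆ Finset.Icc (i + 1) m)
    (hrep : ∀ K : Finset ℕ, K.card = J.card → K ⊆ Finset.Icc (i + 1) m →
      ∀ j, Adm m (i + 1) K j → ElimRep m i I φ Q K j)
    {a : ℕ} (ha : Adm m (i + 1) J a) {μ : Measure ℝ} {w : ℝ → ℝ}
    (hw : Weighted (I (i + J.card + 1)) μ w) {C : ℝ} (hC : i + J.card + 1 ≤ a → C = 0)
    (h : ∀ z ∈ nonreal, elim φ Q J a z = C + ct μ w z) :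
    (∀ t ∉ I (i + J.card + 1), C + ctR μ w t ≠ 0) ∧ (a < i + J.card + 1 → C ≠ 0) := by
  have F := S.fam
  by_cases hmax : ∀ x ∈ J, x < a
  · have h1 : i + J.card + 1 ≤ a := by
      have h2 : J ⊆ Finset.Ico (i + 1) a := fun x hx =>
        Finset.mem_Ico.2 ⟨(Finset.mem_Icc.1 (hJ hx)).1, hmax x hx⟩
      have h3 := Finset.card_le_card h2
      rw [Nat.card_Ico] at h3
      have := ha.1
      omega
    refine ⟨fun t ht => ?_, fun h2 => by omega⟩
    rw [hC h1, zero_add]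
    exact hw.ctR_ne_zero ht
  · push Not at hmax
    obtain ⟨x, hx, hax⟩ := hmax
    have hne : J.Nonempty := ⟨x, hx⟩
    set M := J.max' hne with hM
    have hMJ : M ∈ J := J.max'_mem hne
    have haM : a < M := lt_of_le_of_ne (hax.trans (J.le_max' x hx)) fun h => ha.2.2 (h ▸ hMJ)
    have hMm := Finset.mem_Icc.1 (hJ hMJ)
    have h1 : i + J.card + 1 ≤ M := by
      have h2 : insert a J ⊆ Finset.Icc (i + 1) M := by
        intro y hy
        rcases Finset.mem_insert.1 hy with rfl | hy
        · exact Finset.mem_Icc.2 ⟨ha.1, haM.le⟩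
        · exact Finset.mem_Icc.2 ⟨(Finset.mem_Icc.1 (hJ hy)).1, J.le_max' y hy⟩
      have h3 := Finset.card_le_card h2
      rw [Finset.card_insert_of_notMem ha.2.2, Nat.card_Icc] at h3
      omega
    set J' := J.erase M with hJ'def
    have hJJ' : insert M J' = J := Finset.insert_erase hMJ
    have hJ' : J' ⊆ Finset.Icc (i + 1) m := (Finset.erase_subset _ _).trans hJ
    have hcard : J.card = J'.card + 1 := by
      rw [← hJJ', Finset.card_insert_of_notMem (Finset.notMem_erase M J)]
    have hMa : Adm m (i + 1) J' M := ⟨hMm.1, hMm.2, Finset.notMem_erase M J⟩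
    have haa : Adm m (i + 1) J' a := ⟨ha.1, ha.2.1, fun h => ha.2.2 (Finset.erase_subset _ _ h)⟩
    have hKc : (insert a J').card = J.card := by
      rw [Finset.card_insert_of_notMem haa.2.2, hcard]
    obtain ⟨ν, v, hv, hνv⟩ := hrep (insert a J') hKc (haa.insert_subset hJ') M
      (hMa.adm_insert haM.ne')
    obtain ⟨C', hC', hKz⟩ := hνv M (hMa.adm_insert haM.ne')
    rw [hKc] at hv hC'
    have hK : ∀ z ∈ nonreal, elim φ Q (insert a J') M z = ct ν v z := by
      intro z hz
      rw [hKz z hz, hC' h1, Complex.ofReal_zero, zero_add]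
      refine hv.toConcentrated.ct_congr (fun x _ => ?_) z
      rw [(F.bval_one (haa.insert_subset hJ') (hMa.adm_insert haM.ne') univ).2, one_mul]
    obtain ⟨g, u, hu, α, β, hα, hβ, hQ⟩ := F.rep_self hJ' hMa haa haM.ne'
    have hthr : i + 1 + J'.card + 1 = i + J.card + 1 := by omega
    rw [hthr] at hu hα hβ
    have hα0 : α = 0 := by
      by_contra h0
      have := (hα h0).1
      omega
    have hrel : ∀ z ∈ nonreal, ct ν v z = (-Q J' M a z) * elim φ Q J a z := by
      intro z hz
      have e1 := F.elim_insert (φ := φ) hJ' hMa haa haM.ne hz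
      have e2 := F.elim_insert (φ := φ) hJ' haa hMa haM.ne' hz
      have e3 := F.mul_inv_cancel hJ' hMa haa hz
      rw [hJJ'] at e1
      rw [← hK z hz, e2, e1]
      linear_combination (-elim φ Q J' M z) * e3
    refine ⟨fun t ht h0 => ?_, fun hat hC0 => ?_⟩
    · have hdis : Disjoint (I (i + J.card + 1)) {t} := disjoint_singleton_right.2 ht
      have hY : HasBval (elim φ Q J a) {t} ∧ _ := hw.toConcentrated.hasBval hw.continuousOn hdis
        (α := 0) (β := C) (fun z hz => by rw [h z hz]; simp)
      have hN : HasBval (ct ν v) {t} ∧ _ := hv.toConcentrated.hasBval hv.continuousOn hdis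
        (α := 0) (β := 0) (fun z hz => by simp)
      have hq : HasBval (fun z => -Q J' M a z) {t} ∧ _ :=
        hu.toConcentrated.hasBval hu.continuousOn.neg hdis
        (α := -α) (β := -β) (fun z hz => by
          change _ = _ + ct g (fun x => -u x) z
          rw [hQ z hz, ct_neg]; push_cast; ring)
      have e1 := (hq.1.mul hY.1 hrel).2 t rfl
      rw [hN.2 t rfl, hY.2 t rfl, zero_mul, zero_add, zero_add, zero_add, h0, mul_zero] at e1
      exact hv.ctR_ne_zero ht e1
    · have hβ0 := hβ h1 hat
      have h2 := hv.toConcentrated.tendsto_mul_ct hv.continuousOn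
      have h3 : Tendsto (fun z => -(z * ct g u z) * ct μ w z) imInfty (𝓝 (-((∫ x, u x ∂g : ℝ) : ℂ) * 0)) :=
        (hu.toConcentrated.tendsto_mul_ct hu.continuousOn).neg.mul
          (hw.toConcentrated.tendsto_ct hw.continuousOn)
      rw [mul_zero] at h3
      have h4 := tendsto_nhds_unique_of_eventuallyEq h2 h3 (by
        filter_upwards [eventually_nonreal] with z hz
        rw [hrel z hz, hQ z hz, h z hz, hα0, hβ0, hC0]
        push_cast
        ring)
      exact hv.integral_ne_zero (by exact_mod_cast h4)

lemma elimRep (S : ElimStep m i I φ φ' Q μ₀ w₀) (r : ℕ) : ∀ J : Finset ℕ, J.card = r →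
    J ⊆ Finset.Icc (i + 1) m → ∀ j, Adm m (i + 1) J j → ElimRep m i I φ Q J j := by
  induction r with
  | zero =>
    intro J hJ0 _ j hj
    rw [Finset.card_eq_zero] at hJ0
    subst hJ0
    exact S.rep_empty hj
  | succ r ih =>
    intro J hJr hJ j hj
    have F := S.fam
    obtain ⟨k, hk⟩ : J.Nonempty := by
      rw [← Finset.card_pos, hJr]; exact r.succ_pos
    set J' := J.erase k with hJ'def
    have hJJ' : insert k J' = J := Finset.insert_erase hk
    have hJ' : J' ⊆ Finset.Icc (i + 1) m := (Finset.erase_subset _ _).trans hJ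
    have hcard : J'.card = r := by
      rw [hJ'def, Finset.card_erase_of_mem hk, hJr]; rfl
    have hkm := Finset.mem_Icc.1 (hJ hk)
    have hka : Adm m (i + 1) J' k := ⟨hkm.1, hkm.2, Finset.notMem_erase k J⟩
    have hja : Adm m (i + 1) J' j := ⟨hj.1, hj.2.1, fun h => hj.2.2 (Finset.erase_subset _ _ h)⟩
    have hjk : j ≠ k := fun h => hj.2.2 (h ▸ hk)
    obtain ⟨μ, w, hw, hrep⟩ := ih J' hcard hJ' k hka
    obtain ⟨C, hC, hCz⟩ := hrep k hka
    obtain ⟨g, v, hv, hQ⟩ := F.rep J' hJ' j k hja hka hjk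
    have hyk : ∀ z ∈ nonreal, elim φ Q J' k z = C + ct μ w z := by
      intro z hz
      rw [hCz z hz]
      congr 1
      refine hw.toConcentrated.ct_congr (fun x _ => ?_) z
      rw [(F.bval_one hJ' hka univ).2, one_mul]
    have hnv := (S.nonvanishing hJ' (by rw [hcard]; exact ih) hka hw hC hyk).1
    have hdis := S.disjoint_tail' J' (hja.card_lt hJ' hka hjk)
    have hy := hw.toConcentrated.hasBval (f := elim φ Q J' k) (α := 0) (β := C)
      hw.continuousOn hdis fun z hz => by rw [hyk z hz]; simp
    have hthr : i + 1 + J'.card + 1 = i + J.card + 1 := by omega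
    have hthr' : i + J'.card + 1 + 1 = i + J.card + 1 := by omega
    have hfin := S.rep_insert hJ' hka hja hjk hw hrep hv hQ
    rw [hJJ', hthr'] at hfin
    rw [hthr] at hv hy hdis
    refine ⟨g, _, hv.with_weight (hv.continuousOn.mul hy.1.cont).neg fun x hx => ?_, hfin⟩
    refine neg_ne_zero.2 (mul_ne_zero (hv.ne_zero x hx) ?_)
    rw [hy.2 x hx, zero_mul, zero_add]
    exact hnv x fun hx' => hdis.le_bot ⟨hx', hx⟩

end ElimStep

/-- The functions obtained by eliminating the columns in `J`, with the constant function `1`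
labelled by `i`. -/
def stepZ (φ : ℕ → ℂ → ℂ) (Q : Finset ℕ → ℕ → ℕ → ℂ → ℂ) (i : ℕ) (J : Finset ℕ) (a : ℕ)
    (z : ℂ) : ℂ := if a = i then 1 else elim φ Q J a z

/-- The ratio family obtained by adding the column `i`. -/
def stepQ (φ : ℕ → ℂ → ℂ) (Q : Finset ℕ → ℕ → ℕ → ℂ → ℂ) (i : ℕ) (J : Finset ℕ) (a b : ℕ)
    (z : ℂ) : ℂ :=
  if i ∈ J then Q (J.erase i) a b z else stepZ φ Q i J a z / stepZ φ Q i J b z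

namespace ElimStep

variable {m i : ℕ} {I : ℕ → Set ℝ} {φ φ' : ℕ → ℂ → ℂ} {Q : Finset ℕ → ℕ → ℕ → ℂ → ℂ}
  {μ₀ : Measure ℝ} {w₀ : ℝ → ℝ}

lemma elim_form (S : ElimStep m i I φ φ' Q μ₀ w₀) {J : Finset ℕ}
    (hJ : J ⊆ Finset.Icc (i + 1) m) {a : ℕ} (ha : Adm m (i + 1) J a) :
    ∃ (μ : Measure ℝ) (w : ℝ → ℝ) (C : ℝ), Weighted (I (i + J.card + 1)) μ w ∧
      (i + J.card + 1 ≤ a → C = 0) ∧ (∀ z ∈ nonreal, elim φ Q J a z = C + ct μ w z) ∧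
      (∀ t ∉ I (i + J.card + 1), C + ctR μ w t ≠ 0) ∧ (a < i + J.card + 1 → C ≠ 0) ∧
      ∀ a', Adm m (i + 1) J a' → ∃ C : ℝ, (i + J.card + 1 ≤ a' → C = 0) ∧
        ∀ z ∈ nonreal, elim φ Q J a' z = C + ct μ (fun x => bval (Q J a' a) x * w x) z := by
  obtain ⟨μ, w, hw, h⟩ := S.elimRep _ J rfl hJ a ha
  obtain ⟨C, hC, hz⟩ := h a ha
  have hz' : ∀ z ∈ nonreal, elim φ Q J a z = C + ct μ w z := by
    intro z hz1
    rw [hz z hz1]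
    congr 1
    refine hw.toConcentrated.ct_congr (fun x _ => ?_) z
    rw [(S.fam.bval_one hJ ha univ).2, one_mul]
  obtain ⟨h1, h2⟩ := S.nonvanishing hJ (S.elimRep _) ha hw hC hz'
  exact ⟨μ, w, C, hw, hC, hz', h1, h2, h⟩

lemma subset_succ {J : Finset ℕ} (hJ : J ⊆ Finset.Icc i m) (hi : i ∉ J) :
    J ⊆ Finset.Icc (i + 1) m := by
  intro x hx
  have h1 := Finset.mem_Icc.1 (hJ hx)
  have h2 : x ≠ i := fun h => hi (h ▸ hx)
  exact Finset.mem_Icc.2 ⟨by omega, h1.2⟩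

lemma erase_subset_succ {J : Finset ℕ} (hJ : J ⊆ Finset.Icc i m) :
    J.erase i ⊆ Finset.Icc (i + 1) m :=
  subset_succ ((Finset.erase_subset _ _).trans hJ) (Finset.notMem_erase _ _)

lemma adm_succ {J : Finset ℕ} {a : ℕ} (ha : Adm m i J a) (hi : a ≠ i) : Adm m (i + 1) J a :=
  ⟨by have := ha.1; omega, ha.2⟩

lemma adm_erase {J : Finset ℕ} {a : ℕ} (hi : i ∈ J) (ha : Adm m i J a) :
    Adm m (i + 1) (J.erase i) a :=
  ⟨by have := ha.1; have : a ≠ i := fun h => ha.2.2 (h ▸ hi); omega, ha.2.1,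
    fun h => ha.2.2 (Finset.erase_subset _ _ h)⟩

lemma stepZ_ne_zero (S : ElimStep m i I φ φ' Q μ₀ w₀) {J : Finset ℕ}
    (hJ : J ⊆ Finset.Icc i m) (hi : i ∉ J) {a : ℕ} (ha : Adm m i J a) {z : ℂ}
    (hz : z ∈ nonreal) : stepZ φ Q i J a z ≠ 0 := by
  rw [stepZ]
  split_ifs with h
  · exact one_ne_zero
  · obtain ⟨μ, w, C, hw, -, h1, -⟩ := S.elim_form (subset_succ hJ hi) (adm_succ ha h)
    rw [h1 z hz]
    exact hw.const_add_ct_ne_zero C hz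

lemma stepZ_hasBval (S : ElimStep m i I φ φ' Q μ₀ w₀) {J : Finset ℕ}
    (hJ : J ⊆ Finset.Icc i m) (hi : i ∉ J) {a : ℕ} (ha : Adm m i J a) {K : Set ℝ}
    (hK : i + J.card + 1 ≤ m → Disjoint (I (i + J.card + 1)) K) :
    HasBval (stepZ φ Q i J a) K ∧ ∀ x ∈ K, bval (stepZ φ Q i J a) x ≠ 0 := by
  by_cases h : a = i
  · obtain ⟨h1, h2⟩ := hasBval_const (f := stepZ φ Q i J a) 1 K fun z _ => by simp [stepZ, h]
    exact ⟨h1, fun x hx => by rw [h2 x hx]; exact one_ne_zero⟩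
  · obtain ⟨μ, w, C, hw, -, h1, h3, -⟩ := S.elim_form (subset_succ hJ hi) (adm_succ ha h)
    have hd := hK ((adm_succ ha h).card_lt' (subset_succ hJ hi))
    obtain ⟨h4, h5⟩ := hw.toConcentrated.hasBval hw.continuousOn hd
      (f := stepZ φ Q i J a) (α := 0) (β := C) fun z hz => by simp [stepZ, h, h1 z hz]
    refine ⟨h4, fun x hx => ?_⟩
    rw [h5 x hx, zero_mul, zero_add]
    exact h3 x fun hx' => hd.le_bot ⟨hx', hx⟩

lemma stepQ_one (S : ElimStep m i I φ φ' Q μ₀ w₀) {J : Finset ℕ} (hJ : J ⊆ Finset.Icc i m)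
    {a : ℕ} (ha : Adm m i J a) {z : ℂ} (hz : z ∈ nonreal) : stepQ φ Q i J a a z = 1 := by
  rw [stepQ]
  split_ifs with h
  · exact S.fam.one _ (erase_subset_succ hJ) a (adm_erase h ha) z hz
  · exact div_self (S.stepZ_ne_zero hJ h ha hz)

lemma stepQ_mul (S : ElimStep m i I φ φ' Q μ₀ w₀) {J : Finset ℕ} (hJ : J ⊆ Finset.Icc i m)
    {a b c : ℕ} (ha : Adm m i J a) (hb : Adm m i J b) (hc : Adm m i J c) {z : ℂ}
    (hz : z ∈ nonreal) : stepQ φ Q i J a b z * stepQ φ Q i J b c z = stepQ φ Q i J a c z := by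
  simp only [stepQ]
  split_ifs with h
  · exact S.fam.mul _ (erase_subset_succ hJ) a b c (adm_erase h ha) (adm_erase h hb)
      (adm_erase h hc) z hz
  · have := S.stepZ_ne_zero hJ h hb hz
    have := S.stepZ_ne_zero hJ h hc hz
    field_simp

lemma stepQ_three_term (S : ElimStep m i I φ φ' Q μ₀ w₀) {J : Finset ℕ} (hJ : J ⊆ Finset.Icc i m)
    {a' a b : ℕ} (ha' : Adm m i J a') (ha : Adm m i J a) (hb : Adm m i J b) (h1 : a' ≠ a)
    (h2 : a' ≠ b) (h3 : a ≠ b) {z : ℂ} (hz : z ∈ nonreal) :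
    stepQ φ Q i J a' b z = stepQ φ Q i (insert b J) a' a z * stepQ φ Q i J a b z +
      stepQ φ Q i (insert a J) a' b z := by
  have F := S.fam
  by_cases hi : i ∈ J
  · have hib : i ≠ b := fun h => hb.2.2 (h ▸ hi)
    have hia : i ≠ a := fun h => ha.2.2 (h ▸ hi)
    simp only [stepQ, hi, Finset.mem_insert, or_true, if_true]
    rw [Finset.erase_insert_of_ne hib.symm, Finset.erase_insert_of_ne hia.symm]
    exact F.three_term _ (erase_subset_succ hJ) a' a b (adm_erase hi ha') (adm_erase hi ha)
      (adm_erase hi hb) h1 h2 h3 z hz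
  · have hJ' := subset_succ hJ hi
    have hJb := hb.insert_subset hJ
    have hJa := ha.insert_subset hJ
    have nb := S.stepZ_ne_zero hJ hi hb hz
    have na := S.stepZ_ne_zero hJ hi ha hz
    by_cases hbi : b = i
    · subst hbi
      have e := F.elim_insert (φ := φ) hJ' (adm_succ ha h3) (adm_succ ha' h2) h1 hz
      simp only [stepQ, hi, Finset.mem_insert, or_false, if_true, if_false, stepZ, h2,
        h3, h3.symm, Finset.erase_insert hi, div_one]
      rw [e]
      ring
    · have hbi' : i ≠ b := Ne.symm hbi
      have nab := S.stepZ_ne_zero hJb (by simp [hbi', hi]) (ha.adm_insert h3) hz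
      have hb1 := adm_succ hb hbi
      by_cases hai : a = i
      · subst hai
        have e := F.elim_insert (φ := φ) hJ' hb1 (adm_succ ha' h1) h2 hz
        simp only [stepZ, hbi, if_false] at nb
        simp only [stepQ, hi, Finset.mem_insert, or_false, if_true, if_false, stepZ, h1,
          h3, hbi, Finset.erase_insert hi, div_one]
        rw [e]
        field_simp
        ring
      · have hai' : i ≠ a := Ne.symm hai
        have ha1 := adm_succ ha hai
        have nba := S.stepZ_ne_zero hJa (by simp [hai', hi]) (hb.adm_insert h3.symm) hz
        have eab := F.elim_insert (φ := φ) hJ' hb1 ha1 h3 hz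
        have eba := F.elim_insert (φ := φ) hJ' ha1 hb1 h3.symm hz
        have huv := F.mul_inv_cancel hJ' ha1 hb1 hz
        simp only [stepZ, hbi, hai, if_false] at nb na nab nba
        have nu : Q J a b z ≠ 0 := left_ne_zero_of_mul_eq_one huv
        have key : elim φ Q (insert a J) b z = -Q J b a z * elim φ Q (insert b J) a z := by
          rw [eab, eba]
          linear_combination (-elim φ Q J b z) * huv
        have hv : Q J b a z = (Q J a b z)⁻¹ := eq_inv_of_mul_eq_one_right huv
        have hYa : elim φ Q J a z = elim φ Q (insert b J) a z + Q J a b z * elim φ Q J b z := by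
          rw [eab]
          ring
        by_cases ha'i : a' = i
        · subst ha'i
          simp only [stepQ, hi, Finset.mem_insert, h1, h2, or_false, if_true, if_false, stepZ,
            hbi, hai]
          rw [key, hv, hYa]
          field_simp
          ring
        · have ha'1 := adm_succ ha' ha'i
          have e1 := F.elim_insert (φ := φ) hJ' hb1 ha'1 h2 hz
          have e2 := F.elim_insert (φ := φ) hJ' ha1 ha'1 h1 hz
          have hmul := F.mul J hJ' a' a b ha'1 ha1 hb1 z hz
          simp only [stepQ, hi, Finset.mem_insert, hai', hbi', or_false, if_false, stepZ,
            hbi, hai, ha'i]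
          rw [key, e1, e2, ← hmul, hv, hYa]
          field_simp
          ring

end ElimStep

namespace ElimStep

variable {m i : ℕ} {I : ℕ → Set ℝ} {φ φ' : ℕ → ℂ → ℂ} {Q : Finset ℕ → ℕ → ℕ → ℂ → ℂ}
  {μ₀ : Measure ℝ} {w₀ : ℝ → ℝ}

lemma stepQ_hasBval (S : ElimStep m i I φ φ' Q μ₀ w₀) {J : Finset ℕ} (hJ : J ⊆ Finset.Icc i m)
    (hi : i ∉ J) {a b : ℕ} (ha : Adm m i J a) (hb : Adm m i J b) {K : Set ℝ}
    (hK : i + J.card + 1 ≤ m → Disjoint (I (i + J.card + 1)) K) :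
    HasBval (stepQ φ Q i J a b) K := by
  obtain ⟨h1, -⟩ := S.stepZ_hasBval hJ hi ha hK
  obtain ⟨h2, h3⟩ := S.stepZ_hasBval hJ hi hb hK
  refine (h1.mul (h2.inv h3).1 fun z hz => ?_).1
  rw [stepQ, if_neg hi, div_eq_mul_inv]

lemma stepQ_bval_mul (S : ElimStep m i I φ φ' Q μ₀ w₀) {J : Finset ℕ}
    (hJ : J ⊆ Finset.Icc i m) (hi : i ∉ J) {a b c : ℕ} (ha : Adm m i J a) (hb : Adm m i J b)
    (hc : Adm m i J c) {K : Set ℝ}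
    (hK : i + J.card + 1 ≤ m → Disjoint (I (i + J.card + 1)) K) :
    ∀ x ∈ K, bval (stepQ φ Q i J a c) x =
      bval (stepQ φ Q i J a b) x * bval (stepQ φ Q i J b c) x :=
  ((S.stepQ_hasBval hJ hi ha hb hK).mul (S.stepQ_hasBval hJ hi hb hc hK)
    fun _ hz => (S.stepQ_mul hJ ha hb hc hz).symm).2

lemma stepQ_bval_ne_zero (S : ElimStep m i I φ φ' Q μ₀ w₀) {J : Finset ℕ}
    (hJ : J ⊆ Finset.Icc i m) (hi : i ∉ J) {a b : ℕ} (ha : Adm m i J a) (hb : Adm m i J b)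
    {K : Set ℝ} (hK : i + J.card + 1 ≤ m → Disjoint (I (i + J.card + 1)) K) :
    ∀ x ∈ K, bval (stepQ φ Q i J a b) x ≠ 0 :=
  (S.stepQ_hasBval hJ hi ha hb hK).ne_zero (S.stepQ_hasBval hJ hi hb ha hK) fun _ hz => by
    rw [S.stepQ_mul hJ ha hb ha hz, S.stepQ_one hJ ha hz]

/-- The representation of the ratios `Q J a b` normalised at the new column. -/
lemma stepQ_rep_base (S : ElimStep m i I φ φ' Q μ₀ w₀) {J : Finset ℕ}
    (hJ : J ⊆ Finset.Icc i m) (hi : i ∉ J) {b : ℕ} (hb : Adm m i J b) (hbi : b ≠ i) :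
    ∃ (τ : Measure ℝ) (u : ℝ → ℝ), Weighted (I (i + J.card + 1)) τ u ∧
      ∀ a, Adm m i J a → a ≠ b → ∃ α β : ℝ,
        (α ≠ 0 → a < i + J.card + 1 ∧ i + J.card + 1 ≤ b) ∧
        (i + J.card + 1 ≤ a → b < i + J.card + 1 → β = 0) ∧
        ∀ z ∈ nonreal, stepQ φ Q i J a b z = α * z + β +
          ct τ (fun x => bval (stepQ φ Q i (insert b J) a i) x * u x) z := by
  have F := S.fam
  have hJ' := subset_succ hJ hi
  have hb1 := adm_succ hb hbi
  obtain ⟨μ, w, C, hw, hC, hYb, hnv, hC', hrep⟩ := S.elim_form hJ' hb1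
  obtain ⟨c, d, τ, u, hu, hc, hinv⟩ := hw.exists_inverse C hnv
  have hcb : c ≠ 0 → i + J.card + 1 ≤ b := by
    intro h
    by_contra hlt
    exact h (hc (hC' (by omega)))
  have hJb := hb.insert_subset hJ
  have hib : i ∉ insert b J := by simp [hbi.symm, hi]
  refine ⟨τ, u, hu, fun a ha hab => ?_⟩
  by_cases hai : a = i
  · subst hai
    refine ⟨c, d, fun h => ⟨by omega, hcb h⟩, fun h => by omega, fun z hz => ?_⟩
    have h1 : ∀ x, bval (stepQ φ Q a (insert b J) a a) x = 1 := fun x =>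
      (hasBval_const 1 {x} fun z hz => by
        rw [S.stepQ_one hJb (ha.adm_insert hab) hz, Complex.ofReal_one]).2 x rfl
    simp only [h1, one_mul]
    rw [← hinv z hz, ← hYb z hz, stepQ, if_neg hi, stepZ, stepZ, if_pos rfl, if_neg hbi, one_div]
  · have ha1 := adm_succ ha hai
    obtain ⟨g, v, hv, hQ⟩ := F.rep _ hJ' a b ha1 hb1 hab
    obtain ⟨c', d', hc1, hd1, hQa⟩ := hQ a ha1 hab
    obtain ⟨C₁, -, hY1⟩ := S.rep_insert hJ' hb1 ha1 hab hw hrep hv hQ a (ha1.adm_insert hab)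
    have hone := (F.bval_one (hb1.insert_subset hJ') (ha1.adm_insert hab) univ).2
    simp only [hone, one_mul] at hQa hY1
    have hdis := S.disjoint_tail' J (ha1.card_lt hJ' hb1 hab)
    have hy := hw.toConcentrated.hasBval (f := elim φ Q J b) (α := 0) (β := C)
      hw.continuousOn hdis fun z hz => by rw [hYb z hz]; simp
    set W : ℝ → ℝ := fun x => -(v x * bval (elim φ Q J b) x) with hW
    have hWc : ContinuousOn W (I (i + 1 + J.card + 1)) := (hv.continuousOn.mul hy.1.cont).neg
    have hy0 : ∀ x ∈ I (i + 1 + J.card + 1), bval (elim φ Q J b) x ≠ 0 := by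
      intro x hx
      rw [hy.2 x hx, zero_mul, zero_add]
      exact hnv x fun hx' => hdis.le_bot ⟨hx', hx⟩
    have hyinv := hu.toConcentrated.hasBval (f := fun z => (elim φ Q J b z)⁻¹) hu.continuousOn
      hdis fun z hz => by rw [hYb z hz]; exact hinv z hz
    have hWy : ∀ x ∈ I (i + 1 + J.card + 1), W x * (c * x + d + ctR τ u x) = - v x := by
      intro x hx
      rw [← hyinv.2 x hx, (hy.1.inv hy0).2 x hx, hW]
      have := hy0 x hx
      field_simp
    have hY1b : ∀ x ∈ I (i + J.card + 1),
        bval (stepQ φ Q i (insert b J) a i) x = C₁ + ctR g W x := by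
      intro x hx
      rw [(hv.toConcentrated.hasBval (α := 0) (β := C₁) hWc hdis.symm fun z hz => ?_).2 x hx]
      · ring
      · rw [stepQ, if_neg hib, stepZ, stepZ, if_pos rfl, if_neg hai, div_one, hY1 z hz]
        simp
    have hform : ∀ z ∈ nonreal, stepQ φ Q i J a b z = ((C₁ * c + c' : ℝ) : ℂ) * z +
        ((C₁ * d + c * (∫ x, W x ∂g) + d' : ℝ) : ℂ) +
          ct τ (fun x => bval (stepQ φ Q i (insert b J) a i) x * u x) z := by
      intro z hz
      have hz1 : z ∉ cSet (I (i + J.card + 1)) := notMem_cSet_of_nonreal hz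
      have hz2 : z ∉ cSet (I (i + 1 + J.card + 1)) := notMem_cSet_of_nonreal hz
      have hne : elim φ Q J b z ≠ 0 := by
        rw [hYb z hz]
        exact hw.const_add_ct_ne_zero C hz
      have e0 : stepQ φ Q i J a b z =
          elim φ Q (insert b J) a z * (elim φ Q J b z)⁻¹ + Q J a b z := by
        rw [F.elim_insert hJ' hb1 ha1 hab hz, stepQ, if_neg hi, stepZ, stepZ, if_neg hai,
          if_neg hbi]
        field_simp
        ring
      have e1 : ct τ (fun x => bval (stepQ φ Q i (insert b J) a i) x * u x) z =
          C₁ * ct τ u z + ct τ (fun x => u x * ctR g W x) z := by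
        rw [← ct_const_mul, ← hu.toConcentrated.ct_add (w := fun x => C₁ * u x)
          (v := fun x => u x * ctR g W x) (continuousOn_const.mul hu.continuousOn)
          (hu.continuousOn.mul (hv.toConcentrated.continuousOn_ctR hWc hdis.symm)) hz1]
        refine hu.toConcentrated.ct_congr (fun x hx => ?_) z
        rw [hY1b x hx]
        ring
      have hτc := hu.toConcentrated.continuousOn_ctR hu.continuousOn hdis
      have e2 : c * ct g (fun x => x * W x) z + d * ct g W z +
          ct g (fun x => W x * ctR τ u x) z = - ct g v z := by
        rw [← ct_const_mul, ← ct_const_mul, ← ct_neg,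
          ← hv.toConcentrated.ct_add (w := fun x => c * (x * W x)) (v := fun x => d * W x)
            (continuousOn_const.mul (continuousOn_id.mul hWc)) (continuousOn_const.mul hWc) hz2,
          ← hv.toConcentrated.ct_add (w := fun x => c * (x * W x) + d * W x)
            (v := fun x => W x * ctR τ u x)
            ((continuousOn_const.mul (continuousOn_id.mul hWc)).add (continuousOn_const.mul hWc))
            (hWc.mul hτc) hz2]
        refine hv.toConcentrated.ct_congr (fun x hx => ?_) z
        rw [← hWy x hx]
        ring
      have e3 := hv.toConcentrated.ct_mul hu.toConcentrated hdis.symm hWc hu.continuousOn hz2 hz1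
      have e4 := hv.toConcentrated.mul_ct hWc hz2
      rw [e0, e1, hY1 z hz, hYb z hz, hinv z hz, hQa z hz]
      push_cast
      linear_combination e2 + e3 + (c : ℂ) * e4
    have hwc : ContinuousOn (fun x => bval (stepQ φ Q i (insert b J) a i) x * u x)
        (I (i + J.card + 1)) := by
      refine ContinuousOn.mul ?_ hu.continuousOn
      exact ContinuousOn.congr (continuousOn_const.add
        (hv.toConcentrated.continuousOn_ctR hWc hdis.symm)) hY1b
    have hlim : i + J.card + 1 ≤ a → ∃ L : ℝ, C₁ * c + c' = 0 ∧
        C₁ * d + c * (∫ x, W x ∂g) + d' = c * L := by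
      intro hle
      obtain ⟨μ', w', C', hw', hC0, hYa, -⟩ := S.elim_form hJ' ha1
      refine ⟨∫ x, w' x ∂μ', ?_⟩
      have t1 := hw'.toConcentrated.tendsto_mul_ct hw'.continuousOn
      have t2 := hw'.toConcentrated.tendsto_ct hw'.continuousOn
      have t3 := hu.toConcentrated.tendsto_ct hu.continuousOn
      have t4 := (t1.const_mul (c : ℂ)).add (t2.mul (t3.const_add (d : ℂ)))
      have t5 := hu.toConcentrated.coeff_of_tendsto hwc hform (t4.congr' ?_)
      · refine ⟨t5.1, ?_⟩
        have := t5.2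
        rw [zero_mul, add_zero] at this
        exact_mod_cast this
      · filter_upwards [eventually_nonreal] with z hz
        rw [stepQ, if_neg hi, stepZ, stepZ, if_neg hai, if_neg hbi, div_eq_mul_inv, hYb z hz,
          hinv z hz, hYa z hz, hC0 hle]
        push_cast
        ring
    refine ⟨_, _, fun hα => ⟨?_, ?_⟩, fun h1 h2 => ?_, hform⟩
    · by_contra hlt
      obtain ⟨L, hL, -⟩ := hlim (by omega)
      exact hα hL
    · by_contra hlt
      apply hα
      have hc0 : c = 0 := by
        by_contra h
        exact hlt (hcb h)
      have hc0' : c' = 0 := by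
        by_contra h
        have := (hc1 h).2
        omega
      rw [hc0, hc0', mul_zero, add_zero]
    · obtain ⟨L, -, hL⟩ := hlim h1
      have hc0 : c = 0 := by
        by_contra h
        have := hcb h
        omega
      rw [hL, hc0, zero_mul]

/-- The extension of a ratio family by one column. -/
theorem ratioFamily (S : ElimStep m i I φ φ' Q μ₀ w₀) :
    RatioFamily m i I φ (stepQ φ Q i) where
  one J hJ a ha z hz := S.stepQ_one hJ ha hz
  mul J hJ a b c ha hb hc z hz := S.stepQ_mul hJ ha hb hc hz
  three_term J hJ a' a b ha' ha hb h1 h2 h3 z hz := S.stepQ_three_term hJ ha' ha hb h1 h2 h3 hz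
  zero a ha z hz := by
    rw [stepQ, if_neg (Finset.notMem_empty i), stepZ, stepZ, if_pos rfl, div_one]
    split_ifs with h
    · rw [h, S.one]
    · exact elim_empty a z
  rep J hJ a b ha hb hab := by
    have F := S.fam
    by_cases hi : i ∈ J
    · obtain ⟨μ, w, hw, h⟩ := F.rep _ (erase_subset_succ hJ) a b (adm_erase hi ha)
        (adm_erase hi hb) hab
      have hcard : i + 1 + (J.erase i).card + 1 = i + J.card + 1 := by
        have := Finset.card_erase_add_one hi
        omega
      rw [hcard] at hw h
      refine ⟨μ, w, hw, fun a' ha' ha'b => ?_⟩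
      obtain ⟨α, β, h1, h2, h3⟩ := h a' (adm_erase hi ha') ha'b
      have hib : b ≠ i := fun h => hb.2.2 (h ▸ hi)
      refine ⟨α, β, h1, h2, fun z hz => ?_⟩
      have e : stepQ φ Q i (insert b J) a' a = Q (insert b (J.erase i)) a' a := by
        ext z
        rw [stepQ, if_pos (Finset.mem_insert_of_mem hi), Finset.erase_insert_of_ne hib]
      rw [e, stepQ, if_pos hi, h3 z hz]
    · by_cases hbi : b = i
      · subst hbi
        obtain ⟨μ, w, C, hw, -, -, -, -, h⟩ := S.elim_form (subset_succ hJ hi) (adm_succ ha hab)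
        refine ⟨μ, w, hw, fun a' ha' ha'b => ?_⟩
        obtain ⟨C', hC', h'⟩ := h a' (adm_succ ha' ha'b)
        refine ⟨0, C', fun h => (h rfl).elim, fun h _ => hC' h, fun z hz => ?_⟩
        have e : stepQ φ Q b (insert b J) a' a = Q J a' a := by
          ext z
          rw [stepQ, if_pos (Finset.mem_insert_self _ _), Finset.erase_insert hi]
        rw [e, stepQ, if_neg hi, stepZ, stepZ, if_pos rfl, if_neg ha'b, div_one, h' z hz]
        simp
      · obtain ⟨τ, u, hu, h⟩ := S.stepQ_rep_base hJ hi hb hbi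
        have hJb := hb.insert_subset hJ
        have hib : i ∉ insert b J := by simp [Ne.symm hbi, hi]
        have hii : Adm m i (insert b J) i := ⟨le_rfl, by have := S.le; omega, hib⟩
        have hcard : (insert b J).card = J.card + 1 := Finset.card_insert_of_notMem hb.2.2
        have hd : i + (insert b J).card + 1 ≤ m →
            Disjoint (I (i + (insert b J).card + 1)) (I (i + J.card + 1)) := by
          rw [hcard]
          intro hle
          exact (S.disj (i + J.card + 1) (by omega) hle).symm
        refine ⟨τ, fun x => bval (stepQ φ Q i (insert b J) a i) x * u x,
          hu.with_weight ((S.stepQ_hasBval hJb hib (ha.adm_insert hab) hii hd).cont.mul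
            hu.continuousOn) fun x hx => mul_ne_zero (S.stepQ_bval_ne_zero hJb hib
            (ha.adm_insert hab) hii hd x hx) (hu.ne_zero x hx), fun a' ha' ha'b => ?_⟩
        obtain ⟨α, β, h1, h2, h3⟩ := h a' ha' ha'b
        refine ⟨α, β, h1, h2, fun z hz => ?_⟩
        rw [h3 z hz]
        congr 1
        refine hu.toConcentrated.ct_congr (fun x hx => ?_) z
        rw [S.stepQ_bval_mul hJb hib (ha'.adm_insert ha'b) (ha.adm_insert hab) hii hd x hx,
          mul_assoc]

end ElimStep

/-- The trivial ratio family of a system with a single function. -/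
lemma ratioFamily_self (m : ℕ) (I : ℕ → Set ℝ) (φ : ℕ → ℂ → ℂ) (hφ : ∀ z, φ m z = 1) :
    RatioFamily m m I φ fun _ _ _ _ => 1 where
  one _ _ _ _ _ _ := rfl
  mul _ _ _ _ _ _ _ _ _ _ := one_mul 1
  three_term _ _ a' a _ ha' ha _ h _ _ _ _ :=
    (h (le_antisymm ha'.2.1 ha'.1 |>.trans (le_antisymm ha.2.1 ha.1).symm)).elim
  zero a ha z _ := by rw [le_antisymm ha.2.1 ha.1, hφ]
  rep _ _ a b ha hb h :=
    (h (le_antisymm ha.2.1 ha.1 |>.trans (le_antisymm hb.2.1 hb.1).symm)).elim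

namespace Concentrated

variable {I : Set ℝ} {μ ν : Measure ℝ}

lemma aemeasurable (h : Concentrated I μ) {g : ℝ → ℝ} (hg : ContinuousOn g I) :
    AEMeasurable g μ :=
  (h.integrable hg).aestronglyMeasurable.aemeasurable

lemma withDensity (h : Concentrated I μ) {g : ℝ → ℝ} (hg : ContinuousOn g I) :
    Concentrated I (μ.withDensity fun x => ENNReal.ofReal (g x)) :=
  ⟨h.isCompact, isFiniteMeasure_withDensity_ofReal (h.integrable hg).2,
    withDensity_absolutelyContinuous _ _ h.null⟩

lemma add (h : Concentrated I μ) (h' : Concentrated I ν) : Concentrated I (μ + ν) := by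
  have := h.isFinite
  have := h'.isFinite
  exact ⟨h.isCompact, inferInstance, by simp [h.null, h'.null]⟩

lemma zero (hI : IsCompact I) : Concentrated I (0 : Measure ℝ) :=
  ⟨hI, inferInstance, by simp⟩

lemma integral_withDensity_sub {E : Type*} [NormedAddCommGroup E] [NormedSpace ℝ E]
    (h : Concentrated I μ) {g : ℝ → ℝ} (hg : ContinuousOn g I) {f : ℝ → E}
    (hf : ContinuousOn f I) :
    (∫ x, f x ∂(μ.withDensity fun x => ENNReal.ofReal (g x))) -
      (∫ x, f x ∂(μ.withDensity fun x => ENNReal.ofReal (-g x))) = ∫ x, g x • f x ∂μ := by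
  have hm := h.aemeasurable hg
  have hm' : AEMeasurable (fun x => -g x) μ := hm.neg
  rw [integral_withDensity_eq_integral_toReal_smul₀ hm.ennreal_ofReal (by simp),
    integral_withDensity_eq_integral_toReal_smul₀ hm'.ennreal_ofReal (by simp),
    ← integral_sub]
  · congr 1
    ext x
    rw [← sub_smul]
    congr 1
    rcases le_total 0 (g x) with h0 | h0
    · rw [ENNReal.toReal_ofReal h0, ENNReal.ofReal_of_nonpos (by linarith)]
      simp
    · rw [ENNReal.ofReal_of_nonpos h0, ENNReal.toReal_ofReal (neg_nonneg.2 h0)]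
      simp
  · simp only [ENNReal.toReal_ofReal']
    exact h.integrable ((hg.sup continuousOn_const).smul hf)
  · simp only [ENNReal.toReal_ofReal']
    exact h.integrable ((hg.neg.sup continuousOn_const).smul hf)

end Concentrated

/-- Both parts of the signed measure `s` live on `I`. -/
structure SConc (I : Set ℝ) (s : SignedM) : Prop where
  pos : Concentrated I s.pos
  neg : Concentrated I s.neg

namespace SConc

variable {I : Set ℝ} {s : SignedM}

lemma withDensityR (h : SConc I s) {g : ℝ → ℝ} (hg : ContinuousOn g I) :
    SConc I (s.withDensityR g) :=
  ⟨(h.pos.withDensity hg).add (h.neg.withDensity hg.neg),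
    (h.pos.withDensity hg.neg).add (h.neg.withDensity hg)⟩

lemma integral_withDensityR {E : Type*} [NormedAddCommGroup E] [NormedSpace ℝ E]
    (h : SConc I s) {g : ℝ → ℝ} (hg : ContinuousOn g I) {f : ℝ → E} (hf : ContinuousOn f I) :
    (∫ x, f x ∂(s.withDensityR g).pos) - (∫ x, f x ∂(s.withDensityR g).neg) =
      (∫ x, g x • f x ∂s.pos) - ∫ x, g x • f x ∂s.neg := by
  have hg' : ContinuousOn (fun x => -g x) I := hg.neg
  simp only [SignedM.withDensityR]
  rw [integral_add_measure ((h.pos.withDensity hg).integrable hf)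
      ((h.neg.withDensity hg').integrable hf),
    integral_add_measure ((h.pos.withDensity hg').integrable hf)
      ((h.neg.withDensity hg).integrable hf),
    ← h.pos.integral_withDensity_sub hg hf, ← h.neg.integral_withDensity_sub hg hf]
  abel

lemma cintegral_withDensityR (h : SConc I s) {g : ℝ → ℝ} (hg : ContinuousOn g I) {f : ℝ → ℂ}
    (hf : ContinuousOn f I) :
    (s.withDensityR g).cintegral f = s.cintegral fun x => (g x : ℂ) * f x :=
  h.integral_withDensityR hg hf

lemma rintegral_withDensityR (h : SConc I s) {g : ℝ → ℝ} (hg : ContinuousOn g I) {f : ℝ → ℝ}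
    (hf : ContinuousOn f I) :
    (s.withDensityR g).rintegral f = s.rintegral fun x => g x * f x :=
  h.integral_withDensityR hg hf

end SConc

/-- The signed measure `s` is `w μ`. -/
structure SRep (s : SignedM) (I : Set ℝ) (μ : Measure ℝ) (w : ℝ → ℝ) : Prop where
  conc : SConc I s
  weighted : Weighted I μ w
  cint : ∀ f : ℝ → ℂ, ContinuousOn f I → s.cintegral f = ∫ x, (w x : ℂ) * f x ∂μ
  rint : ∀ f : ℝ → ℝ, ContinuousOn f I → s.rintegral f = ∫ x, w x * f x ∂μ

lemma SRep.withDensityR {s : SignedM} {I : Set ℝ} {μ : Measure ℝ} {w : ℝ → ℝ}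
    (h : SRep s I μ w) {g : ℝ → ℝ} (hg : ContinuousOn g I) (h0 : ∀ x ∈ I, g x ≠ 0) :
    SRep (s.withDensityR g) I μ (fun x => g x * w x) where
  conc := h.conc.withDensityR hg
  weighted := h.weighted.with_weight (hg.mul h.weighted.continuousOn)
    fun x hx => mul_ne_zero (h0 x hx) (h.weighted.ne_zero x hx)
  cint f hf := by
    rw [h.conc.cintegral_withDensityR hg hf,
      h.cint (fun x => (g x : ℂ) * f x) ((Complex.continuous_ofReal.comp_continuousOn hg).mul hf)]
    congr 1
    ext x
    push_cast
    ring
  rint f hf := by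
    rw [h.conc.rintegral_withDensityR hg hf, h.rint (fun x => g x * f x) (hg.mul hf)]
    congr 1
    ext x
    ring

lemma SRep.cauchy {s : SignedM} {I : Set ℝ} {μ : Measure ℝ} {w : ℝ → ℝ}
    (h : SRep s I μ w) {z : ℂ} (hz : z ∉ cSet I) : s.cauchy z = ct μ w z :=
  h.cint _ (Concentrated.continuousOn_kernel hz)

lemma SRep.cauchyR {s : SignedM} {I : Set ℝ} {μ : Measure ℝ} {w : ℝ → ℝ}
    (h : SRep s I μ w) {t : ℝ} (ht : t ∉ I) : s.cauchyR t = ctR μ w t :=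
  h.rint _ (Concentrated.continuousOn_kernelR ht)

lemma sRep_pos {I : Set ℝ} {μ : Measure ℝ} {w : ℝ → ℝ} (h : Weighted I μ w) :
    SRep ⟨μ, 0⟩ I μ fun _ => 1 where
  conc := ⟨h.toConcentrated, .zero h.isCompact⟩
  weighted := h.with_weight continuousOn_const fun _ _ => one_ne_zero
  cint f _ := by simp [SignedM.cintegral]
  rint f _ := by simp [SignedM.rintegral]

lemma supp_eq (s : SignedM) : s.supp = s.pos.support ∪ s.neg.support := by
  rw [SignedM.supp, msupport_eq, msupport_eq]

lemma IsM.exists_sRep {s : SignedM} {Δ : Set ℝ} (h : IsM s Δ) :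
    ∃ (μ : Measure ℝ) (w : ℝ → ℝ), SRep s Δ μ w := by
  have hsub : s.supp ⊆ Δ := by
    rw [h.hullEq]
    exact fun x hx => ⟨csInf_le h.compactSupp.bddBelow hx, le_csSup h.compactSupp.bddAbove hx⟩
  have hc : IsCompact Δ := by
    rw [h.hullEq]
    exact isCompact_Icc
  have ho : Δ.OrdConnected := by
    rw [h.hullEq]
    exact ordConnected_Icc
  rw [supp_eq] at hsub
  have hp : Concentrated Δ s.pos := ⟨hc, h.posFinite, measure_mono_null
    (compl_subset_compl.2 (subset_union_left.trans hsub)) Measure.measure_compl_support⟩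
  have hn : Concentrated Δ s.neg := ⟨hc, h.negFinite, measure_mono_null
    (compl_subset_compl.2 (subset_union_right.trans hsub)) Measure.measure_compl_support⟩
  have hi := h.infiniteSupp
  rw [supp_eq] at hi
  rcases h.constSign with h0 | h0
  · refine ⟨s.neg, fun _ => -1, ⟨hp, hn⟩, ⟨hn, ho, by simpa [h0] using hi, continuousOn_const,
      fun _ _ => by simp⟩, fun f _ => ?_, fun f _ => ?_⟩
    · simp [SignedM.cintegral, h0, integral_neg]
    · simp [SignedM.rintegral, h0, integral_neg]
  · refine ⟨s.pos, fun _ => 1, ⟨hp, hn⟩, ⟨hp, ho, by simpa [h0] using hi, continuousOn_const,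
      fun _ _ => by simp⟩, fun f _ => ?_, fun f _ => ?_⟩
    · simp [SignedM.cintegral, h0]
    · simp [SignedM.rintegral, h0]

/-- A weighted measure belongs to the class `M(Δ')` of the convex hull `Δ'` of its support. -/
lemma Weighted.isM {I : Set ℝ} {μ : Measure ℝ} {w : ℝ → ℝ} (h : Weighted I μ w) :
    ∃ Δ' ⊆ I, IsM ((⟨μ, 0⟩ : SignedM).withDensityR w) Δ' := by
  set s := (⟨μ, 0⟩ : SignedM).withDensityR w with hs
  have hconc : SConc I s := (sRep_pos h).conc.withDensityR h.continuousOn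
  have hsub : s.supp ⊆ I := by
    rw [supp_eq]
    exact union_subset hconc.pos.support_subset hconc.neg.support_subset
  have hcl : IsClosed s.supp := by
    rw [supp_eq]
    exact Measure.isClosed_support.union Measure.isClosed_support
  have hcp : IsCompact s.supp := h.isCompact.of_isClosed_subset hcl hsub
  have hpos : s.pos = μ.withDensity fun x => ENNReal.ofReal (w x) := by
    simp [hs, SignedM.withDensityR]
  have hneg : s.neg = μ.withDensity fun x => ENNReal.ofReal (-w x) := by
    simp [hs, SignedM.withDensityR]
  have hm := h.toConcentrated.aemeasurable h.continuousOn
  obtain ⟨ε, hε, hεw⟩ := exists_sign h.ordConnected h.continuousOn h.ne_zero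
  have key : (s.pos = 0 ∨ s.neg = 0) ∧ s.supp.Infinite := by
    rw [supp_eq]
    rcases hε with rfl | rfl
    · constructor
      · right
        rw [hneg, withDensity_congr_ae (g := 0), withDensity_zero]
        filter_upwards [h.toConcentrated.ae_mem] with x hx
        have := hεw x hx
        exact ENNReal.ofReal_of_nonpos (by linarith)
      · refine (h.infinite.mono ?_).mono subset_union_left
        refine Measure.AbsolutelyContinuous.support_mono ?_
        rw [hpos]
        refine withDensity_absolutelyContinuous' hm.ennreal_ofReal ?_
        filter_upwards [h.toConcentrated.ae_mem] with x hx
        have := hεw x hx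
        exact (ENNReal.ofReal_pos.2 (by linarith)).ne'
    · constructor
      · left
        rw [hpos, withDensity_congr_ae (g := 0), withDensity_zero]
        filter_upwards [h.toConcentrated.ae_mem] with x hx
        have := hεw x hx
        exact ENNReal.ofReal_of_nonpos (by linarith)
      · refine (h.infinite.mono ?_).mono subset_union_right
        refine Measure.AbsolutelyContinuous.support_mono ?_
        rw [hneg]
        refine withDensity_absolutelyContinuous' hm.neg.ennreal_ofReal ?_
        filter_upwards [h.toConcentrated.ae_mem] with x hx
        have := hεw x hx
        exact (ENNReal.ofReal_pos.2 (by linarith)).ne'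
  have hne := key.2.nonempty
  refine ⟨Icc (sInf s.supp) (sSup s.supp), ?_, hconc.pos.isFinite, hconc.neg.isFinite, key.1,
    hcp, key.2, rfl⟩
  exact h.ordConnected.out (hsub (hcp.sInf_mem hne)) (hsub (hcp.sSup_mem hne))

/-- `ŝ_{i+1,a}` with the convention `ŝ_{i+1,i} = 1`. -/
def phiC (σ : ℕ → SignedM) (i a : ℕ) (z : ℂ) : ℂ :=
  if a = i then 1 else (nikSys σ (i + 1) a).cauchy z

/-- `ŝ_{i+1,a}` at real points, with the convention `ŝ_{i+1,i} = 1`. -/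
def phiR (σ : ℕ → SignedM) (i a : ℕ) (x : ℝ) : ℝ :=
  if a = i then 1 else (nikSys σ (i + 1) a).cauchyR x

lemma phiC_self (σ : ℕ → SignedM) (i : ℕ) (z : ℂ) : phiC σ i i z = 1 := if_pos rfl

lemma phiR_self (σ : ℕ → SignedM) (i : ℕ) (x : ℝ) : phiR σ i i x = 1 := if_pos rfl

lemma nikSys_self (σ : ℕ → SignedM) (a : ℕ) : nikSys σ a a = σ a := by
  rw [nikSys, dif_neg (lt_irrefl a)]

lemma nikSys_of_lt (σ : ℕ → SignedM) {k a : ℕ} (h : k < a) :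
    nikSys σ k a = (σ k).withDensityR (phiR σ k a) := by
  have e : phiR σ k a = (nikSys σ (k + 1) a).cauchyR := by
    ext x
    rw [phiR, if_neg h.ne']
  rw [nikSys, dif_pos h, SignedM.nik, e]

lemma sh1R_eq (σ : ℕ → SignedM) (k : ℕ) : sh1R σ k = phiR σ 0 k := rfl

lemma sh1C_eq (σ : ℕ → SignedM) (k : ℕ) : sh1C σ k = phiC σ 0 k := rfl

/-- The measures `σ 1, …, σ m` are `w k • μ k` on the intervals `Δ k`, consecutive ones being
disjoint. -/
structure NikRep (m : ℕ) (σ : ℕ → SignedM) (Δ : ℕ → Set ℝ) (μ : ℕ → Measure ℝ)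
    (w : ℕ → ℝ → ℝ) : Prop where
  rep : ∀ k, 1 ≤ k → k ≤ m → SRep (σ k) (Δ k) (μ k) (w k)
  disj : ∀ k, 1 ≤ k → k + 1 ≤ m → Disjoint (Δ k) (Δ (k + 1))

namespace NikRep

variable {m : ℕ} {σ : ℕ → SignedM} {Δ : ℕ → Set ℝ} {μ : ℕ → Measure ℝ} {w : ℕ → ℝ → ℝ}

lemma sRep (N : NikRep m σ Δ μ w) {k a : ℕ} (hk : 1 ≤ k) (hka : k ≤ a) (ham : a ≤ m) :
    SRep (nikSys σ k a) (Δ k) (μ k) fun x => phiR σ k a x * w k x := by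
  obtain ⟨d, rfl⟩ := Nat.exists_eq_add_of_le hka
  induction d generalizing k with
  | zero =>
    rw [add_zero, nikSys_self]
    simp only [phiR_self, one_mul]
    exact N.rep k hk (by omega)
  | succ d ih =>
    have e : k + (d + 1) = k + 1 + d := by omega
    have h1 := ih (k := k + 1) (by omega) (by omega) (by omega)
    rw [← e] at h1
    have hd := N.disj k hk (by omega)
    have h2 : ∀ x ∈ Δ k, phiR σ k (k + (d + 1)) x = ctR (μ (k + 1))
        (fun x => phiR σ (k + 1) (k + (d + 1)) x * w (k + 1) x) x := by
      intro x hx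
      rw [phiR, if_neg (by omega), h1.cauchyR fun h => hd.le_bot ⟨hx, h⟩]
    rw [nikSys_of_lt σ (by omega)]
    refine (N.rep k hk (by omega)).withDensityR ?_ fun x hx => ?_
    · exact (h1.weighted.toConcentrated.continuousOn_ctR h1.weighted.continuousOn
        hd.symm).congr h2
    · rw [h2 x hx]
      exact h1.weighted.ctR_ne_zero fun h => hd.le_bot ⟨hx, h⟩

lemma phiC_eq (N : NikRep m σ Δ μ w) {k a : ℕ} (hka : k < a) (ham : a ≤ m) {z : ℂ}
    (hz : z ∉ cSet (Δ (k + 1))) :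
    phiC σ k a z = ct (μ (k + 1)) (fun x => phiR σ (k + 1) a x * w (k + 1) x) z := by
  rw [phiC, if_neg hka.ne', (N.sRep (by omega) hka ham).cauchy hz]

lemma phiR_eq (N : NikRep m σ Δ μ w) {k a : ℕ} (hka : k < a) (ham : a ≤ m) {x : ℝ}
    (hx : x ∉ Δ (k + 1)) :
    phiR σ k a x = ctR (μ (k + 1)) (fun x => phiR σ (k + 1) a x * w (k + 1) x) x := by
  rw [phiR, if_neg hka.ne', (N.sRep (by omega) hka ham).cauchyR hx]

lemma continuousOn_phiR (N : NikRep m σ Δ μ w) {k a : ℕ} (hka : k ≤ a) (ham : a ≤ m) {K : Set ℝ}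
    (hK : k < a → Disjoint (Δ (k + 1)) K) : ContinuousOn (phiR σ k a) K := by
  rcases hka.eq_or_lt with rfl | h
  · exact continuousOn_const.congr fun x _ => phiR_self σ k x
  · have h1 := N.sRep (k := k + 1) (by omega) h ham
    exact (h1.weighted.toConcentrated.continuousOn_ctR h1.weighted.continuousOn
      (hK h)).congr fun x hx => N.phiR_eq h ham fun hh => (hK h).le_bot ⟨hh, hx⟩

lemma phiR_ne_zero (N : NikRep m σ Δ μ w) {k a : ℕ} (hka : k ≤ a) (ham : a ≤ m) {x : ℝ}
    (hx : k < a → x ∉ Δ (k + 1)) : phiR σ k a x ≠ 0 := by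
  rcases hka.eq_or_lt with rfl | h
  · rw [phiR_self]
    exact one_ne_zero
  · rw [N.phiR_eq h ham (hx h)]
    exact (N.sRep (by omega) h ham).weighted.ctR_ne_zero (hx h)

lemma hasBval (N : NikRep m σ Δ μ w) {k a : ℕ} (hka : k ≤ a) (ham : a ≤ m) {K : Set ℝ}
    (hK : k < a → Disjoint (Δ (k + 1)) K) :
    HasBval (phiC σ k a) K ∧ ∀ x ∈ K, bval (phiC σ k a) x = phiR σ k a x := by
  rcases hka.eq_or_lt with rfl | h
  · have h1 := hasBval_const (f := phiC σ k k) 1 K fun z _ => by simp [phiC_self]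
    exact ⟨h1.1, fun x hx => by rw [h1.2 x hx, phiR_self]⟩
  · have h1 := N.sRep (k := k + 1) (by omega) h ham
    have h2 := h1.weighted.toConcentrated.hasBval (α := 0) (β := 0) (f := phiC σ k a)
      h1.weighted.continuousOn (hK h) fun z hz => by
        rw [N.phiC_eq h ham (notMem_cSet_of_nonreal hz)]
        simp
    refine ⟨h2.1, fun x hx => ?_⟩
    rw [h2.2 x hx, N.phiR_eq h ham fun hh => (hK h).le_bot ⟨hh, hx⟩]
    ring

lemma continuousAt_phiC (N : NikRep m σ Δ μ w) {k a : ℕ} (hka : k ≤ a) (ham : a ≤ m) {z : ℂ}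
    (hz : k < a → z ∉ cSet (Δ (k + 1))) : ContinuousAt (phiC σ k a) z := by
  rcases hka.eq_or_lt with rfl | h
  · have e : phiC σ k k = fun _ => 1 := funext fun z => phiC_self σ k z
    rw [e]
    exact continuousAt_const
  · have h1 := N.sRep (k := k + 1) (by omega) h ham
    refine (h1.weighted.toConcentrated.continuousAt_ct h1.weighted.continuousOn (hz h)).congr ?_
    filter_upwards [(isOpen_compl_cSet h1.weighted.isCompact).mem_nhds (hz h)] with z' hz'
    exact (N.phiC_eq h ham hz').symm

lemma elimStep (N : NikRep m σ Δ μ w) {i : ℕ} (hi : i + 1 ≤ m)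
    {Q : Finset ℕ → ℕ → ℕ → ℂ → ℂ} (F : RatioFamily m (i + 1) Δ (phiC σ (i + 1)) Q) :
    ElimStep m i Δ (phiC σ i) (phiC σ (i + 1)) Q (μ (i + 1)) (w (i + 1)) where
  disj := N.disj
  le := hi
  fam := F
  weighted := (N.rep (i + 1) (by omega) hi).weighted
  one := phiC_self σ i
  rep a ha ham z hz := by
    rw [N.phiC_eq ha ham (notMem_cSet_of_nonreal hz)]
    refine (N.rep (i + 1) (by omega) hi).weighted.toConcentrated.ct_congr (fun x hx => ?_) z
    rw [(N.hasBval ha ham fun h => (N.disj (i + 1) (by omega) (by omega)).symm).2 x hx]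

lemma exists_ratioFamily (N : NikRep m σ Δ μ w) {i : ℕ} (hi : i ≤ m) :
    ∃ Q, RatioFamily m i Δ (phiC σ i) Q := by
  induction hi using Nat.decreasingInduction with
  | self => exact ⟨_, ratioFamily_self m Δ _ (phiC_self σ m)⟩
  | of_succ i hi ih =>
    obtain ⟨Q, F⟩ := ih
    exact ⟨_, (N.elimStep hi F).ratioFamily⟩

end NikRep

/-- A polynomial relation between functions passes to their boundary values. -/
lemma HasBval.eval_mul_eq_sum {K : Set ℝ} {f : ℂ → ℂ} (hf : HasBval f K) (s : Finset ℕ)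
    {g : ℕ → ℂ → ℂ} (hg : ∀ t ∈ s, HasBval (g t) K) {p : ℝ[X]} {q : ℕ → ℝ[X]}
    (h : ∀ z ∈ nonreal, aeval z p * f z = ∑ t ∈ s, aeval z (q t) * g t z) {x : ℝ} (hx : x ∈ K) :
    p.eval x * bval f x = ∑ t ∈ s, (q t).eval x * bval (g t) x := by
  have hp : ∀ r : ℝ[X], Tendsto (fun z : ℂ => aeval z r) (𝓝[nonreal] (x : ℂ))
      (𝓝 ((r.eval x : ℝ) : ℂ)) := by
    intro r
    have h1 := (r.continuous_aeval (A := ℂ)).tendsto (x : ℂ)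
    have h2 : aeval (x : ℂ) r = ((r.eval x : ℝ) : ℂ) := by
      rw [← Complex.coe_algebraMap, aeval_algebraMap_apply, coe_aeval_eq_eval]
    rw [h2] at h1
    exact h1.mono_left nhdsWithin_le_nhds
  have h1 := (hp p).mul (hf.tendsto x hx)
  have h2 := tendsto_finsetSum s fun t ht => (hp (q t)).mul ((hg t ht).tendsto x hx)
  have h3 := tendsto_nhds_unique_of_eventuallyEq h1 h2
    (by filter_upwards [self_mem_nhdsWithin] with z hz using h z hz)
  exact_mod_cast h3

/-- A polynomial relation between densities gives one between Cauchy transforms, up to a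
polynomial. -/
lemma Weighted.transfer {I : Set ℝ} {μ : Measure ℝ} {w : ℝ → ℝ} (h : Weighted I μ w)
    (s : Finset ℕ) {f : ℂ → ℂ} {f' : ℝ → ℝ} {P : ℝ[X]} {g : ℕ → ℂ → ℂ} {g' : ℕ → ℝ → ℝ}
    {R : ℕ → ℝ[X]} {N : ℕ} {p : ℝ[X]} {q : ℕ → ℝ[X]} (hf' : ContinuousOn f' I)
    (hg' : ∀ t ∈ s, ContinuousOn (g' t) I)
    (hf : ∀ z ∈ nonreal, f z = aeval z P + ct μ (fun x => f' x * w x) z)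
    (hg : ∀ t ∈ s, ∀ z ∈ nonreal, g t z = aeval z (R t) + ct μ (fun x => g' t x * w x) z)
    (hp : p.degree < N) (hpP : (p * P).degree < N) (hq : ∀ t ∈ s, (q t).degree < N)
    (hqR : ∀ t ∈ s, (q t * R t).degree < N)
    (hpq : ∀ x ∈ I, p.eval x * f' x = ∑ t ∈ s, (q t).eval x * g' t x) :
    ∃ E : ℝ[X], E.degree < N ∧ ∀ z ∈ nonreal,
      aeval z p * f z = aeval z E + ∑ t ∈ s, aeval z (q t) * g t z := by
  obtain ⟨E₀, hE₀, h₀⟩ := h.toConcentrated.poly_mul_ct N p hp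
    (w := fun x => f' x * w x) (hf'.mul h.continuousOn)
  have : ∀ t, ∃ E : ℝ[X], t ∈ s → E.degree < N ∧ ∀ z ∉ cSet I,
      aeval z (q t) * ct μ (fun x => g' t x * w x) z =
        aeval z E + ct μ (fun x => (q t).eval x * (g' t x * w x)) z := by
    intro t
    by_cases ht : t ∈ s
    · obtain ⟨E, hE⟩ :=
        h.toConcentrated.poly_mul_ct N (q t) (hq t ht) ((hg' t ht).mul h.continuousOn)
      exact ⟨E, fun _ => hE⟩
    · exact ⟨0, fun h => (ht h).elim⟩
  choose E hE using this
  refine ⟨p * P + E₀ - ∑ t ∈ s, (q t * R t + E t), ?_, fun z hz => ?_⟩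
  · have hb : (∑ t ∈ s, (q t * R t + E t)).degree < N := by
      rw [← mem_degreeLT]
      exact Submodule.sum_mem _ fun t ht => Submodule.add_mem _ (mem_degreeLT.2 (hqR t ht))
        (mem_degreeLT.2 (hE t ht).1)
    rw [← mem_degreeLT] at hpP hE₀ hb ⊢
    exact Submodule.sub_mem _ (Submodule.add_mem _ hpP hE₀) hb
  · have hz' : z ∉ cSet I := notMem_cSet_of_nonreal hz
    have e1 : ct μ (fun x => p.eval x * (f' x * w x)) z =
        ∑ t ∈ s, ct μ (fun x => (q t).eval x * (g' t x * w x)) z := by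
      rw [← h.toConcentrated.ct_sum s (w := fun t x => (q t).eval x * (g' t x * w x))
        (fun t ht => (q t).continuous.continuousOn.mul ((hg' t ht).mul h.continuousOn)) hz']
      refine h.toConcentrated.ct_congr (fun x hx => ?_) z
      rw [← mul_assoc, hpq x hx, Finset.sum_mul]
      exact Finset.sum_congr rfl fun t _ => mul_assoc _ _ _
    have e2 : ∑ t ∈ s, aeval z (q t) * g t z = ∑ t ∈ s, aeval z (q t * R t + E t) +
        ∑ t ∈ s, ct μ (fun x => (q t).eval x * (g' t x * w x)) z := by
      rw [← Finset.sum_add_distrib]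
      refine Finset.sum_congr rfl fun t ht => ?_
      rw [hg t ht z hz, mul_add, (hE t ht).2 z hz', map_add, map_mul]
      ring
    rw [e2, hf z hz, mul_add, h₀ z hz', e1, map_sub, map_add, map_mul, map_sum]
    ring

/-- A triangular array of functions, each row being, up to polynomials, the Cauchy transform of
the boundary values of the next one. -/
structure Tower (m : ℕ) (n : ℕ → ℕ) (I : ℕ → Set ℝ) (μ : ℕ → Measure ℝ) (w : ℕ → ℝ → ℝ)
    (A : ℕ → ℕ → ℂ → ℂ) : Prop where
  one : ∀ l ≤ m, ∀ z ∈ nonreal, A l l z = 1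
  bv : ∀ l t, l + 1 ≤ t → t ≤ m → HasBval (A (l + 1) t) (I (l + 1))
  rep : ∀ l t, l + 1 ≤ t → t ≤ m → ∃ P : ℝ[X],
    (∀ p : ℝ[X], p.degree < n t → (p * P).degree < n l) ∧
    ∀ z ∈ nonreal, A l t z =
      aeval z P + ct (μ (l + 1)) (fun x => bval (A (l + 1) t) x * w (l + 1) x) z

lemma Tower.expand {m : ℕ} {n : ℕ → ℕ} {I : ℕ → Set ℝ} {μ : ℕ → Measure ℝ} {w : ℕ → ℝ → ℝ}
    {A B : ℕ → ℕ → ℂ → ℂ} (hA : Tower m n I μ w A) (hB : Tower m n I μ w B)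
    (hw : ∀ l, 1 ≤ l → l ≤ m → Weighted (I l) (μ l) (w l))
    (hn : ∀ l t, l ≤ t → t ≤ m → n t ≤ n l) {l : ℕ} (hl : l ≤ m) :
    ∀ k, l ≤ k → k ≤ m → ∀ p : ℝ[X], p.degree < n k → ∃ q : ℕ → ℝ[X],
      (∀ t, l ≤ t → t ≤ m → (q t).degree < n t) ∧
      ∀ z ∈ nonreal, aeval z p * A l k z =
        ∑ t ∈ Finset.Icc l m, aeval z (q t) * B l t z := by
  have diag : ∀ l ≤ m, ∀ p : ℝ[X], p.degree < n l → ∃ q : ℕ → ℝ[X],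
      (∀ t, l ≤ t → t ≤ m → (q t).degree < n t) ∧
      ∀ z ∈ nonreal, aeval z p * A l l z =
        ∑ t ∈ Finset.Icc l m, aeval z (q t) * B l t z := by
    intro l hl p hp
    refine ⟨fun t => if t = l then p else 0, fun t _ _ => ?_, fun z hz => ?_⟩
    · dsimp only
      split_ifs with h
      · rwa [h]
      · simp
    · rw [Finset.sum_eq_single l]
      · dsimp only
        rw [if_pos rfl, hA.one l hl z hz, hB.one l hl z hz]
      · intro t _ ht
        simp [ht]
      · intro h
        exact (h (Finset.mem_Icc.2 ⟨le_rfl, hl⟩)).elim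
  induction hl using Nat.decreasingInduction with
  | self =>
    intro k hk hkm p hp
    obtain rfl := le_antisymm hkm hk
    exact diag k le_rfl p hp
  | of_succ l hl ih =>
    intro k hk hkm p hp
    rcases hk.eq_or_lt with rfl | hlk
    · exact diag l hl.le p hp
    obtain ⟨q, hq, hpq⟩ := ih k hlk hkm p hp
    obtain ⟨P, hP, hPA⟩ := hA.rep l k hlk hkm
    have : ∀ t, ∃ R : ℝ[X], l + 1 ≤ t → t ≤ m →
        (∀ p : ℝ[X], p.degree < n t → (p * R).degree < n l) ∧
        ∀ z ∈ nonreal, B l t z =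
          aeval z R + ct (μ (l + 1)) (fun x => bval (B (l + 1) t) x * w (l + 1) x) z := by
      intro t
      by_cases ht : l + 1 ≤ t ∧ t ≤ m
      · obtain ⟨R, hR⟩ := hB.rep l t ht.1 ht.2
        exact ⟨R, fun _ _ => hR⟩
      · exact ⟨0, fun h1 h2 => (ht ⟨h1, h2⟩).elim⟩
    choose R hR using this
    have hmem : ∀ t ∈ Finset.Icc (l + 1) m, l + 1 ≤ t ∧ t ≤ m := fun t => Finset.mem_Icc.1
    obtain ⟨E, hE, hEz⟩ := (hw (l + 1) (by omega) hl).transfer (Finset.Icc (l + 1) m)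
      (f := A l k) (f' := bval (A (l + 1) k)) (P := P) (g := B l)
      (g' := fun t => bval (B (l + 1) t)) (R := R) (N := n l) (p := p) (q := q)
      (hA.bv l k hlk hkm).cont (fun t ht => (hB.bv l t (hmem t ht).1 (hmem t ht).2).cont) hPA
      (fun t ht => (hR t (hmem t ht).1 (hmem t ht).2).2)
      (hp.trans_le (by exact_mod_cast hn l k hk hkm)) (hP p hp)
      (fun t ht => (hq t (hmem t ht).1 (hmem t ht).2).trans_le
        (by exact_mod_cast hn l t (by have := hmem t ht; omega) (hmem t ht).2))
      (fun t ht => (hR t (hmem t ht).1 (hmem t ht).2).1 _ (hq t (hmem t ht).1 (hmem t ht).2))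
      (fun x hx => (hA.bv l k hlk hkm).eval_mul_eq_sum _
        (fun t ht => hB.bv l t (hmem t ht).1 (hmem t ht).2) hpq hx)
    refine ⟨fun t => if t = l then E else q t, fun t h1 h2 => ?_, fun z hz => ?_⟩
    · dsimp only
      split_ifs with h
      · rwa [h]
      · exact hq t (by omega) h2
    · rw [hEz z hz, ← Finset.add_sum_Ioc_eq_sum_Icc hl.le]
      dsimp only
      rw [if_pos rfl, hB.one l hl.le z hz, mul_one]
      congr 1
      refine Finset.sum_congr ?_ fun t ht => ?_
      · ext t
        simp
      · rw [if_neg (by have := Finset.mem_Ioc.1 ht; omega)]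

/-- `e` lists `0, …, m` by decreasing value of `n`, ties being broken by the index. -/
structure Sorting (m : ℕ) (n : ℕ → ℕ) (e : ℕ → ℕ) : Prop where
  le : ∀ k ≤ m, e k ≤ m
  inj : ∀ j ≤ m, ∀ k ≤ m, e j = e k → j = k
  surj : ∀ j ≤ m, ∃ k ≤ m, e k = j
  anti : ∀ l k, l ≤ k → k ≤ m → n (e k) ≤ n (e l)
  strict : ∀ l k, l < k → k ≤ m → e k < e l → n (e k) < n (e l)

lemma exists_sorting (m : ℕ) (n : ℕ → ℕ) : ∃ e, Sorting m n e := by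
  let f : Fin (m + 1) → ℕᵒᵈ ×ₗ ℕ := fun i => toLex (OrderDual.toDual (n i), i)
  have hmono : Monotone (f ∘ Tuple.sort f) := Tuple.monotone_sort f
  set s := Tuple.sort f
  let e : ℕ → ℕ := fun k => if h : k < m + 1 then s ⟨k, h⟩ else k
  have he : ∀ k (h : k < m + 1), e k = s ⟨k, h⟩ := fun k h => dif_pos h
  have hle : ∀ l k, l ≤ k → k ≤ m →
      n (e k) < n (e l) ∨ n (e l) = n (e k) ∧ e l ≤ e k := by
    intro l k hlk hk
    have h1 : f (s ⟨l, by omega⟩) ≤ f (s ⟨k, by omega⟩) := hmono (by simpa using hlk)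
    rw [Prod.Lex.le_iff] at h1
    rw [he l (by omega), he k (by omega)]
    simpa [f] using h1
  refine ⟨e, fun k hk => ?_, fun j hj k hk hjk => ?_, fun j hj => ?_, fun l k hlk hk => ?_,
    fun l k hlk hk h => ?_⟩
  · rw [he k (by omega)]
    have := (s ⟨k, by omega⟩).isLt
    omega
  · rw [he j (by omega), he k (by omega)] at hjk
    simpa using s.injective (Fin.ext hjk)
  · refine ⟨s.symm ⟨j, by omega⟩, by have := (s.symm ⟨j, by omega⟩).isLt; omega, ?_⟩
    rw [he _ (s.symm ⟨j, by omega⟩).isLt]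
    simp
  · rcases hle l k hlk hk with h | h <;> omega
  · rcases hle l k hlk.le hk with h | h <;> omega

/-- The first `l` labels in the order `e`. -/
def firstLabels (e : ℕ → ℕ) (l : ℕ) : Finset ℕ := (Finset.range l).image e

namespace Sorting

variable {m : ℕ} {n e : ℕ → ℕ}

lemma subset (S : Sorting m n e) {l : ℕ} (hl : l ≤ m) :
    firstLabels e l ⊆ Finset.Icc 0 m := by
  intro x hx
  obtain ⟨k, hk, rfl⟩ := Finset.mem_image.1 hx
  have := Finset.mem_range.1 hk
  exact Finset.mem_Icc.2 ⟨zero_le, S.le k (by omega)⟩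

lemma card (S : Sorting m n e) {l : ℕ} (hl : l ≤ m) : (firstLabels e l).card = l := by
  rw [firstLabels, Finset.card_image_of_injOn, Finset.card_range]
  intro j hj k hk h
  have hj' := Finset.mem_range.1 (Finset.mem_coe.1 hj)
  have hk' := Finset.mem_range.1 (Finset.mem_coe.1 hk)
  exact S.inj j (by omega) k (by omega) h

lemma adm (S : Sorting m n e) {l k : ℕ} (hlk : l ≤ k) (hk : k ≤ m) :
    Adm m 0 (firstLabels e l) (e k) := by
  refine ⟨zero_le, S.le k hk, fun h => ?_⟩
  obtain ⟨j, hj, hjk⟩ := Finset.mem_image.1 h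
  have hj' := Finset.mem_range.1 hj
  have := S.inj j (by omega) k hk hjk
  omega

lemma insert_firstLabels (e : ℕ → ℕ) (l : ℕ) :
    insert (e l) (firstLabels e l) = firstLabels e (l + 1) := by
  rw [firstLabels, firstLabels, Finset.range_add_one, Finset.image_insert]

/-- The ratios along the sorted order form a tower. -/
lemma exists_tower (S : Sorting m n e) {I : ℕ → Set ℝ} {φ : ℕ → ℂ → ℂ}
    {Q : Finset ℕ → ℕ → ℕ → ℂ → ℂ} (F : RatioFamily m 0 I φ Q)
    (hd : ∀ k, 1 ≤ k → k + 1 ≤ m → Disjoint (I k) (I (k + 1))) :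
    ∃ (μ : ℕ → Measure ℝ) (w : ℕ → ℝ → ℝ),
      (∀ l, 1 ≤ l → l ≤ m → Weighted (I l) (μ l) (w l)) ∧
      Tower m (fun k => n (e k)) I μ w fun l t => Q (firstLabels e l) (e t) (e l) := by
  have : ∀ l, ∃ (μ : Measure ℝ) (w : ℝ → ℝ), l + 1 ≤ m → Weighted (I (l + 1)) μ w ∧
      ∀ a', Adm m 0 (firstLabels e l) a' → a' ≠ e l → ∃ α β : ℝ,
        (α ≠ 0 → a' < l + 1 ∧ l + 1 ≤ e l) ∧
        ∀ z ∈ nonreal, Q (firstLabels e l) a' (e l) z =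
          α * z + β + ct μ (fun x => bval (Q (firstLabels e (l + 1)) a' (e (l + 1))) x * w x) z := by
    intro l
    by_cases hl : l + 1 ≤ m
    · obtain ⟨μ, w, hw, h⟩ := F.rep (firstLabels e l) (S.subset (by omega)) (e (l + 1)) (e l)
        (S.adm (by omega) hl) (S.adm le_rfl (by omega)) fun h => by
          have := S.inj _ hl _ (by omega) h
          omega
      rw [S.card (by omega), zero_add] at hw h
      rw [insert_firstLabels] at h
      refine ⟨μ, w, fun _ => ⟨hw, fun a' ha' hne => ?_⟩⟩
      obtain ⟨α, β, h1, -, h3⟩ := h a' ha' hne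
      exact ⟨α, β, h1, h3⟩
    · exact ⟨0, 0, fun h => (hl h).elim⟩
  choose μ w h using this
  refine ⟨fun l => μ (l - 1), fun l => w (l - 1), fun l h1 hl => ?_, ?_, ?_, ?_⟩
  · obtain ⟨l, rfl⟩ := Nat.exists_eq_add_of_le' h1
    exact (h l hl).1
  · intro l hl z hz
    exact F.one _ (S.subset hl) _ (S.adm le_rfl hl) z hz
  · intro l t hlt ht
    refine F.hasBval (S.subset (by omega)) (S.adm hlt ht) (S.adm le_rfl (by omega)) fun hle => ?_
    rw [S.card (by omega), zero_add] at hle ⊢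
    exact (hd (l + 1) (by omega) hle).symm
  · intro l t hlt ht
    obtain ⟨α, β, h1, h2⟩ := (h l (by omega)).2 (e t) (S.adm (by omega) ht) fun hh => by
      have := S.inj _ ht _ (by omega) hh
      omega
    refine ⟨C α * X + C β, fun p hp => ?_, fun z hz => ?_⟩
    · by_cases hα : α = 0
      · rw [hα, C_0, zero_mul, zero_add, mul_comm, ← smul_eq_C_mul]
        exact (degree_smul_le β p).trans_lt
          (hp.trans_le (by exact_mod_cast S.anti l t (by omega) ht))
      · have hlt' : n (e t) + 1 ≤ n (e l) := S.strict l t (by omega) ht (by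
          have := h1 hα
          omega)
        have : (p * (C α * X + C β)).degree < ((n (e t) + 1 : ℕ) : WithBot ℕ) := by
          rw [degree_mul, degree_linear hα]
          push_cast
          exact WithBot.add_lt_add_right (by simp) hp
        exact this.trans_le (by exact_mod_cast hlt')
    · rw [h2 z hz]
      simp

end Sorting

/-- If the Cauchy transform of `g μ` is a polynomial up to `O(z⁻ⁿ⁻¹)`, the first `n` moments of
`g μ` vanish. -/
lemma Concentrated.moment_eq_zero {I : Set ℝ} {μ : Measure ℝ} (h : Concentrated I μ) {ν : ℕ} :
    ∀ {n : ℕ}, ν < n → ∀ {g : ℝ → ℝ}, ContinuousOn g I → ∀ {d : ℝ[X]} {C R : ℝ},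
      (∀ z ∈ nonreal, R ≤ ‖z‖ → ‖ct μ g z - aeval z d‖ ≤ C / ‖z‖ ^ (n + 1)) →
      ∫ x, x ^ ν * g x ∂μ = 0 := by
  induction ν with
  | zero =>
    intro n hn g hg d c R hb
    have hlarge : ∀ᶠ z in imInfty, max R 1 ≤ ‖z‖ := by
      rw [imInfty, eventually_map]
      filter_upwards [eventually_ge_atTop (max R 1)] with y hy
      simpa using (Or.inl (hy.trans (le_abs_self y)) : max R 1 ≤ |y| ∨ False)
    have h0 : Tendsto (fun z => z * (ct μ g z - aeval z d)) imInfty (𝓝 0) := by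
      rw [tendsto_zero_iff_norm_tendsto_zero]
      refine squeeze_zero' (g := fun z : ℂ => |c| * ‖z⁻¹‖) (Eventually.of_forall fun z =>
        norm_nonneg _) ?_ (by simpa using (tendsto_inv_imInfty.norm).const_mul |c|)
      filter_upwards [hlarge, eventually_nonreal] with z hz hz'
      have h1 : (1 : ℝ) ≤ ‖z‖ := (le_max_right _ _).trans hz
      rw [norm_mul, norm_inv]
      calc ‖z‖ * ‖ct μ g z - aeval z d‖ ≤ ‖z‖ * (|c| / ‖z‖ ^ (n + 1)) := by
            gcongr
            refine (hb z hz' ((le_max_left _ _).trans hz)).trans ?_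
            gcongr
            exact le_abs_self c
        _ = |c| * (‖z‖ ^ n)⁻¹ := by
            field_simp
            ring
        _ ≤ |c| * ‖z‖⁻¹ := by
            gcongr
            exact le_self_pow₀ h1 (by omega)
    have h1 := (h.tendsto_mul_ct hg).sub h0
    have h2 : X * d - C (∫ x, g x ∂μ) = 0 := by
      refine Polynomial.eq_zero_of_tendsto_imInfty ?_
      have h3 := h1.sub (tendsto_const_nhds (x := ((∫ x, g x ∂μ : ℝ) : ℂ)))
      rw [sub_zero, sub_self] at h3
      refine h3.congr fun z => ?_
      simp only [map_sub, map_mul, aeval_X, aeval_C, Complex.coe_algebraMap]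
      ring
    have h3 := congrArg (Polynomial.eval 0) h2
    simp only [eval_sub, eval_mul, eval_X, zero_mul, eval_C, eval_zero, zero_sub] at h3
    simpa using h3
  | succ ν ih =>
    intro n hn g hg d c R hb
    obtain ⟨n, rfl⟩ := Nat.exists_eq_add_of_lt (Nat.zero_lt_of_lt hn)
    rw [zero_add] at hn hb
    have h1 := ih (n := n) (by omega) (g := fun x => x * g x) (continuousOn_id.mul hg)
      (d := X * d - C (∫ x, g x ∂μ)) (C := c) (R := max R 1) fun z hz hR => by
        have h1 : (0 : ℝ) < ‖z‖ := by linarith [(le_max_right R 1).trans hR]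
        have e : ct μ (fun x => x * g x) z - aeval z (X * d - C (∫ x, g x ∂μ)) =
            z * (ct μ g z - aeval z d) := by
          simp only [map_sub, map_mul, aeval_X, aeval_C, Complex.coe_algebraMap]
          rw [mul_sub, h.mul_ct hg (notMem_cSet_of_nonreal hz)]
          ring
        rw [e, norm_mul]
        calc ‖z‖ * ‖ct μ g z - aeval z d‖ ≤ ‖z‖ * (c / ‖z‖ ^ (n + 1 + 1)) := by
              gcongr
              exact hb z hz ((le_max_left _ _).trans hR)
          _ = c / ‖z‖ ^ (n + 1) := by
              field_simp
              ring
    rw [← h1]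
    congr 1
    ext x
    ring

lemma Concentrated.integral_eval_eq_zero {I : Set ℝ} {μ : Measure ℝ} (h : Concentrated I μ)
    {n : ℕ} {g : ℝ → ℝ} (hg : ContinuousOn g I)
    (h0 : ∀ ν < n, ∫ x, x ^ ν * g x ∂μ = 0) {p : ℝ[X]} (hp : p.degree < n) :
    ∫ x, p.eval x * g x ∂μ = 0 := by
  by_cases hp0 : p = 0
  · simp [hp0]
  have e : ∀ x, p.eval x * g x = ∑ ν ∈ Finset.range n, p.coeff ν * (x ^ ν * g x) := by
    intro x
    rw [eval_eq_sum_range' ((natDegree_lt_iff_degree_lt hp0).2 hp), Finset.sum_mul]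
    exact Finset.sum_congr rfl fun ν _ => by ring
  simp only [e]
  rw [integral_finsetSum]
  · refine Finset.sum_eq_zero fun ν hν => ?_
    rw [integral_const_mul, h0 ν (Finset.mem_range.1 hν), mul_zero]
  · intro ν _
    exact (h.integrable ((continuous_pow ν).continuousOn.mul hg)).const_mul _

/-- The generating measures `w l • μ l` for `l ≥ 1`, completed by `s` at `l = 0`. -/
def rhoSys (s : SignedM) (μ : ℕ → Measure ℝ) (w : ℕ → ℝ → ℝ) (l : ℕ) : SignedM :=
  if l = 0 then s else (⟨μ l, 0⟩ : SignedM).withDensityR (w l)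

lemma nikRep_rhoSys (s : SignedM) {m : ℕ} {I : ℕ → Set ℝ} {μ : ℕ → Measure ℝ}
    {w : ℕ → ℝ → ℝ} (hw : ∀ l, 1 ≤ l → l ≤ m → Weighted (I l) (μ l) (w l))
    (hd : ∀ k, 1 ≤ k → k + 1 ≤ m → Disjoint (I k) (I (k + 1))) :
    NikRep m (rhoSys s μ w) I μ w where
  rep k hk hkm := by
    have h := hw k hk hkm
    have h1 := (sRep_pos h).withDensityR h.continuousOn h.ne_zero
    simp only [mul_one] at h1
    rwa [rhoSys, if_neg (by omega)]
  disj := hd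

lemma NikRep.tower {m : ℕ} {σ : ℕ → SignedM} {Δ : ℕ → Set ℝ} {μ : ℕ → Measure ℝ}
    {w : ℕ → ℝ → ℝ} (N : NikRep m σ Δ μ w) (n : ℕ → ℕ) : Tower m n Δ μ w (phiC σ) where
  one l _ z _ := phiC_self σ l z
  bv l t hlt ht := (N.hasBval hlt ht fun h => (N.disj (l + 1) (by omega) (by omega)).symm).1
  rep l t hlt ht := by
    refine ⟨0, fun p _ => by simp, fun z hz => ?_⟩
    rw [N.phiC_eq hlt ht (notMem_cSet_of_nonreal hz), map_zero, zero_add]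
    refine (N.rep (l + 1) (by omega) (by omega)).weighted.toConcentrated.ct_congr
      (fun x hx => ?_) z
    rw [(N.hasBval hlt ht fun h => (N.disj (l + 1) (by omega) (by omega)).symm).2 x hx]

/-- Change of generators: forms in the `ŝ_{1,k}` are forms in the `r̂_{1,k}` times one of the
`ŝ_{1,k}`, and conversely. -/
lemma NikRep.exists_rho {m : ℕ} {σ : ℕ → SignedM} {Δ : ℕ → Set ℝ} {μ₀ : ℕ → Measure ℝ}
    {w₀ : ℕ → ℝ → ℝ} (N : NikRep m σ Δ μ₀ w₀) {n e : ℕ → ℕ} (S : Sorting m n e) (s : SignedM) :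
    ∃ (μ : ℕ → Measure ℝ) (w : ℕ → ℝ → ℝ),
      (∀ l, 1 ≤ l → l ≤ m → Weighted (Δ l) (μ l) (w l)) ∧
      (∀ p : ℕ → ℝ[X], (∀ k ≤ m, (p k).degree < n k) → ∃ q : ℕ → ℝ[X],
        (∀ k ≤ m, (q k).degree < n (e k)) ∧ ∀ z ∈ nonreal,
          ∑ k ∈ Finset.Icc 0 m, aeval z (p k) * phiC σ 0 k z =
            (∑ k ∈ Finset.Icc 0 m, aeval z (q k) * phiC (rhoSys s μ w) 0 k z) *
              phiC σ 0 (e 0) z) ∧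
      (∀ k ≤ m, ∀ p : ℝ[X], p.degree < n (e k) → ∃ q : ℕ → ℝ[X],
        (∀ t ≤ m, (q t).degree < n (e t)) ∧ ∀ z ∈ nonreal,
          aeval z p * (phiC (rhoSys s μ w) 0 k z * phiC σ 0 (e 0) z) =
            ∑ t ∈ Finset.Icc 0 m, aeval z (q t) * phiC σ 0 (e t) z) := by
  obtain ⟨Q, F⟩ := N.exists_ratioFamily (zero_le (a := m))
  obtain ⟨μ, w, hw, T⟩ := S.exists_tower F N.disj
  have N' := nikRep_rhoSys s hw N.disj
  have T' := N'.tower fun k => n (e k)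
  have hanti := S.anti
  have hfirst : firstLabels e 0 = ∅ := by simp [firstLabels]
  have hmul : ∀ t ≤ m, ∀ z ∈ nonreal,
      Q (firstLabels e 0) (e t) (e 0) z * phiC σ 0 (e 0) z = phiC σ 0 (e t) z := by
    intro t ht z hz
    have h0 : Adm m 0 ∅ 0 := ⟨le_rfl, zero_le, by simp⟩
    have ht' := S.adm (zero_le (a := t)) ht
    have he := S.adm le_rfl (zero_le (a := m))
    rw [hfirst] at ht' he ⊢
    rw [← F.zero _ he z hz, F.mul ∅ (Finset.empty_subset _) _ _ _ ht' he h0 z hz,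
      F.zero _ ht' z hz]
  refine ⟨μ, w, hw, fun p hp => ?_, fun k hk p hp => ?_⟩
  · have : ∀ t, ∃ q : ℕ → ℝ[X], t ≤ m → (∀ k ≤ m, (q k).degree < n (e k)) ∧
        ∀ z ∈ nonreal, aeval z (p (e t)) * Q (firstLabels e 0) (e t) (e 0) z =
          ∑ k ∈ Finset.Icc 0 m, aeval z (q k) * phiC (rhoSys s μ w) 0 k z := by
      intro t
      by_cases ht : t ≤ m
      · obtain ⟨q, hq, hqz⟩ := T.expand T' hw hanti (zero_le (a := m)) t zero_le ht (p (e t))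
          (hp _ (S.le t ht))
        exact ⟨q, fun _ => ⟨fun k hk => hq k zero_le hk, hqz⟩⟩
      · exact ⟨0, fun h => (ht h).elim⟩
    choose q hq using this
    have hmem : ∀ t ∈ Finset.Icc 0 m, t ≤ m := fun t ht => (Finset.mem_Icc.1 ht).2
    refine ⟨fun k => ∑ t ∈ Finset.Icc 0 m, q t k, fun k hk => ?_, fun z hz => ?_⟩
    · rw [← mem_degreeLT]
      exact Submodule.sum_mem _ fun t ht => mem_degreeLT.2 ((hq t (hmem t ht)).1 k hk)
    · have e1 : ∑ k ∈ Finset.Icc 0 m, aeval z (p k) * phiC σ 0 k z =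
          ∑ t ∈ Finset.Icc 0 m, aeval z (p (e t)) * phiC σ 0 (e t) z := by
        symm
        refine Finset.sum_nbij e (fun t ht => ?_) (fun j hj k hk h => ?_) (fun k hk => ?_)
          fun t _ => rfl
        · exact Finset.mem_Icc.2 ⟨zero_le, S.le t (hmem t ht)⟩
        · exact S.inj j (hmem j (Finset.mem_coe.1 hj)) k (hmem k (Finset.mem_coe.1 hk)) h
        · obtain ⟨t, ht, htk⟩ := S.surj k (hmem k (Finset.mem_coe.1 hk))
          exact ⟨t, Finset.mem_coe.2 (Finset.mem_Icc.2 ⟨zero_le, ht⟩), htk⟩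
      rw [e1]
      simp only [map_sum, Finset.sum_mul]
      rw [Finset.sum_comm]
      refine Finset.sum_congr rfl fun t ht => ?_
      rw [← hmul t (hmem t ht) z hz, ← mul_assoc, (hq t (hmem t ht)).2 z hz, Finset.sum_mul]
  · obtain ⟨q, hq, hqz⟩ := T'.expand T hw hanti (zero_le (a := m)) k zero_le hk p hp
    refine ⟨q, fun t ht => hq t zero_le ht, fun z hz => ?_⟩
    rw [← mul_assoc, hqz z hz, Finset.sum_mul]
    refine Finset.sum_congr rfl fun t ht => ?_
    rw [mul_assoc, hmul t (Finset.mem_Icc.1 ht).2 z hz]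

lemma Sorting.bijOn {m : ℕ} {n e : ℕ → ℕ} (S : Sorting m n e) : BijOn e (Iic m) (Iic m) :=
  ⟨fun k hk => S.le k hk, fun j hj k hk h => S.inj j hj k hk h, fun j hj => by
    obtain ⟨k, hk, h⟩ := S.surj j hj
    exact ⟨k, hk, h⟩⟩

lemma exists_nikRep {m : ℕ} {σ : ℕ → SignedM} {Δ : ℕ → Set ℝ} (h : ∀ j ≤ m, IsM (σ j) (Δ j))
    (hd : ∀ j, j + 1 ≤ m → Δ j ∩ Δ (j + 1) = ∅) :
    ∃ (μ : ℕ → Measure ℝ) (w : ℕ → ℝ → ℝ), NikRep m σ Δ μ w := by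
  have : ∀ j, ∃ (μ : Measure ℝ) (w : ℝ → ℝ), j ≤ m → SRep (σ j) (Δ j) μ w := by
    intro j
    by_cases hj : j ≤ m
    · obtain ⟨μ, w, hw⟩ := (h j hj).exists_sRep
      exact ⟨μ, w, fun _ => hw⟩
    · exact ⟨0, 0, fun h => (hj h).elim⟩
  choose μ w hw using this
  exact ⟨μ, w, fun k _ hk => hw k hk, fun k _ hk => disjoint_iff_inter_eq_empty.2 (hd k hk)⟩

lemma sum_phiC_eq (σ : ℕ → SignedM) (m : ℕ) (p : ℕ → ℝ[X]) (z : ℂ) :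
    aeval z (p 0) + ∑ k ∈ Finset.Icc 1 m, aeval z (p k) * (nikSys σ 1 k).cauchy z =
      ∑ k ∈ Finset.Icc 0 m, aeval z (p k) * phiC σ 0 k z := by
  rw [← Finset.add_sum_Ioc_eq_sum_Icc (zero_le (a := m)), phiC_self, mul_one]
  congr 1
  refine Finset.sum_congr (by ext; simp [Nat.succ_le_iff]) fun k hk => ?_
  rw [phiC, if_neg (by have := Finset.mem_Ioc.1 hk; omega)]

/-- Functions continuous at `z` and equal off the real line agree at `z`. -/
lemma eq_of_eq_nonreal {f g : ℂ → ℂ} (h : ∀ z ∈ nonreal, f z = g z) {z : ℂ}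
    (hf : ContinuousAt f z) (hg : ContinuousAt g z) : f z = g z := by
  by_cases hz : z ∈ nonreal
  · exact h z hz
  · have him : z.im = 0 := by simpa [nonreal] using hz
    obtain ⟨x, rfl⟩ : ∃ x : ℝ, (x : ℂ) = z := ⟨z.re, Complex.ext (by simp) (by simp [him])⟩
    exact tendsto_nhds_unique_of_eventuallyEq (l := 𝓝[nonreal] (x : ℂ))
      (hf.tendsto.mono_left nhdsWithin_le_nhds) (hg.tendsto.mono_left nhdsWithin_le_nhds)
      (by filter_upwards [self_mem_nhdsWithin] with z hz using h z hz)

lemma NikRep.continuousAt_sum {m : ℕ} {σ : ℕ → SignedM} {Δ : ℕ → Set ℝ} {μ : ℕ → Measure ℝ}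
    {w : ℕ → ℝ → ℝ} (N : NikRep m σ Δ μ w) (p : ℕ → ℝ[X]) {z : ℂ} (hz : z ∉ cSet (Δ 1)) :
    ContinuousAt (fun z => ∑ k ∈ Finset.Icc 0 m, aeval z (p k) * phiC σ 0 k z) z := by
  refine tendsto_finsetSum _ fun k hk => ?_
  exact ((p k).continuous_aeval (A := ℂ)).continuousAt.mul
    (N.continuousAt_phiC zero_le (Finset.mem_Icc.1 hk).2 fun _ => hz)

/-- The orthogonality relations contained in the definition of a mixed type vector polynomial. -/
lemma IsMixedVP.integral_eq_zero {σ1 σ2 : ℕ → SignedM} {m1 m2 : ℕ} {n1 n2 : ℕ → ℕ}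
    {a : ℕ → ℝ[X]} (ha : IsMixedVP σ1 σ2 m1 m2 n1 n2 a) {I : Set ℝ} {μ : Measure ℝ}
    {w : ℝ → ℝ} (h : SRep (σ2 0) I μ w) (h1 : ∀ k ≤ m1, ContinuousOn (sh1R σ1 k) I)
    (h2 : ∀ i ≤ m2, ContinuousOn (sh1R σ2 i) I) {i : ℕ} (hi : i ≤ m2) {p : ℝ[X]}
    (hp : p.degree < n2 i) :
    ∫ x, p.eval x * ((∑ k ∈ Finset.range (m1 + 1), (a k).eval x * sh1R σ1 k x) *
      (sh1R σ2 i x * w x)) ∂μ = 0 := by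
  have hW := h.weighted
  have hmem : ∀ k ∈ Finset.range (m1 + 1), k ≤ m1 := fun k hk => by
    have := Finset.mem_range.1 hk
    omega
  have hk : ∀ k ≤ m1, ContinuousOn (fun x => sh1R σ1 k x * (sh1R σ2 i x * w x)) I :=
    fun k hk => (h1 k hk).mul ((h2 i hi).mul hW.continuousOn)
  have hg : ContinuousOn (fun x => (∑ k ∈ Finset.range (m1 + 1), (a k).eval x * sh1R σ1 k x) *
      (sh1R σ2 i x * w x)) I :=
    (continuousOn_finsetSum _ fun k hk => (a k).continuous.continuousOn.mul
      (h1 k (hmem k hk))).mul ((h2 i hi).mul hW.continuousOn)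
  refine hW.toConcentrated.integral_eval_eq_zero hg (fun ν hν => ?_) hp
  obtain ⟨d, c, R, hb⟩ := ha.2.2 i hi
  have : ∀ k, ∃ E : ℝ[X], k ≤ m1 → ∀ z ∉ cSet I,
      aeval z (a k) * ct μ (fun x => sh1R σ1 k x * (sh1R σ2 i x * w x)) z = aeval z E +
        ct μ (fun x => (a k).eval x * (sh1R σ1 k x * (sh1R σ2 i x * w x))) z := by
    intro k
    by_cases hkm : k ≤ m1
    · obtain ⟨E, -, hE⟩ := hW.toConcentrated.poly_mul_ct (n1 k) (a k) (ha.2.1 k hkm) (hk k hkm)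
      exact ⟨E, fun _ => hE⟩
    · exact ⟨0, fun h => (hkm h).elim⟩
  choose E hE using this
  refine hW.toConcentrated.moment_eq_zero hν hg
    (d := d - ∑ k ∈ Finset.range (m1 + 1), E k) (C := c) (R := R) fun z hz hR => ?_
  have hz' : z ∉ cSet I := notMem_cSet_of_nonreal hz
  convert hb z hR using 2
  have e1 : ct μ (fun x => (∑ k ∈ Finset.range (m1 + 1), (a k).eval x * sh1R σ1 k x) *
      (sh1R σ2 i x * w x)) z = ∑ k ∈ Finset.range (m1 + 1),
        ct μ (fun x => (a k).eval x * (sh1R σ1 k x * (sh1R σ2 i x * w x))) z := by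
    rw [← hW.toConcentrated.ct_sum (Finset.range (m1 + 1))
      (w := fun k x => (a k).eval x * (sh1R σ1 k x * (sh1R σ2 i x * w x)))
      (fun k hk' => (a k).continuous.continuousOn.mul (hk k (hmem k hk'))) hz']
    congr 1
    ext x
    rw [Finset.sum_mul]
    exact Finset.sum_congr rfl fun k _ => by ring
  have e2 : ∀ k ∈ Finset.range (m1 + 1), (σ2 0).cintegral (fun x =>
      ((sh1R σ2 i x * sh1R σ1 k x : ℝ) : ℂ) * (z - (x : ℂ))⁻¹) =
        ct μ (fun x => sh1R σ1 k x * (sh1R σ2 i x * w x)) z := by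
    intro k hk'
    rw [h.cint (fun x => ((sh1R σ2 i x * sh1R σ1 k x : ℝ) : ℂ) * (z - (x : ℂ))⁻¹)
      ((Concentrated.continuousOn_ofReal ((h2 i hi).mul (h1 k (hmem k hk')))).mul
        (Concentrated.continuousOn_kernel hz'))]
    rw [ct]
    congr 1
    ext x
    push_cast
    ring
  rw [e1, map_sub, map_sum, sub_sub_eq_add_sub, ← Finset.sum_add_distrib]
  congr 1
  refine Finset.sum_congr rfl fun k hk' => ?_
  rw [e2 k hk', hE k (hmem k hk') z hz', add_comm]

/-- Theorem 4: there exist a permutation `λ₂` reordering `n₂` decreasingly and an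
associated Nikishin system `N(ρ₁², …, ρ_{m₂}²)` (solving Theorem 3 for
`N(σ₁², …, σ_{m₂}²)` and `n₂`) such that, with `dρ₀² = ŝ²_{1,λ₂(0)} dσ₀²` and
`r²_{0,k} = ⟨ρ₀², ρ₁², …, ρ_k²⟩`, the linear form `𝒜_n` satisfies
`∫ x^ν 𝒜_n(x) dr²_{0,k}(x) = 0` for `ν = 0, …, n_{2,λ₂(k)} − 1`, `k = 0, …, m₂`. -/
theorem stmt15
    (m1 m2 : ℕ)
    (σ1 σ2 : ℕ → SignedM) (Δ1 Δ2 : ℕ → Set ℝ)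
    (hσ1 : ∀ j ≤ m1, IsM (σ1 j) (Δ1 j))
    (hdisj1 : ∀ j, j + 1 ≤ m1 → Δ1 j ∩ Δ1 (j + 1) = ∅)
    (hσ2 : ∀ j ≤ m2, IsM (σ2 j) (Δ2 j))
    (hdisj2 : ∀ j, j + 1 ≤ m2 → Δ2 j ∩ Δ2 (j + 1) = ∅)
    (hbase : σ1 0 = σ2 0)
    (n1 n2 : ℕ → ℕ)
    (hn : ∑ j ∈ Finset.range (m1 + 1), n1 j = (∑ j ∈ Finset.range (m2 + 1), n2 j) + 1)
    (a : ℕ → Polynomial ℝ) (ha : IsMixedVP σ1 σ2 m1 m2 n1 n2 a)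
    (Ar : ℝ → ℝ)
    (hAr : ∀ x, Ar x = eval x (a 0) +
      ∑ k ∈ Finset.Icc 1 m1, eval x (a k) * (nikSys σ1 1 k).cauchyR x) :
    ∃ (e : ℕ → ℕ) (ρ : ℕ → SignedM) (Δ' : ℕ → Set ℝ),
      Set.BijOn e (Set.Iic m2) (Set.Iic m2) ∧
      (∀ j k, j ≤ k → k ≤ m2 → n2 (e k) ≤ n2 (e j)) ∧
      (∀ i, 1 ≤ i → i ≤ m2 → Δ' i ⊆ Δ2 i ∧ IsM (ρ i) (Δ' i)) ∧
      (∀ i, 1 ≤ i → i + 1 ≤ m2 → Δ' i ∩ Δ' (i + 1) = ∅) ∧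
      (∀ p : ℕ → Polynomial ℝ, (∀ k ≤ m2, (p k).degree < (n2 k : WithBot ℕ)) →
        ∃ q : ℕ → Polynomial ℝ, (∀ k ≤ m2, (q k).degree < (n2 (e k) : WithBot ℕ)) ∧
          ∀ z : ℂ, z ∉ cSet (Δ2 1) →
            aeval z (p 0) +
                ∑ k ∈ Finset.Icc 1 m2, aeval z (p k) * (nikSys σ2 1 k).cauchy z =
              (aeval z (q 0) +
                  ∑ k ∈ Finset.Icc 1 m2, aeval z (q k) * (nikSys ρ 1 k).cauchy z) *
                sh1C σ2 (e 0) z) ∧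
      ρ 0 = (σ2 0).withDensityR (sh1R σ2 (e 0)) ∧
      (∀ k ≤ m2, ∀ ν < n2 (e k),
        (nikSys ρ 0 k).rintegral (fun x => x ^ ν * Ar x) = 0) := by
  obtain ⟨μ1, w1, N1⟩ := exists_nikRep hσ1 hdisj1
  obtain ⟨μ2, w2, N2⟩ := exists_nikRep hσ2 hdisj2
  obtain ⟨μ0, w0, h0⟩ := (hσ2 0 zero_le).exists_sRep
  obtain ⟨e, S⟩ := exists_sorting m2 n2
  obtain ⟨μ, w, hw, hforms, horth⟩ :=
    N2.exists_rho S ((σ2 0).withDensityR (sh1R σ2 (e 0)))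
  set ρ := rhoSys ((σ2 0).withDensityR (sh1R σ2 (e 0))) μ w with hρ
  have Nρ : NikRep m2 ρ Δ2 μ w := nikRep_rhoSys _ hw N2.disj
  have hρ0 : ρ 0 = (σ2 0).withDensityR (sh1R σ2 (e 0)) := if_pos rfl
  have hρs : ∀ l, 1 ≤ l → ρ l = (⟨μ l, 0⟩ : SignedM).withDensityR (w l) :=
    fun l hl => if_neg (by omega)
  clear_value ρ
  have hbase' : Δ1 0 = Δ2 0 := by
    rw [(hσ1 0 zero_le).hullEq, (hσ2 0 zero_le).hullEq, hbase]
  have hK1 : ∀ k, 0 < k → k ≤ m1 → Disjoint (Δ1 (0 + 1)) (Δ2 0) := fun k hk hkm => by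
    rw [← hbase', disjoint_comm, disjoint_iff_inter_eq_empty]
    exact hdisj1 0 (by omega)
  have hK2 : ∀ k, 0 < k → k ≤ m2 → Disjoint (Δ2 (0 + 1)) (Δ2 0) := fun k hk hkm => by
    rw [disjoint_comm, disjoint_iff_inter_eq_empty]
    exact hdisj2 0 (by omega)
  have hc1 : ∀ k ≤ m1, ContinuousOn (sh1R σ1 k) (Δ2 0) := fun k hk =>
    N1.continuousOn_phiR zero_le hk fun h => hK1 k h hk
  have hc2 : ∀ k ≤ m2, ContinuousOn (sh1R σ2 k) (Δ2 0) := fun k hk =>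
    N2.continuousOn_phiR zero_le hk fun h => hK2 k h hk
  have hcρ : ∀ k ≤ m2, ContinuousOn (phiR ρ 0 k) (Δ2 0) := fun k hk =>
    Nρ.continuousOn_phiR zero_le hk fun h => hK2 k h hk
  have he0 := S.le 0 zero_le
  have hΔ' : ∀ l, ∃ D : Set ℝ, 1 ≤ l → l ≤ m2 → D ⊆ Δ2 l ∧ IsM (ρ l) D := by
    intro l
    by_cases hl : 1 ≤ l ∧ l ≤ m2
    · obtain ⟨D, hD, hM⟩ := (hw l hl.1 hl.2).isM
      exact ⟨D, fun _ _ => ⟨hD, by rwa [hρs l hl.1]⟩⟩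
    · exact ⟨∅, fun h1 h2 => (hl ⟨h1, h2⟩).elim⟩
  choose Δ' hΔ' using hΔ'
  have hAr' : ∀ x, Ar x = ∑ k ∈ Finset.range (m1 + 1), (a k).eval x * sh1R σ1 k x := by
    intro x
    rw [hAr, Finset.range_eq_Ico, Finset.sum_eq_sum_Ico_succ_bot (by omega), sh1R, if_pos rfl,
      mul_one]
    congr 1
    refine Finset.sum_congr (by ext; simp) fun k hk => ?_
    rw [sh1R, if_neg (by have := Finset.mem_Icc.1 hk; omega)]
  have hρrep : ∀ k ≤ m2, SRep (nikSys ρ 0 k) (Δ2 0) μ0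
      fun x => phiR ρ 0 k x * (sh1R σ2 (e 0) x * w0 x) := by
    intro k hk
    have h1 : SRep (ρ 0) (Δ2 0) μ0 fun x => sh1R σ2 (e 0) x * w0 x := by
      rw [hρ0]
      exact h0.withDensityR (hc2 _ he0) fun x hx => N2.phiR_ne_zero zero_le he0
        fun h hx' => (hK2 _ h he0).le_bot ⟨hx', hx⟩
    rcases Nat.eq_zero_or_pos k with rfl | hkpos
    · rw [nikSys_self]
      simpa only [phiR_self, one_mul] using h1
    · rw [nikSys_of_lt ρ hkpos]
      exact h1.withDensityR (hcρ k hk) fun x hx => Nρ.phiR_ne_zero zero_le hk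
        fun h hx' => (hK2 _ h hk).le_bot ⟨hx', hx⟩
  refine ⟨e, ρ, Δ', S.bijOn, S.anti, fun i hi him => hΔ' i hi him, fun i hi him => ?_,
    fun p hp => ?_, hρ0, fun k hk ν hν => ?_⟩
  · rw [← disjoint_iff_inter_eq_empty]
    exact (N2.disj i hi him).mono (hΔ' i hi (by omega)).1 (hΔ' (i + 1) (by omega) him).1
  · obtain ⟨q, hq, hqz⟩ := hforms p hp
    refine ⟨q, hq, fun z hz => ?_⟩
    rw [sum_phiC_eq, sum_phiC_eq, sh1C_eq]
    exact eq_of_eq_nonreal hqz (N2.continuousAt_sum p hz)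
      ((Nρ.continuousAt_sum q hz).mul (N2.continuousAt_phiC zero_le he0 fun _ => hz))
  · have hAc : ContinuousOn Ar (Δ2 0) := by
      refine ContinuousOn.congr (continuousOn_finsetSum _ fun k hk =>
        (a k).continuous.continuousOn.mul (hc1 k ?_)) fun x _ => hAr' x
      have := Finset.mem_range.1 hk
      omega
    obtain ⟨q, hq, hqz⟩ := horth k hk (X ^ ν) (by
      rw [degree_X_pow]
      exact_mod_cast hν)
    have hbρ := Nρ.hasBval (k := 0) zero_le hk fun h => hK2 k h hk
    have hb2 : ∀ t ≤ m2, HasBval (phiC σ2 0 t) (Δ2 0) ∧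
        ∀ x ∈ Δ2 0, bval (phiC σ2 0 t) x = phiR σ2 0 t x := fun t ht =>
      N2.hasBval zero_le ht fun h => hK2 t h ht
    have hprod := hbρ.1.mul (hb2 _ he0).1 (h := fun z => phiC ρ 0 k z * phiC σ2 0 (e 0) z)
      fun z _ => rfl
    have hmem : ∀ t ∈ Finset.Icc 0 m2, e t ≤ m2 := fun t ht => S.le t (Finset.mem_Icc.1 ht).2
    have hreal : ∀ x ∈ Δ2 0, x ^ ν * (phiR ρ 0 k x * sh1R σ2 (e 0) x) =
        ∑ t ∈ Finset.Icc 0 m2, (q t).eval x * sh1R σ2 (e t) x := by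
      intro x hx
      have h1 := hprod.1.eval_mul_eq_sum (Finset.Icc 0 m2) (g := fun t => phiC σ2 0 (e t))
        (fun t ht => (hb2 _ (hmem t ht)).1) hqz hx
      rw [hprod.2 x hx, hbρ.2 x hx, (hb2 _ he0).2 x hx, eval_pow, eval_X] at h1
      rw [sh1R_eq, h1]
      refine Finset.sum_congr rfl fun t ht => ?_
      rw [(hb2 _ (hmem t ht)).2 x hx, sh1R_eq]
    have hW := h0.weighted.toConcentrated
    rw [(hρrep k hk).rint (fun x => x ^ ν * Ar x)
      ((continuous_pow ν).continuousOn.mul hAc)]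
    have e1 : ∫ x, phiR ρ 0 k x * (sh1R σ2 (e 0) x * w0 x) * (x ^ ν * Ar x) ∂μ0 =
        ∫ x, ∑ t ∈ Finset.Icc 0 m2, (q t).eval x * (Ar x * (sh1R σ2 (e t) x * w0 x)) ∂μ0 := by
      refine hW.integral_congr fun x hx => ?_
      have h1 := hreal x hx
      calc phiR ρ 0 k x * (sh1R σ2 (e 0) x * w0 x) * (x ^ ν * Ar x) =
          (x ^ ν * (phiR ρ 0 k x * sh1R σ2 (e 0) x)) * (Ar x * w0 x) := by ring
        _ = _ := by
          rw [h1, Finset.sum_mul]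
          exact Finset.sum_congr rfl fun t _ => by ring
    rw [e1, integral_finsetSum]
    · refine Finset.sum_eq_zero fun t ht => ?_
      simp only [hAr']
      exact ha.integral_eq_zero h0 hc1 hc2 (hmem t ht) (hq t (Finset.mem_Icc.1 ht).2)
    · intro t ht
      exact hW.integrable ((q t).continuous.continuousOn.mul
        (hAc.mul ((hc2 _ (hmem t ht)).mul h0.weighted.continuousOn)))
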